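/- arXiv:1607.03010 — 3 statements merged into one kernel-verified Lean document; each statement's English description precedes it below -/
import Mathlib

section
/- Let G_α, α ∈ I, be nontrivial left ordered groups, let 𝓕 = *_{α∈I} G_α be their free product, and let H₁, H₂ be finitely generated factor-free subgroups of 𝓕. Then r̄(H₁ ∩ H₂) ≤ r̄(H₁) · r̄(H₂). -/
open Monoid

/-- A subgroup `H` of the free product `𝓕 = *_{α∈I} G_α` is *factor-free* if
`H ∩ s G_γ s⁻¹ = {1}` for every `s ∈ 𝓕` and every `γ ∈ I`. -/
def IsFactorFree {I : Type*} {G : I → Type*} [∀ i, Group (G i)]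
    (H : Subgroup (CoprodI G)) : Prop :=
  ∀ (s : CoprodI G) (i : I) (g : G i), s * CoprodI.of g * s⁻¹ ∈ H → g = 1


namespace HNC

section Graph
variable {V E : Type*} (s t : E → V)

/-- adjacency through an edge of `D` -/
def Adj (D : Set E) (v w : V) : Prop :=
  ∃ e ∈ D, (s e = v ∧ t e = w) ∨ (s e = w ∧ t e = v)

/-- connectedness through edges of `D` -/
def Cn (D : Set E) : V → V → Prop := Relation.ReflTransGen (Adj s t D)

variable {s t}

theorem Cn.refl {D : Set E} (v : V) : Cn s t D v v := Relation.ReflTransGen.refl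

theorem Cn.symm {D : Set E} {v w : V} (h : Cn s t D v w) : Cn s t D w v := by
  induction h with
  | refl => exact Relation.ReflTransGen.refl
  | tail _ h ih =>
    obtain ⟨e, he, h⟩ := h
    exact Relation.ReflTransGen.head ⟨e, he, h.symm⟩ ih

theorem Cn.trans {D : Set E} {u v w : V} (h : Cn s t D u v) (h' : Cn s t D v w) :
    Cn s t D u w := Relation.ReflTransGen.trans h h'

theorem Cn.mono {D D' : Set E} (hD : D ⊆ D') {v w : V} (h : Cn s t D v w) : Cn s t D' v w :=
  Relation.ReflTransGen.mono (fun _ _ ⟨e, he, h⟩ => ⟨e, hD he, h⟩) _ _ h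

theorem Cn.edge {D : Set E} {e : E} (he : e ∈ D) : Cn s t D (s e) (t e) :=
  Relation.ReflTransGen.single ⟨e, he, Or.inl ⟨rfl, rfl⟩⟩

theorem Cn.const {D : Set E} {X : Type*} (p : V → X) (hp : ∀ e ∈ D, p (s e) = p (t e))
    {v w : V} (h : Cn s t D v w) : p v = p w := by
  induction h with
  | refl => rfl
  | tail _ h ih =>
    obtain ⟨e, he, ⟨rfl, rfl⟩ | ⟨rfl, rfl⟩⟩ := h
    · rw [ih, hp e he]
    · rw [ih, hp e he]

theorem Cn.closed {D : Set E} (C : Set V) (hp : ∀ e ∈ D, s e ∈ C ↔ t e ∈ C)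
    {v w : V} (h : Cn s t D v w) (hv : v ∈ C) : w ∈ C := by
  have := Cn.const (fun v => v ∈ C) (fun e he => propext (hp e he)) h
  exact this ▸ hv

theorem Cn.delete {D : Set E} {v w : V} (h : Cn s t D v w) (e : E) :
    Cn s t (D \ {e}) v w ∨ (Cn s t (D \ {e}) v (s e) ∧ Cn s t (D \ {e}) (t e) w) ∨
      (Cn s t (D \ {e}) v (t e) ∧ Cn s t (D \ {e}) (s e) w) := by
  induction h with
  | refl => exact Or.inl (Cn.refl _)
  | @tail b c _ h ih =>
    obtain ⟨e', he', h⟩ := h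
    by_cases hee : e' = e
    · subst hee
      rcases h with ⟨rfl, rfl⟩ | ⟨rfl, rfl⟩
      · rcases ih with h1 | ⟨h1, h2⟩ | ⟨h1, h2⟩
        · exact Or.inr (Or.inl ⟨h1, Cn.refl _⟩)
        · exact Or.inr (Or.inl ⟨h1, Cn.refl _⟩)
        · exact Or.inl h1
      · rcases ih with h1 | ⟨h1, h2⟩ | ⟨h1, h2⟩
        · exact Or.inr (Or.inr ⟨h1, Cn.refl _⟩)
        · exact Or.inl h1
        · exact Or.inr (Or.inr ⟨h1, Cn.refl _⟩)
    · have hbc : Cn s t (D \ {e}) b c :=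
        Relation.ReflTransGen.single ⟨e', ⟨he', hee⟩, h⟩
      rcases ih with h1 | ⟨h1, h2⟩ | ⟨h1, h2⟩
      · exact Or.inl (h1.trans hbc)
      · exact Or.inr (Or.inl ⟨h1, h2.trans hbc⟩)
      · exact Or.inr (Or.inr ⟨h1, h2.trans hbc⟩)

theorem Cn.exists_finite {D : Set E} {v w : V} (h : Cn s t D v w) :
    ∃ F : Set E, F.Finite ∧ F ⊆ D ∧ Cn s t F v w := by
  induction h with
  | refl => exact ⟨∅, Set.finite_empty, Set.empty_subset _, Cn.refl _⟩
  | @tail b c _ h ih =>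
    obtain ⟨e, he, h⟩ := h
    obtain ⟨F, hF, hFD, hc⟩ := ih
    refine ⟨insert e F, hF.insert e, Set.insert_subset he hFD, ?_⟩
    exact (hc.mono (Set.subset_insert _ _)).trans
      (Relation.ReflTransGen.single ⟨e, Set.mem_insert _ _, h⟩)

theorem Cn.first {D : Set E} {v w : V} (h : Cn s t D v w) (hne : v ≠ w) :
    ∃ e ∈ D, s e = v ∨ t e = v := by
  rcases Relation.ReflTransGen.cases_head h with h | ⟨c, ⟨e, he, h⟩, _⟩
  · exact absurd h hne
  · exact ⟨e, he, h.imp And.left And.right⟩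

theorem Cn.map {V' E' : Type*} {s' t' : E' → V'} (jV : V → V') (jE : E → E')
    (hs : ∀ e, s' (jE e) = jV (s e)) (ht : ∀ e, t' (jE e) = jV (t e))
    {D : Set E} {D' : Set E'} (hD : ∀ e ∈ D, jE e ∈ D') {v w : V} (h : Cn s t D v w) :
    Cn s' t' D' (jV v) (jV w) := by
  induction h with
  | refl => exact Cn.refl _
  | tail _ h ih =>
    obtain ⟨e, he, ⟨rfl, rfl⟩ | ⟨rfl, rfl⟩⟩ := h
    · refine ih.trans ?_
      rw [← hs, ← ht]; exact Cn.edge (hD e he)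
    · refine ih.trans ?_
      rw [← hs, ← ht]; exact (Cn.edge (hD e he)).symm

variable (s t) in
/-- every mod 2 edge function is a coboundary (the graph is a forest) -/
def Pot : Prop := ∀ c : E → ZMod 2, ∃ p : V → ZMod 2, ∀ e, p (s e) + p (t e) = c e

theorem z2_ne {a b : ZMod 2} (h : a + b = 1) : a ≠ b := by revert a b; decide
theorem z2_eq {a b : ZMod 2} (h : a + b = 0) : a = b := by revert a b; decide
theorem z2_three {a b c : ZMod 2} (h : a ≠ c) (h' : b ≠ c) : a = b := by revert a b c; decide

variable (s t) in
/-- side functions of edges -/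
structure Side (χ : E → V → ZMod 2) : Prop where
  ne : ∀ e, χ e (s e) ≠ χ e (t e)
  eq : ∀ e e', e' ≠ e → χ e (s e') = χ e (t e')

theorem Pot.side (h : Pot s t) : ∃ χ, Side s t χ := by
  classical
  choose χ hχ using fun e : E => h (fun e' => if e' = e then 1 else 0)
  refine ⟨χ, ⟨fun e => z2_ne ?_, fun e e' hee => z2_eq ?_⟩⟩
  · simpa using hχ e e
  · simpa [hee] using hχ e e'

variable {χ : E → V → ZMod 2}

theorem Side.cn (hχ : Side s t χ) {D : Set E} {e : E} (he : e ∉ D) {v w : V}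
    (h : Cn s t D v w) : χ e v = χ e w :=
  Cn.const (χ e) (fun f hf => hχ.eq e f (fun h => he (h ▸ hf))) h

/-- The separating edges already connect. -/
theorem Side.sep (hχ : Side s t χ) {D : Set E} {v w : V} (h : Cn s t D v w) :
    Cn s t {e ∈ D | χ e v ≠ χ e w} v w := by
  induction h with
  | refl => exact Cn.refl _
  | @tail b c _ h ih =>
    obtain ⟨e, he, h⟩ := h
    have hbc : χ e b ≠ χ e c := by
      rcases h with ⟨rfl, rfl⟩ | ⟨rfl, rfl⟩
      · exact hχ.ne e
      · exact (hχ.ne e).symm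
    have hbc' : ∀ e', e' ≠ e → χ e' b = χ e' c := by
      intro e' hne
      rcases h with ⟨rfl, rfl⟩ | ⟨rfl, rfl⟩
      · exact hχ.eq e' e hne.symm
      · exact (hχ.eq e' e hne.symm).symm
    by_cases hvb : χ e v = χ e b
    · have h1 : Cn s t {e ∈ D | χ e v ≠ χ e c} v b := by
        refine ih.mono ?_
        rintro e' ⟨he', hne⟩
        refine ⟨he', ?_⟩
        have : e' ≠ e := by rintro rfl; exact hne hvb
        rwa [← hbc' e' this]
      exact h1.trans (Relation.ReflTransGen.single ⟨e, ⟨he, hvb ▸ hbc⟩, h⟩)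
    · have hsub : ({e ∈ D | χ e v ≠ χ e b} \ {e}) ⊆ {e ∈ D | χ e v ≠ χ e c} := by
        rintro e' ⟨⟨he', hne⟩, hee⟩
        refine ⟨he', ?_⟩
        rwa [← hbc' e' hee]
      have key : Cn s t ({e ∈ D | χ e v ≠ χ e b} \ {e}) v c := by
        have hno : ∀ x y, Cn s t ({e ∈ D | χ e v ≠ χ e b} \ {e}) x y → χ e x = χ e y :=
          fun x y hxy => hχ.cn (by simp) hxy
        rcases h with ⟨rfl, rfl⟩ | ⟨rfl, rfl⟩
        · rcases ih.delete e with h1 | ⟨h1, h2⟩ | ⟨h1, h2⟩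
          · exact absurd (hno _ _ h1) hvb
          · exact absurd (hno _ _ h1) hvb
          · exact h1
        · rcases ih.delete e with h1 | ⟨h1, h2⟩ | ⟨h1, h2⟩
          · exact absurd (hno _ _ h1) hvb
          · exact h1
          · exact absurd (hno _ _ h1) hvb
      exact key.mono hsub

theorem Side.inter (hχ : Side s t χ) {D D' : Set E} {v w : V} (h : Cn s t D v w)
    (h' : Cn s t D' v w) : Cn s t (D ∩ D') v w := by
  refine (hχ.sep h).mono ?_
  rintro e ⟨he, hne⟩
  refine ⟨he, ?_⟩
  by_contra hc
  have h_eq := hχ.cn hc h'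
  exact hne h_eq

/-- Two different edges at `v` cannot both separate `v` from `x`. -/
theorem Side.unique_first (hχ : Side s t χ) {D : Set E} {v x : V} (h : Cn s t D v x) {e e' : E}
    (hne : e ≠ e') (he : s e = v ∨ t e = v) (he' : s e' = v ∨ t e' = v)
    (h1 : χ e v ≠ χ e x) (h2 : χ e' v ≠ χ e' x) : False := by
  -- other endpoint of `e`
  have key : ∀ (e : E), (s e = v ∨ t e = v) → ∀ {D : Set E} {u : V}, Cn s t D u x → χ e u = χ e v →
      χ e v ≠ χ e x → ∃ w, (s e = v ∧ t e = w ∨ s e = w ∧ t e = v) ∧ Cn s t (D \ {e}) u v ∧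
        Cn s t (D \ {e}) w x := by
    intro e he D u hu huv hvx
    have hno : ∀ a b, Cn s t (D \ {e}) a b → χ e a = χ e b := fun a b hab => hχ.cn (by simp) hab
    have hst := hχ.ne e
    rcases hu.delete e with h | ⟨h3, h4⟩ | ⟨h3, h4⟩
    · exact absurd (huv.symm.trans (hno _ _ h)) hvx
    · rcases he with rfl | rfl
      · exact ⟨t e, Or.inl ⟨rfl, rfl⟩, h3, h4⟩
      · exact absurd (hno _ _ h4) hvx
    · rcases he with rfl | rfl
      · exact absurd (hno _ _ h4) hvx
      · exact ⟨s e, Or.inr ⟨rfl, rfl⟩, h3, h4⟩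
  obtain ⟨w, hw, -, hwx⟩ := key e he h rfl h1
  have hwv : χ e' w = χ e' v := by
    rcases hw with ⟨h3, h4⟩ | ⟨h3, h4⟩
    · rw [← h3, ← h4]; exact (hχ.eq e' e hne).symm
    · rw [← h3, ← h4]; exact (hχ.eq e' e hne)
  obtain ⟨w', -, h5, -⟩ := key e' he' hwx hwv h2
  have h6 : χ e w = χ e v := hχ.cn (by simp) h5
  rcases hw with ⟨h3, h4⟩ | ⟨h3, h4⟩
  · rw [← h3, ← h4] at h6; exact hχ.ne e h6.symm
  · rw [← h3, ← h4] at h6; exact hχ.ne e h6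

end Graph

end HNC


namespace HNC

section Flow
variable {V E H : Type*} [Group H] [MulAction H V] [MulAction H E] [LinearOrder E] {s t : E → V}

variable (H s t) in
/-- free order preserving action of `H` on a connected graph -/
structure Act : Prop where
  hs : ∀ (h : H) (e : E), s (h • e) = h • s e
  ht : ∀ (h : H) (e : E), t (h • e) = h • t e
  lt : ∀ (h : H) (a b : E), a < b → h • a < h • b
  free : ∀ (h : H) (v : V), h • v = v → h = 1
  conn : ∀ v w : V, Cn s t Set.univ v w

theorem Act.le (A : Act H s t) (h : H) {a b : E} (hab : a ≤ b) : h • a ≤ h • b := by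
  rcases hab.eq_or_lt with rfl | hab
  · exact le_rfl
  · exact (A.lt h a b hab).le

theorem Act.cn (A : Act H s t) (h : H) {D D' : Set E} (hD : ∀ e ∈ D, h • e ∈ D') {v w : V}
    (hc : Cn s t D v w) : Cn s t D' (h • v) (h • w) :=
  Cn.map (fun v => h • v) (fun e => h • e) (A.hs h) (A.ht h) hD hc

theorem Act.freeE (A : Act H s t) (h : H) (e : E) (he : h • e = e) : h = 1 :=
  A.free h (s e) (by rw [← A.hs, he])

theorem Act.lt_or (A : Act H s t) {h : H} (hh : h ≠ 1) (e : E) : h • e < e ∨ h⁻¹ • e < e := by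
  rcases lt_trichotomy (h • e) e with h1 | h1 | h1
  · exact Or.inl h1
  · exact absurd (A.freeE h e h1) hh
  · right
    simpa using A.lt h⁻¹ _ _ h1

theorem Act.pow_inj (A : Act H s t) {h : H} {e : E} (he : h • e < e) (u : V) :
    Function.Injective (fun n : ℕ => h ^ n • u) := by
  have h1 : StrictAnti (fun n : ℕ => h ^ n • e) := by
    refine strictAnti_nat_of_succ_lt fun n => ?_
    have := A.lt (h ^ n) _ _ he
    rwa [smul_smul, ← pow_succ] at this
  intro a b hab
  apply h1.injective
  have h2 : (h ^ b)⁻¹ * h ^ a = 1 := A.free _ u (by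
    simp only at hab
    rw [mul_smul, hab, inv_smul_smul])
  have h3 : h ^ a = h ^ b := (inv_mul_eq_one.mp h2).symm
  simp only [h3]

theorem Act.infinite_comp (A : Act H s t) {h : H} {e : E} (he : h • e < e) {u : V}
    (hc : Cn s t (Set.Iic e) u (h • u)) : {w | Cn s t (Set.Iic e) u w}.Infinite := by
  refine Set.infinite_of_injective_forall_mem (A.pow_inj he u) fun n => ?_
  have hle : ∀ n : ℕ, h ^ n • e ≤ e := by
    intro n
    induction n with
    | zero => simp
    | succ n ih => rw [pow_succ, mul_smul]; exact (A.le _ he.le).trans ih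
  show Cn s t (Set.Iic e) u (h ^ n • u)
  induction n with
  | zero => simpa using Cn.refl u
  | succ n ih =>
    refine ih.trans ?_
    rw [pow_succ, mul_smul]
    exact A.cn (h ^ n) (D := Set.Iic e) (D' := Set.Iic e)
      (fun e' he' => (A.le (h ^ n) (Set.mem_Iic.mp he')).trans (hle n)) hc

theorem Act.locfin (A : Act H s t) [Finite (MulAction.orbitRel.Quotient H E)] (v : V) :
    {e | s e = v ∨ t e = v}.Finite := by
  have key : ∀ (σ : E → V), (∀ (h : H) e, σ (h • e) = h • σ e) → {e | σ e = v}.Finite := by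
    intro σ hσ
    refine Set.Finite.of_finite_image
      (f := fun e => (Quotient.mk _ e : MulAction.orbitRel.Quotient H E)) (Set.toFinite _) ?_
    intro e he e' he' hee
    obtain ⟨h, hh⟩ := (Quotient.exact hee : MulAction.orbitRel H E e e')
    simp only at hh
    have : h = 1 := by
      apply A.free h v
      conv_lhs => rw [← (show σ e' = v from he'), ← hσ, hh]
      exact he
    rw [← hh, this, one_smul]
  exact (key s A.hs).union (key t A.ht)

theorem Act.finV (A : Act H s t) [Finite (MulAction.orbitRel.Quotient H E)] :
    Finite (MulAction.orbitRel.Quotient H V) := by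
  have key : ∀ (σ : E → V), (∀ (h : H) e, σ (h • e) = h • σ e) →
      (Set.range fun e => (Quotient.mk _ (σ e) : MulAction.orbitRel.Quotient H V)).Finite := by
    intro σ hσ
    let f : MulAction.orbitRel.Quotient H E → MulAction.orbitRel.Quotient H V :=
      Quotient.map σ (by
        rintro a b ⟨h, rfl⟩
        exact ⟨h, (hσ h b).symm⟩)
    refine (Set.finite_range f).subset ?_
    rintro _ ⟨e, rfl⟩
    exact ⟨Quotient.mk _ e, rfl⟩
  rcases isEmpty_or_nonempty V with hV | ⟨⟨v0⟩⟩
  · infer_instance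
  rw [← Set.finite_univ_iff]
  refine (((key s A.hs).union (key t A.ht)).insert (Quotient.mk _ v0)).subset ?_
  intro q _
  induction q using Quotient.inductionOn with
  | h v =>
    by_cases hv : v = v0
    · left; rw [hv]
    · right
      obtain ⟨e, -, rfl | rfl⟩ := (A.conn v v0).first hv
      · exact Or.inl ⟨e, rfl⟩
      · exact Or.inr ⟨e, rfl⟩

theorem exists_bound {A : Set E} (e0 : E) (he0 : e0 ∈ A) {v w : V}
    (h : Cn s t A v w) : ∃ e ∈ A, Cn s t (Set.Iic e) v w := by
  induction h with
  | refl => exact ⟨e0, he0, Cn.refl _⟩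
  | tail _ h ih =>
    obtain ⟨e, he, h⟩ := h
    obtain ⟨e', he', hc⟩ := ih
    refine ⟨max e e', ?_, ?_⟩
    · rcases max_choice e e' with h | h <;> rw [h] <;> assumption
    · exact (hc.mono (Set.Iic_subset_Iic.mpr (le_max_right _ _))).trans
        (Relation.ReflTransGen.single ⟨e, le_max_left _ _, h⟩)

theorem Act.infV (A : Act H s t) [Nontrivial H] [Nonempty V] : Infinite V := by
  obtain ⟨v⟩ := ‹Nonempty V›
  obtain ⟨h, hh⟩ := exists_ne (1 : H)
  have hv : h • v ≠ v := fun hc => hh (A.free h v hc)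
  obtain ⟨e, -, -⟩ := (A.conn _ _).first hv
  rcases A.lt_or hh e with h1 | h1
  · exact Infinite.of_injective _ (A.pow_inj h1 v)
  · exact Infinite.of_injective _ (A.pow_inj h1 v)

/-- existence of the critical edge of a vertex -/
theorem Act.exists_crit (A : Act H s t) [Finite (MulAction.orbitRel.Quotient H E)] [Nontrivial H]
    (v : V) : ∃ f : E, {w | Cn s t (Set.Iic f) v w}.Infinite ∧
      {w | Cn s t (Set.Iio f) v w}.Finite := by
  have : Nonempty V := ⟨v⟩
  have := A.infV
  have := A.finV
  by_contra hcon
  push Not at hcon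
  set 𝒜 : Set E := {f | {w | Cn s t (Set.Iio f) v w}.Finite} with h𝒜
  have hdown : ∀ a ∈ 𝒜, ∀ b, b ≤ a → b ∈ 𝒜 := by
    intro a ha b hb
    exact Set.Finite.subset ha (fun w hw => hw.mono (Set.Iio_subset_Iio hb))
  have hAfin : ∀ f ∈ 𝒜, {w | Cn s t (Set.Iic f) v w}.Finite := by
    intro f hf
    by_contra hc
    exact hcon f hc hf
  by_cases hC : {w | Cn s t 𝒜 v w}.Finite
  · -- boundary edges
    set C := {w | Cn s t 𝒜 v w} with hCdef
    set B : Set E := {e | ¬ (s e ∈ C ↔ t e ∈ C)} with hB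
    have hBfin : B.Finite := by
      refine (hC.biUnion fun w _ => A.locfin w).subset ?_
      intro e he
      simp only [Set.mem_iUnion]
      by_cases h1 : s e ∈ C
      · exact ⟨s e, h1, Or.inl rfl⟩
      · by_cases h2 : t e ∈ C
        · exact ⟨t e, h2, Or.inr rfl⟩
        · exact absurd (by tauto) he
    have hBne : B.Nonempty := by
      by_contra hne
      rw [Set.not_nonempty_iff_eq_empty] at hne
      have : ∀ w, w ∈ C := by
        intro w
        refine (A.conn v w).closed C (fun e _ => ?_) (Cn.refl v)
        by_contra hc
        have : e ∈ B := hc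
        rw [hne] at this
        exact this
      exact Set.infinite_univ (hC.subset fun w _ => this w)
    obtain ⟨f, hf, hmin⟩ := Set.exists_min_image B id hBfin hBne
    have hfA : f ∈ 𝒜 := by
      refine hC.subset ?_
      intro w hw
      refine Cn.closed C (fun e he => ?_) hw (Cn.refl v)
      by_contra hc
      exact absurd (hmin e hc) (not_le.mpr he)
    apply hf
    have hfe : Cn s t 𝒜 (s f) (t f) := Cn.edge hfA
    exact ⟨fun h => Cn.trans h hfe, fun h => Cn.trans h hfe.symm⟩
  · -- pigeonhole
    have hninj : ¬ Set.InjOn (fun w => (Quotient.mk _ w : MulAction.orbitRel.Quotient H V))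
        {w | Cn s t 𝒜 v w} := by
      intro hinj
      exact hC (Set.Finite.of_finite_image (Set.toFinite _) hinj)
    simp only [Set.InjOn] at hninj
    push Not at hninj
    obtain ⟨u, hu, u', hu', hq, hne⟩ := hninj
    obtain ⟨h, hh⟩ := (Quotient.exact hq : MulAction.orbitRel H V u u')
    simp only at hh
    have hh1 : h ≠ 1 := by
      rintro rfl
      exact hne (by rw [← hh, one_smul])
    have huu : Cn s t 𝒜 u' u := (Cn.symm hu').trans hu
    obtain ⟨e0, he0, -⟩ := huu.first hne.symm
    obtain ⟨e1, he1, hc1⟩ := exists_bound e0 he0 huu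
    obtain ⟨e2, he2, hc2⟩ := exists_bound e0 he0 hu'
    have hmax : max e1 e2 ∈ 𝒜 := by
      rcases max_choice e1 e2 with h | h <;> rw [h] <;> assumption
    refine absurd (hAfin _ hmax) ?_
    have hc1' := hc1.mono (Set.Iic_subset_Iic.mpr (le_max_left e1 e2))
    have hc2' := hc2.mono (Set.Iic_subset_Iic.mpr (le_max_right e1 e2))
    rcases A.lt_or hh1 (max e1 e2) with hlt | hlt
    · rw [← hh] at hc1'
      refine (A.infinite_comp hlt hc1').mono ?_
      intro w hw
      exact hc2'.trans hw
    · have : u' = h⁻¹ • u := by rw [← hh, inv_smul_smul]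
      have hc3 := hc1'.symm
      rw [this] at hc3
      refine (A.infinite_comp hlt hc3).mono ?_
      intro w hw
      exact (hc2'.trans hc1').trans hw

variable (s t) in
/-- critical edge -/
def Crit (v : V) (f : E) : Prop := {w | Cn s t (Set.Iic f) v w}.Infinite ∧
      {w | Cn s t (Set.Iio f) v w}.Finite

variable (s t) in
/-- essential edges -/
def Ess : Set E := {e | {w | Cn s t (Set.Iio e) (s e) w}.Infinite ∧
  {w | Cn s t (Set.Iio e) (t e) w}.Infinite}

theorem Crit.le {v : V} {f : E} (h : Crit s t v f) {e : E}
    (he : {w | Cn s t (Set.Iic e) v w}.Infinite) : f ≤ e := by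
  by_contra hc
  push Not at hc
  exact he (h.2.subset fun w hw => hw.mono fun x hx => lt_of_le_of_lt hx hc)

theorem Crit.unique {v : V} {f f' : E} (h : Crit s t v f) (h' : Crit s t v f') : f = f' :=
  le_antisymm (h.le h'.1) (h'.le h.1)

theorem Crit.cn {v w : V} {f : E} (h : Crit s t v f) (hvw : Cn s t (Set.Iio f) v w) :
    Crit s t w f := by
  have h2 : Cn s t (Set.Iic f) v w := hvw.mono fun x hx => le_of_lt hx
  exact ⟨h.1.mono fun x hx => h2.symm.trans hx, h.2.subset fun x hx => hvw.trans hx⟩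

theorem iic_diff (f : E) : Set.Iic f \ {f} = Set.Iio f := by
  ext x; simp [lt_iff_le_and_ne]

/-- the critical edge has an endpoint close to `v` -/
theorem Crit.near {v : V} {f : E} (h : Crit s t v f) :
    ∃ v', (v' = s f ∨ v' = t f) ∧ Cn s t (Set.Iio f) v v' := by
  by_contra hc
  push Not at hc
  refine h.1 (h.2.subset fun w hw => ?_)
  have := Cn.delete hw f
  rw [iic_diff] at this
  rcases this with h1 | h1 | h1
  · exact h1
  · exact absurd h1.1 (hc _ (Or.inl rfl))
  · exact absurd h1.1 (hc _ (Or.inr rfl))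

theorem Act.crit (A : Act H s t) {v : V} {f : E} (h : Crit s t v f) (g : H) :
    Crit s t (g • v) (g • f) := by
  constructor
  · have h1 := h.1.image (f := fun w => g • w) ((MulAction.injective g).injOn)
    refine h1.mono ?_
    rintro _ ⟨w, hw, rfl⟩
    exact A.cn g (D := Set.Iic f) (D' := Set.Iic (g • f))
      (fun e he => A.le g (Set.mem_Iic.mp he)) hw
  · refine (h.2.image (fun w => g • w)).subset ?_
    intro w hw
    refine ⟨g⁻¹ • w, ?_, by simp⟩
    have : Cn s t (Set.Iio f) (g⁻¹ • g • v) (g⁻¹ • w) :=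
      A.cn g⁻¹ (fun e he => by simpa using A.lt g⁻¹ _ _ he) hw
    simpa using this

variable (s t) in
/-- the matching between vertices and non-essential edges -/
def Mt (χ : E → V → ZMod 2) (v : V) (e : E) : Prop :=
  (s e = v ∨ t e = v) ∧ ∃ f, Crit s t v f ∧ (e = f ∨ (e < f ∧ χ e v ≠ χ e (s f)))

variable {χ : E → V → ZMod 2}

theorem Mt.exists_edge (hχ : Side s t χ) {v : V} {f : E} (h : Crit s t v f) :
    ∃ e, Mt s t χ v e := by
  obtain ⟨v', hv', hc⟩ := h.near
  by_cases hvv : v = v'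
  · refine ⟨f, ?_, f, h, Or.inl rfl⟩
    rw [hvv]; exact hv'.imp Eq.symm Eq.symm
  · obtain ⟨e, ⟨he1, he2⟩, he3⟩ := (hχ.sep hc).first hvv
    refine ⟨e, he3, f, h, Or.inr ⟨he1, ?_⟩⟩
    have : χ e v' = χ e (s f) := by
      rcases hv' with rfl | rfl
      · rfl
      · exact (hχ.eq e f (ne_of_gt he1)).symm
    rwa [← this]

theorem Mt.unique_edge (A : Act H s t) (hχ : Side s t χ) {v : V} {e e' : E}
    (h : Mt s t χ v e) (h' : Mt s t χ v e') : e = e' := by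
  obtain ⟨h1, f, hf, h2⟩ := h
  obtain ⟨h1', f', hf', h2'⟩ := h'
  obtain rfl := hf.unique hf'
  by_contra hne
  have aux : ∀ {e : E}, (s f = v ∨ t f = v) → e < f → χ e v ≠ χ e (s f) → False := by
    intro e hv hlt hc
    rcases hv with rfl | rfl
    · exact hc rfl
    · exact hc (hχ.eq e f (ne_of_gt hlt)).symm
  rcases h2 with rfl | ⟨h2, h3⟩
  · rcases h2' with rfl | ⟨h2', h3'⟩
    · exact hne rfl
    · exact aux h1 h2' h3'
  · rcases h2' with rfl | ⟨h2', h3'⟩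
    · exact aux h1' h2 h3
    · exact hχ.unique_first (A.conn v (s f)) hne h1 h1' h3 h3'

theorem Mt.not_ess {v : V} {e : E} (h : Mt s t χ v e) : e ∉ Ess s t := by
  obtain ⟨h1, f, hf, h2⟩ := h
  have hfin : {w | Cn s t (Set.Iio e) v w}.Finite := by
    have : e ≤ f := by
      rcases h2 with rfl | ⟨h2, -⟩
      · exact le_rfl
      · exact h2.le
    exact hf.2.subset fun w hw => hw.mono (Set.Iio_subset_Iio this)
  rintro ⟨h3, h4⟩
  rcases h1 with rfl | rfl
  · exact h3 hfin
  · exact h4 hfin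

theorem Mt.exists_vertex (hχ : Side s t χ) (hcrit : ∀ v, ∃ f, Crit s t v f) {e : E}
    (he : e ∉ Ess s t) : ∃ v, Mt s t χ v e := by
  have key : ∀ v w, (s e = v ∧ t e = w ∨ s e = w ∧ t e = v) →
      {x | Cn s t (Set.Iio e) v x}.Finite → ∃ v, Mt s t χ v e := by
    intro v w hvw hfin
    have hv : s e = v ∨ t e = v := by tauto
    have hw : s e = w ∨ t e = w := by tauto
    have hadj : Cn s t {e} v w := Relation.ReflTransGen.single ⟨e, rfl, hvw⟩
    obtain ⟨f, hf⟩ := hcrit v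
    have hle : e ≤ f := by
      by_contra hc
      push Not at hc
      exact hf.1 (hfin.subset fun x hx => hx.mono fun y hy => lt_of_le_of_lt hy hc)
    rcases hle.eq_or_lt with rfl | hlt
    · exact ⟨v, hv, e, hf, Or.inl rfl⟩
    · have hfw : Crit s t w f := hf.cn (hadj.mono (by
        intro x hx; rw [Set.mem_singleton_iff.mp hx]; exact hlt))
      by_cases hvf : χ e v = χ e (s f)
      · refine ⟨w, hw, f, hfw, Or.inr ⟨hlt, ?_⟩⟩
        rw [← hvf]
        rcases hvw with ⟨rfl, rfl⟩ | ⟨rfl, rfl⟩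
        · exact (hχ.ne e).symm
        · exact hχ.ne e
      · exact ⟨v, hv, f, hf, Or.inr ⟨hlt, hvf⟩⟩
  by_cases h1 : {w | Cn s t (Set.Iio e) (s e) w}.Infinite
  · have h2 : ¬ {w | Cn s t (Set.Iio e) (t e) w}.Infinite := fun h2 => he ⟨h1, h2⟩
    exact key (t e) (s e) (Or.inr ⟨rfl, rfl⟩) (Set.not_infinite.mp h2)
  · exact key (s e) (t e) (Or.inl ⟨rfl, rfl⟩) (Set.not_infinite.mp h1)

theorem Mt.unique_vertex (hχ : Side s t χ) {v w : V} {e : E}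
    (h : Mt s t χ v e) (h' : Mt s t χ w e) : v = w := by
  by_contra hne
  obtain ⟨h1, f, hf, h2⟩ := h
  obtain ⟨h1', f', hf', h2'⟩ := h'
  have hvw : s e = v ∧ t e = w ∨ s e = w ∧ t e = v := by
    rcases h1 with rfl | rfl <;> rcases h1' with rfl | rfl <;> simp_all
  have hadj : Cn s t {e} v w := Relation.ReflTransGen.single ⟨e, rfl, hvw⟩
  have hχne : χ e v ≠ χ e w := by
    rcases hvw with ⟨rfl, rfl⟩ | ⟨rfl, rfl⟩
    · exact hχ.ne e
    · exact (hχ.ne e).symm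
  have hlow : ∀ {f}, e < f → Cn s t (Set.Iio f) v w := fun {f} hlt => hadj.mono (by
        intro x hx; rw [Set.mem_singleton_iff.mp hx]; exact hlt)
  rcases h2 with rfl | ⟨h2, h3⟩
  · rcases h2' with rfl | ⟨h2', h3'⟩
    · refine hf.1 ((hf.2.union hf'.2).subset ?_)
      intro x hx
      have := Cn.delete hx e
      rw [iic_diff] at this
      rcases this with h | ⟨h3, h4⟩ | ⟨h3, h4⟩
      · exact Or.inl h
      · rcases hvw with ⟨rfl, rfl⟩ | ⟨rfl, rfl⟩
        · exact Or.inr h4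
        · exact Or.inl h4
      · rcases hvw with ⟨rfl, rfl⟩ | ⟨rfl, rfl⟩
        · exact Or.inl h4
        · exact Or.inr h4
    · have := hf'.cn (hlow h2').symm
      exact absurd (hf.unique this) (ne_of_lt h2')
  · rcases h2' with rfl | ⟨h2', h3'⟩
    · have := hf.cn (hlow h2)
      exact absurd (hf'.unique this) (ne_of_lt h2)
    · obtain rfl := (hf.cn (hlow h2)).unique hf'
      exact hχne (z2_three h3 h3')

theorem Act.side_iff (A : Act H s t) (hχ : Side s t χ) (e : E) (v x : V) :
    χ e v = χ e x ↔ Cn s t (Set.univ \ {e}) v x := by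
  constructor
  · intro h
    have hno : ∀ a b, Cn s t (Set.univ \ {e}) a b → χ e a = χ e b :=
      fun a b hab => hχ.cn (by simp) hab
    rcases (A.conn v x).delete e with h1 | ⟨h1, h2⟩ | ⟨h1, h2⟩
    · exact h1
    · exact absurd ((hno _ _ h1).symm.trans (h.trans (hno _ _ h2).symm)) (hχ.ne e)
    · exact absurd ((hno _ _ h1).symm.trans (h.trans (hno _ _ h2).symm)) (hχ.ne e).symm
  · exact fun h => hχ.cn (by simp) h

theorem Act.mt (A : Act H s t) (hχ : Side s t χ) {v : V} {e : E} (h : Mt s t χ v e) (g : H) :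
    Mt s t χ (g • v) (g • e) := by
  obtain ⟨h1, f, hf, h2⟩ := h
  refine ⟨?_, g • f, A.crit hf g, ?_⟩
  · rcases h1 with rfl | rfl
    · exact Or.inl (A.hs g e)
    · exact Or.inr (A.ht g e)
  · rcases h2 with rfl | ⟨h2, h3⟩
    · exact Or.inl rfl
    · refine Or.inr ⟨A.lt g _ _ h2, ?_⟩
      rw [ne_eq, A.hs, A.side_iff hχ] at *
      intro hc
      apply h3
      have := A.cn g⁻¹ (D' := Set.univ \ {e}) (fun e' he' => ⟨trivial, ?_⟩) hc
      · simpa using this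
      · rintro h4
        apply he'.2
        rw [← (show g⁻¹ • e' = e from h4)]
        simp

theorem Act.card_V (A : Act H s t) (hp : Pot s t) [Finite (MulAction.orbitRel.Quotient H E)]
    [Nontrivial H] :
    Nat.card (MulAction.orbitRel.Quotient H V) =
      Set.ncard ((fun e => (Quotient.mk _ e : MulAction.orbitRel.Quotient H E)) '' (Ess s t)ᶜ) := by
  obtain ⟨χ, hχ⟩ := hp.side
  have hcrit : ∀ v, ∃ f, Crit s t v f := A.exists_crit
  have hex : ∀ v, ∃ e, Mt s t χ v e := fun v => by
    obtain ⟨f, hf⟩ := hcrit v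
    exact Mt.exists_edge hχ hf
  choose φ hφ using hex
  rw [← Nat.card_coe_set_eq]
  have hwd : ∀ a b : V, (MulAction.orbitRel H V) a b → 
      (Quotient.mk _ (φ a) : MulAction.orbitRel.Quotient H E) = Quotient.mk _ (φ b) := by
    rintro a b ⟨g, rfl⟩
    refine Quotient.sound ⟨g, ?_⟩
    exact Mt.unique_edge A hχ (A.mt hχ (hφ b) g) (hφ (g • b))
  let F : MulAction.orbitRel.Quotient H V →
      ((fun e => (Quotient.mk _ e : MulAction.orbitRel.Quotient H E)) '' (Ess s t)ᶜ) :=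
    Quotient.lift (fun v => ⟨Quotient.mk _ (φ v), φ v, (hφ v).not_ess, rfl⟩)
      (fun a b hab => Subtype.ext (hwd a b hab))
  refine Nat.card_congr (Equiv.ofBijective F ⟨?_, ?_⟩)
  · intro q q'
    induction q using Quotient.inductionOn with
    | h v =>
    induction q' using Quotient.inductionOn with
    | h w =>
    intro h
    have h1 : (Quotient.mk _ (φ v) : MulAction.orbitRel.Quotient H E) = Quotient.mk _ (φ w) :=
      congrArg Subtype.val h
    obtain ⟨g, hg⟩ := (Quotient.exact h1 : MulAction.orbitRel H E _ _)
    simp only at hg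
    refine Quotient.sound ⟨g, ?_⟩
    have h2 := A.mt hχ (hφ w) g
    rw [hg] at h2
    exact Mt.unique_vertex hχ h2 (hφ v)
  · rintro ⟨_, e, he, rfl⟩
    obtain ⟨v, hv⟩ := Mt.exists_vertex hχ hcrit he
    refine ⟨Quotient.mk _ v, Subtype.ext ?_⟩
    show (Quotient.mk _ (φ v) : MulAction.orbitRel.Quotient H E) = Quotient.mk _ e
    rw [Mt.unique_edge A hχ hv (hφ v)]

theorem Act.ess (A : Act H s t) {e : E} (he : e ∈ Ess s t) (g : H) : g • e ∈ Ess s t := by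
  have key : ∀ v, {w | Cn s t (Set.Iio e) v w}.Infinite →
      {w | Cn s t (Set.Iio (g • e)) (g • v) w}.Infinite := by
    intro v h
    refine (h.image (f := fun w => g • w) ((MulAction.injective g).injOn)).mono ?_
    rintro _ ⟨w, hw, rfl⟩
    exact A.cn g (D := Set.Iio e) (D' := Set.Iio (g • e)) (fun x hx => A.lt g _ _ hx) hw
  refine ⟨?_, ?_⟩
  · rw [A.hs]; exact key _ he.1
  · rw [A.ht]; exact key _ he.2

theorem Act.card_E (A : Act H s t) (hp : Pot s t) [Finite (MulAction.orbitRel.Quotient H E)]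
    [Nontrivial H] :
    Nat.card (MulAction.orbitRel.Quotient H E) = Nat.card (MulAction.orbitRel.Quotient H V) +
      Set.ncard ((fun e => (Quotient.mk _ e : MulAction.orbitRel.Quotient H E)) '' Ess s t) := by
  rw [A.card_V hp, ← Set.ncard_union_eq ?_ (Set.toFinite _) (Set.toFinite _), ← Set.image_union,
    Set.compl_union_self, Set.image_univ, Set.range_eq_univ.mpr Quotient.mk_surjective,
    Set.ncard_univ]
  rw [Set.disjoint_left]
  rintro _ ⟨e, he, rfl⟩ ⟨e', he', h⟩
  obtain ⟨g, hg⟩ := (Quotient.exact h.symm : MulAction.orbitRel H E e e')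
  simp only at hg
  exact he (hg ▸ A.ess he' g)

end Flow
end HNC


namespace HNC

section Euler
variable {V E H : Type*} [Group H] [MulAction H V] [MulAction H E] [LinearOrder E] {s t : E → V}

variable (V H) in
/-- functions with `H`-invariant coboundary -/
def XX : Submodule (ZMod 2) (V → ZMod 2) where
  carrier := {p | ∀ (h : H) (v w : V), p (h • v) - p v = p (h • w) - p w}
  add_mem' := by
    intro p q hp hq h v w
    have h1 := hp h v w
    have h2 := hq h v w
    simp only [Pi.add_apply]
    linear_combination h1 + h2
  zero_mem' := by intro h v w; simp
  smul_mem' := by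
    intro c p hp h v w
    have h1 := hp h v w
    simp only [Pi.smul_apply, smul_eq_mul]
    linear_combination c * h1

theorem z2_add_self (a : ZMod 2) : a + a = 0 := by revert a; decide

theorem Act.equivE (A : Act H s t) (hp : Pot s t) [Nonempty V] :
    Nonempty (XX V H ≃ₗ[ZMod 2] ((MulAction.orbitRel.Quotient H E → ZMod 2) × ZMod 2)) := by
  obtain ⟨v0⟩ := ‹Nonempty V›
  let F : XX V H →ₗ[ZMod 2] ((MulAction.orbitRel.Quotient H E → ZMod 2) × ZMod 2) :=
    { toFun := fun p => (fun q => Quotient.lift (fun e => p.1 (s e) + p.1 (t e)) (by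
        rintro a b ⟨h, rfl⟩
        have := p.2 h (s b) (t b)
        simp only [A.hs, A.ht]
        linear_combination this + z2_add_self (p.1 (h • t b)) - z2_add_self (p.1 (t b))) q, p.1 v0)
      map_add' := by
        intro p q
        refine Prod.ext ?_ rfl
        funext e
        induction e using Quotient.inductionOn with
        | h e =>
          simp only [Submodule.coe_add, Pi.add_apply, Prod.fst_add, Quotient.lift_mk]
          ring
      map_smul' := by
        intro c p
        refine Prod.ext ?_ rfl
        funext e
        induction e using Quotient.inductionOn with
        | h e =>
          simp [mul_add] }
  refine ⟨LinearEquiv.ofBijective F ⟨?_, ?_⟩⟩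
  · rw [injective_iff_map_eq_zero]
    intro p hpz
    have h1 : ∀ e, p.1 (s e) + p.1 (t e) = 0 := fun e =>
      congrFun (congrArg Prod.fst hpz) (Quotient.mk _ e)
    have h2 : p.1 v0 = 0 := congrArg Prod.snd hpz
    refine Subtype.ext (funext fun v => ?_)
    have := Cn.const p.1 (fun e _ => z2_eq (h1 e)) (A.conn v v0)
    rw [this, h2]; rfl
  · rintro ⟨c, a⟩
    obtain ⟨p, hp⟩ := hp (fun e => c (Quotient.mk _ e))
    refine ⟨⟨fun v => p v + (a - p v0), ?_⟩, ?_⟩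
    · intro h v w
      have hinv : ∀ e, p (h • s e) + p (h • t e) = p (s e) + p (t e) := by
        intro e
        rw [← A.hs, ← A.ht, hp, hp]
        congr 1
        exact Quotient.sound ⟨h, rfl⟩
      have := Cn.const (fun v => p (h • v) - p v) (fun e _ => ?_) (A.conn v w)
      · simp only at this ⊢
        linear_combination this
      · linear_combination hinv e - z2_add_self (p (h • t e)) + z2_add_self (p (t e))
    · refine Prod.ext ?_ ?_
      · funext q
        induction q using Quotient.inductionOn with
        | h e =>
          show p (s e) + (a - p v0) + (p (t e) + (a - p v0)) = c _
          rw [← hp e]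
          linear_combination z2_add_self (a - p v0)
      · show p v0 + (a - p v0) = a
        ring

theorem Act.equivV (A : Act H s t) [Nonempty V] :
    Nonempty (XX V H ≃ₗ[ZMod 2]
      ((Additive H →+ ZMod 2) × (MulAction.orbitRel.Quotient H V → ZMod 2))) := by
  obtain ⟨v0⟩ := ‹Nonempty V›
  let F : XX V H →ₗ[ZMod 2]
      ((Additive H →+ ZMod 2) × (MulAction.orbitRel.Quotient H V → ZMod 2)) :=
    { toFun := fun p =>
        (AddMonoidHom.mk' (fun h : Additive H => p.1 (h.toMul • v0) - p.1 v0) (by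
          intro a b
          have := p.2 a.toMul (b.toMul • v0) v0
          simp only [toMul_add, mul_smul]
          linear_combination this), fun q => p.1 q.out)
      map_add' := by
        intro p q
        refine Prod.ext ?_ rfl
        refine DFunLike.ext _ _ fun h => ?_
        show p.1 (h.toMul • v0) + q.1 (h.toMul • v0) - (p.1 v0 + q.1 v0) =
          (p.1 (h.toMul • v0) - p.1 v0) + (q.1 (h.toMul • v0) - q.1 v0)
        ring
      map_smul' := by
        intro c p
        refine Prod.ext ?_ rfl
        ext h
        simp [mul_sub] }
  refine ⟨LinearEquiv.ofBijective F ⟨?_, ?_⟩⟩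
  · rw [injective_iff_map_eq_zero]
    intro p hpz
    have h1 : ∀ h : H, p.1 (h • v0) - p.1 v0 = 0 := fun h =>
      DFunLike.congr_fun (congrArg Prod.fst hpz) (Additive.ofMul h)
    have h2 : ∀ q : MulAction.orbitRel.Quotient H V, p.1 q.out = 0 := fun q =>
      congrFun (congrArg Prod.snd hpz) q
    refine Subtype.ext (funext fun v => ?_)
    obtain ⟨h, hh⟩ := (Quotient.mk_out v : MulAction.orbitRel H V _ _)
    simp only at hh
    have h3 := p.2 h v v0
    rw [h1 h, hh] at h3
    have h4 := h2 (Quotient.mk _ v)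
    have : p.1 v = 0 := by
      linear_combination h4 - h3
    exact this
  · rintro ⟨φ, c⟩
    have hex : ∀ v : V, ∃ h : H,
        h • (Quotient.out (Quotient.mk (MulAction.orbitRel H V) v)) = v := by
      intro v
      obtain ⟨h, hh⟩ := ((MulAction.orbitRel H V).symm (Quotient.mk_out v) :
        MulAction.orbitRel H V _ _)
      exact ⟨h, hh⟩
    choose g hg using hex
    have hgm : ∀ (h : H) (v : V), g (h • v) = h * g v := by
      intro h v
      have hq : (Quotient.mk (MulAction.orbitRel H V) (h • v)) =
        Quotient.mk (MulAction.orbitRel H V) v := Quotient.sound ⟨h, rfl⟩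
      have h1 := hg (h • v)
      rw [hq] at h1
      have h2 : (g (h • v))⁻¹ * (h * g v) = 1 := A.free _
        (Quotient.out (Quotient.mk (MulAction.orbitRel H V) v)) (by
          rw [mul_smul, mul_smul, hg v, inv_smul_eq_iff, h1])
      exact inv_mul_eq_one.mp h2
    let p0 : V → ZMod 2 := fun v =>
      φ (Additive.ofMul (g v)) + c (Quotient.mk _ v)
    have hp0 : ∀ h v, p0 (h • v) = φ (Additive.ofMul h) + p0 v := by
      intro h v
      have hq : (Quotient.mk (MulAction.orbitRel H V) (h • v)) =
        Quotient.mk (MulAction.orbitRel H V) v := Quotient.sound ⟨h, rfl⟩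
      show φ (Additive.ofMul (g (h • v))) + c (Quotient.mk _ (h • v)) =
        φ (Additive.ofMul h) + (φ (Additive.ofMul (g v)) + c (Quotient.mk _ v))
      rw [hq, hgm, ofMul_mul, map_add]
      ring
    refine ⟨⟨p0, ?_⟩, ?_⟩
    · intro h v w
      rw [hp0, hp0]; ring
    · refine Prod.ext ?_ ?_
      · ext h
        show p0 (h • v0) - p0 v0 = φ (Additive.ofMul h)
        rw [hp0]; ring
      · funext q
        show p0 q.out = c q
        have h1 : g q.out = 1 := by
          apply A.free _ q.out
          have := hg q.out
          rwa [Quotient.out_eq] at this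
        show φ (Additive.ofMul (g q.out)) + c (Quotient.mk _ q.out) = c q
        rw [h1, Quotient.out_eq]
        simp

theorem Act.main (A : Act H s t) (hp : Pot s t) [Finite (MulAction.orbitRel.Quotient H E)]
    [Nontrivial H] [Nonempty V] :
    Module.Finite (ZMod 2) (Additive H →+ ZMod 2) ∧
    Module.finrank (ZMod 2) (Additive H →+ ZMod 2) =
      Set.ncard ((fun e => (Quotient.mk _ e : MulAction.orbitRel.Quotient H E)) '' Ess s t) + 1 := by
  obtain ⟨f1⟩ := A.equivE hp
  obtain ⟨f2⟩ := A.equivV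
  have := A.finV
  have f := f1.symm.trans f2
  have hfin : Module.Finite (ZMod 2)
    ((Additive H →+ ZMod 2) × (MulAction.orbitRel.Quotient H V → ZMod 2)) :=
    Module.Finite.equiv f
  have hfin2 : Module.Finite (ZMod 2) (Additive H →+ ZMod 2) :=
    Module.Finite.of_surjective (LinearMap.fst (ZMod 2) (Additive H →+ ZMod 2)
      (MulAction.orbitRel.Quotient H V → ZMod 2)) LinearMap.fst_surjective
  refine ⟨hfin2, ?_⟩
  have h1 := f.finrank_eq
  have := Fintype.ofFinite (MulAction.orbitRel.Quotient H V)
  have := Fintype.ofFinite (MulAction.orbitRel.Quotient H E)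
  rw [Module.finrank_prod, Module.finrank_prod, Module.finrank_fintype_fun_eq_card,
    Module.finrank_fintype_fun_eq_card, Module.finrank_self, ← Nat.card_eq_fintype_card,
    ← Nat.card_eq_fintype_card, A.card_E hp] at h1
  omega

end Euler
end HNC


namespace HNC

section Order

/-- comparison sign -/
def cc {α : Type*} [LinearOrder α] (x y : α) : ℤ := if x < y then 1 else if y < x then -1 else 0

theorem cc_self {α : Type*} [LinearOrder α] (x : α) : cc x x = 0 := by simp [cc]

theorem cc_anti {α : Type*} [LinearOrder α] (x y : α) : cc y x = - cc x y := by
  unfold cc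
  rcases lt_trichotomy x y with h | h | h
  · simp [h, h.not_gt]
  · simp [h]
  · simp [h, h.not_gt]

theorem cc_cocycle {α : Type*} [LinearOrder α] (x y z : α) :
    -1 ≤ cc x y + cc y z + cc z x ∧ cc x y + cc y z + cc z x ≤ 1 := by
  unfold cc
  split_ifs <;> first | omega | (exfalso; order)

theorem cc_odd {α : Type*} [LinearOrder α] {x y : α} (h : x ≠ y) : cc x y % 2 = 1 := by
  unfold cc
  rcases lt_or_gt_of_ne h with h | h
  · simp [h]
  · simp [h, h.not_gt]

variable {I : Type*} {G : I → Type*} [LinearOrder I] [∀ i, Group (G i)] [∀ i, LinearOrder (G i)]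

/-- continuation value -/
def rho : I → List (Σ i, G i) → ℤ
  | _, [] => 0
  | i, y :: l => cc i y.1 + (cc 1 y.2 + rho y.1 l)

/-- value of a word -/
def tau : List (Σ i, G i) → ℤ
  | [] => 0
  | x :: l => cc 1 x.2 + rho x.1 l

/-- comparison of letters -/
def cs (x y : Σ i, G i) : ℤ :=
  if h : x.1 = y.1 then cc (h ▸ x.2) y.2 else - cc 1 x.2 + cc x.1 y.1 + cc 1 y.2

theorem cs_same {i : I} (x y : G i) : cs (⟨i, x⟩ : Σ i, G i) ⟨i, y⟩ = cc x y := by simp [cs]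

theorem cs_diff {x y : Σ i, G i} (h : x.1 ≠ y.1) :
    cs x y = - cc 1 x.2 + cc x.1 y.1 + cc 1 y.2 := by simp [cs, h]

theorem cs_anti (x y : Σ i, G i) : cs y x = - cs x y := by
  obtain ⟨i, x⟩ := x
  obtain ⟨j, y⟩ := y
  by_cases h : i = j
  · subst h; rw [cs_same, cs_same, cc_anti]
  · rw [cs_diff (x := ⟨j, y⟩) (fun h' => h h'.symm), cs_diff (x := ⟨i, x⟩) h]
    simp only
    rw [cc_anti i j]; ring

theorem cs_cocycle (x y z : Σ i, G i) :
    -1 ≤ cs x y + cs y z + cs z x ∧ cs x y + cs y z + cs z x ≤ 1 := by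
  have two : ∀ {i j : I} (x y : G i) (z : G j), i ≠ j →
      -1 ≤ cs (⟨i, x⟩ : Σ i, G i) ⟨i, y⟩ + cs (⟨i, y⟩ : Σ i, G i) ⟨j, z⟩ + cs ⟨j, z⟩ ⟨i, x⟩ ∧
      cs (⟨i, x⟩ : Σ i, G i) ⟨i, y⟩ + cs (⟨i, y⟩ : Σ i, G i) ⟨j, z⟩ + cs ⟨j, z⟩ ⟨i, x⟩ ≤ 1 := by
    intro i j x y z h
    rw [cs_anti ⟨i, x⟩ ⟨j, z⟩, cs_same, cs_diff (by simpa using h), cs_diff (by simpa using h)]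
    have := cc_cocycle x y 1
    rw [cc_anti 1 y] at this
    simp only
    omega
  obtain ⟨i, x⟩ := x
  obtain ⟨j, y⟩ := y
  obtain ⟨k, z⟩ := z
  by_cases hij : i = j
  · subst hij
    by_cases hik : i = k
    · subst hik
      simp only [cs_same]
      exact cc_cocycle x y z
    · exact two x y z hik
  · by_cases hik : i = k
    · subst hik
      have := two z x y hij
      omega
    · by_cases hjk : j = k
      · subst hjk
        have := two y z x (fun h => hij h.symm)
        omega
      · rw [cs_diff (by simpa using hij), cs_diff (by simpa using hjk),
          cs_diff (by simpa using fun h' : k = i => hik h'.symm)]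
        have := cc_cocycle i j k
        simp only
        omega

/-- comparison of words -/
def dd : List (Σ i, G i) → List (Σ i, G i) → ℤ
  | [], m => tau m
  | x :: l, [] => - tau (x :: l)
  | x :: l, y :: m => if x = y then dd l m else - rho x.1 l + cs x y + rho y.1 m

theorem dd_nil (m : List (Σ i, G i)) : dd [] m = tau m := by
  cases m <;> simp [dd]

theorem dd_nil' (m : List (Σ i, G i)) : dd m [] = - tau m := by
  cases m <;> simp [dd, tau]

theorem dd_cons (x : Σ i, G i) (l m) : dd (x :: l) (x :: m) = dd l m := by simp [dd]

theorem dd_cons_ne {x y : Σ i, G i} (h : x ≠ y) (l m) :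
    dd (x :: l) (y :: m) = - rho x.1 l + cs x y + rho y.1 m := by simp [dd, h]

theorem dd_anti (l m : List (Σ i, G i)) : dd m l = - dd l m := by
  induction l generalizing m with
  | nil => rw [dd_nil, dd_nil']
  | cons x l ih =>
    cases m with
    | nil => rw [dd_nil, dd_nil', neg_neg]
    | cons y m =>
      by_cases h : x = y
      · subst h; rw [dd_cons, dd_cons, ih]
      · rw [dd_cons_ne h, dd_cons_ne (Ne.symm h), cs_anti x y]; ring

theorem dd_rho (i : I) (l m : List (Σ i, G i)) :
    -1 ≤ dd l m + rho i l - rho i m ∧ dd l m + rho i l - rho i m ≤ 1 := by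
  have cb : ∀ {α : Type _} [LinearOrder α] (x y : α), -1 ≤ cc x y ∧ cc x y ≤ 1 := by
    intro α _ x y; unfold cc; split_ifs <;> norm_num
  induction l generalizing m i with
  | nil =>
    cases m with
    | nil => simp [dd, tau, rho]
    | cons y m =>
      simp only [dd, tau, rho]
      have := cb i y.1
      omega
  | cons x l ih =>
    cases m with
    | nil =>
      simp only [dd, tau, rho]
      have := cb i x.1
      omega
    | cons y m =>
      by_cases h : x = y
      · subst h
        have := ih x.1 m
        simp only [dd_cons, rho]
        omega
      · rw [dd_cons_ne h]
        simp only [rho]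
        obtain ⟨j, x⟩ := x
        obtain ⟨k, y⟩ := y
        by_cases hjk : j = k
        · subst hjk
          rw [cs_same]
          have := cc_cocycle x y 1
          rw [cc_anti 1 y] at this
          simp only
          omega
        · rw [cs_diff (by simpa using hjk)]
          have := cc_cocycle i j k
          rw [cc_anti i k] at this
          simp only
          omega

theorem dd_tau (l m : List (Σ i, G i)) :
    -1 ≤ dd l m + tau l - tau m ∧ dd l m + tau l - tau m ≤ 1 := by
  cases l with
  | nil => simp [dd_nil, tau]
  | cons x l =>
    cases m with
    | nil => simp [dd, tau]
    | cons y m =>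
      by_cases h : x = y
      · subst h
        have := dd_rho x.1 l m
        simp only [dd_cons, tau]
        omega
      · rw [dd_cons_ne h]
        simp only [tau]
        obtain ⟨j, x⟩ := x
        obtain ⟨k, y⟩ := y
        by_cases hjk : j = k
        · subst hjk
          rw [cs_same]
          have := cc_cocycle x y 1
          rw [cc_anti 1 y] at this
          simp only
          omega
        · rw [cs_diff (by simpa using hjk)]
          have := cc_cocycle j k k
          rw [cc_self, cc_anti j k] at this
          have : -1 ≤ cc j k ∧ cc j k ≤ 1 := by unfold cc; split_ifs <;> norm_num
          simp only
          omega

theorem dd_cocycle (l m n : List (Σ i, G i)) :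
    -1 ≤ dd l m + dd m n + dd n l ∧ dd l m + dd m n + dd n l ≤ 1 := by
  induction l generalizing m n with
  | nil =>
    have := dd_tau m n
    rw [dd_nil, dd_nil']
    omega
  | cons x l ih =>
    cases m with
    | nil =>
      have := dd_tau n (x :: l)
      rw [dd_nil, dd_nil']
      omega
    | cons y m =>
      cases n with
      | nil =>
        have := dd_tau (x :: l) (y :: m)
        rw [dd_nil, dd_nil']
        omega
      | cons z n =>
        by_cases hxy : x = y
        · subst hxy
          by_cases hxz : x = z
          · subst hxz
            simp only [dd_cons]
            exact ih m n
          · rw [dd_cons, dd_cons_ne hxz, dd_cons_ne (Ne.symm hxz), cs_anti x z]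
            have := dd_rho x.1 l m
            omega
        · by_cases hxz : x = z
          · subst hxz
            rw [dd_cons, dd_cons_ne hxy, dd_cons_ne (Ne.symm hxy), cs_anti x y]
            have := dd_rho x.1 n l
            omega
          · by_cases hyz : y = z
            · subst hyz
              rw [dd_cons, dd_cons_ne hxy, dd_cons_ne (Ne.symm hxy), cs_anti x y]
              have := dd_rho y.1 m n
              omega
            · rw [dd_cons_ne hxy, dd_cons_ne hyz, dd_cons_ne (Ne.symm hxz)]
              have := cs_cocycle x y z
              omega

/-- reduced continuation -/
def Red : I → List (Σ i, G i) → Prop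
  | _, [] => True
  | i, y :: l => i ≠ y.1 ∧ y.2 ≠ 1 ∧ Red y.1 l

/-- reduced list -/
def Red' : List (Σ i, G i) → Prop
  | [] => True
  | x :: l => x.2 ≠ 1 ∧ Red x.1 l

theorem Red.red' {i : I} {l : List (Σ i, G i)} (h : Red i l) : Red' l := by
  cases l with
  | nil => trivial
  | cons y l => exact h.2

theorem rho_even {i : I} {l : List (Σ i, G i)} (h : Red i l) : rho i l % 2 = 0 := by
  induction l generalizing i with
  | nil => simp [rho]
  | cons y l ih =>
    obtain ⟨h1, h2, h3⟩ := h
    have a := cc_odd h1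
    have b := cc_odd h2.symm
    have c := ih h3
    simp only [rho]
    omega

theorem dd_odd {l m : List (Σ i, G i)} (hl : Red' l) (hm : Red' m) (hne : l ≠ m) :
    dd l m % 2 = 1 := by
  have tau_odd : ∀ x l, Red' (x :: l : List (Σ i, G i)) → tau (x :: l) % 2 = 1 := by
    intro x l h
    have := cc_odd h.1.symm
    have := rho_even h.2
    simp only [tau]
    omega
  induction l generalizing m with
  | nil =>
    cases m with
    | nil => exact absurd rfl hne
    | cons y m => rw [dd_nil]; exact tau_odd _ _ hm
  | cons x l ih =>
    cases m with
    | nil => rw [dd_nil']; have := tau_odd _ _ hl; omega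
    | cons y m =>
      by_cases h : x = y
      · subst h
        rw [dd_cons]
        exact ih hl.2.red' hm.2.red' (fun h => hne (by rw [h]))
      · rw [dd_cons_ne h]
        have h1 := rho_even hl.2
        have h2 := rho_even hm.2
        have h3 : cs x y % 2 = 1 := by
          obtain ⟨j, x⟩ := x
          obtain ⟨k, y⟩ := y
          by_cases hjk : j = k
          · subst hjk
            rw [cs_same]
            exact cc_odd (fun h' => h (by rw [h']))
          · rw [cs_diff (by simpa using hjk)]
            have a := cc_odd hjk
            have b := cc_odd hl.1.symm
            have c := cc_odd hm.1.symm
            simp only at a b c ⊢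
            omega
        omega

theorem word_red (w : CoprodI.Word G) : Red' w.toList := by
  have key : ∀ (l : List (Σ i, G i)) (x : Σ i, G i), (∀ y ∈ x :: l, y.2 ≠ 1) →
      (x :: l).IsChain (fun a b => a.1 ≠ b.1) → x.2 ≠ 1 ∧ Red x.1 l := by
    intro l
    induction l with
    | nil => intro x h _; exact ⟨h x (by simp), trivial⟩
    | cons y l ih =>
      intro x h hc
      rw [List.isChain_cons_cons] at hc
      have := ih y (fun z hz => h z (List.mem_cons_of_mem _ hz)) hc.2
      exact ⟨h x (by simp), hc.1, this.1, this.2⟩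
  obtain ⟨l, h1, h2⟩ := w
  cases l with
  | nil => trivial
  | cons x l => exact key l x h1 h2

theorem dd_pair {i : I} (p q : CoprodI.Word.Pair G i) :
    dd (CoprodI.Word.rcons p).toList (CoprodI.Word.rcons q).toList =
      if p.head = q.head then dd p.tail.toList q.tail.toList else
        - rho i p.tail.toList + cc p.head q.head + rho i q.tail.toList := by
  have mixed : ∀ (p q : CoprodI.Word.Pair G i), p.head = 1 → q.head ≠ 1 →
      dd p.tail.toList (⟨i, q.head⟩ :: q.tail.toList) =
        - rho i p.tail.toList + cc 1 q.head + rho i q.tail.toList := by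
    intro p q _ _
    have h := CoprodI.Word.fstIdx_ne_iff.mp p.fstIdx_ne
    revert h
    generalize p.tail.toList = l
    intro h
    cases l with
    | nil => simp [dd_nil, tau, rho]
    | cons y l =>
      have hy : i ≠ y.1 := h y (by simp)
      rw [dd_cons_ne (fun hc => hy (by rw [hc])), cs_diff (by simpa using hy.symm)]
      simp only [rho]
      rw [cc_anti i y.1]
      ring
  by_cases hp : p.head = 1
  · by_cases hq : q.head = 1
    · simp [CoprodI.Word.rcons, hp, hq]
    · have := mixed p q hp hq
      simp only [CoprodI.Word.rcons, hp, hq, dif_pos, dif_neg, not_false_eq_true,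
        CoprodI.Word.cons, this, if_neg (Ne.symm hq)]
  · by_cases hq : q.head = 1
    · have := mixed q p hq hp
      rw [dd_anti] at this
      simp only [CoprodI.Word.rcons, hp, hq, dif_pos, dif_neg, not_false_eq_true,
        CoprodI.Word.cons]
      simp only [if_false]
      rw [cc_anti 1 p.head]
      linarith
    · simp only [CoprodI.Word.rcons, hp, hq, dif_neg, not_false_eq_true, CoprodI.Word.cons]
      by_cases h : p.head = q.head
      · rw [if_pos h, h, dd_cons]
      · rw [if_neg h, dd_cons_ne (by simpa using h), cs_same]

variable [∀ i, CovariantClass (G i) (G i) (· * ·) (· ≤ ·)]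

theorem cc_mul {i : I} (a x y : G i) : cc (a * x) (a * y) = cc x y := by
  unfold cc
  simp only [mul_lt_mul_iff_left]

theorem dd_of {i : I} (a : G i) (u v : CoprodI.Word G) :
    dd (CoprodI.of a • u).toList (CoprodI.of a • v).toList = dd u.toList v.toList := by
  have hu : u = CoprodI.Word.rcons (CoprodI.Word.equivPair i u) := by
    rw [← CoprodI.Word.equivPair_symm, Equiv.symm_apply_apply]
  have hv : v = CoprodI.Word.rcons (CoprodI.Word.equivPair i v) := by
    rw [← CoprodI.Word.equivPair_symm, Equiv.symm_apply_apply]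
  conv_rhs => rw [hu, hv]
  rw [CoprodI.Word.of_smul_def, CoprodI.Word.of_smul_def, dd_pair, dd_pair]
  simp only [mul_right_inj, cc_mul]

theorem dd_smul (g : CoprodI G) (u v : CoprodI.Word G) :
    dd (g • u).toList (g • v).toList = dd u.toList v.toList := by
  induction g using CoprodI.induction_on generalizing u v with
  | one => simp
  | of i m => exact dd_of m u v
  | mul x y hx hy => rw [mul_smul, mul_smul, hx, hy]

theorem exists_lt (G : I → Type*) [∀ i, Group (G i)] [∀ i, LinearOrder (G i)]
    [∀ i, CovariantClass (G i) (G i) (· * ·) (· ≤ ·)] :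
    ∃ lt : CoprodI G → CoprodI G → Prop, (∀ a, ¬ lt a a) ∧
    (∀ a b c, lt a b → lt b c → lt a c) ∧ (∀ a b, a ≠ b → lt a b ∨ lt b a) ∧
    (∀ a b c, lt a b → lt (c * a) (c * b)) := by
  have hsm : ∀ a : CoprodI G, CoprodI.Word.equiv a = a • CoprodI.Word.empty := fun a => rfl
  refine ⟨fun a b => 0 < dd (CoprodI.Word.equiv a).toList (CoprodI.Word.equiv b).toList,
    ?_, ?_, ?_, ?_⟩
  · intro a h
    have := dd_anti (CoprodI.Word.equiv a).toList (CoprodI.Word.equiv a).toList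
    omega
  · intro a b c hab hbc
    have := dd_cocycle (CoprodI.Word.equiv a).toList (CoprodI.Word.equiv b).toList
      (CoprodI.Word.equiv c).toList
    have := dd_anti (CoprodI.Word.equiv a).toList (CoprodI.Word.equiv c).toList
    omega
  · intro a b hne
    have h1 : (CoprodI.Word.equiv a).toList ≠ (CoprodI.Word.equiv b).toList := fun h =>
      hne (CoprodI.Word.equiv.injective (CoprodI.Word.ext h))
    have h2 := dd_odd (word_red _) (word_red _) h1
    have := dd_anti (CoprodI.Word.equiv a).toList (CoprodI.Word.equiv b).toList
    omega
  · intro a b c h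
    rw [hsm, hsm, mul_smul, mul_smul, dd_smul]
    exact h

end Order

end HNC


namespace HNC

section Sub
variable {V E H : Type*} [Group H] [MulAction H V] [MulAction H E] [LinearOrder E] {s t : E → V}

variable (H s t) in
/-- free order preserving action of `H` on a graph -/
structure PreAct : Prop where
  hs : ∀ (h : H) (e : E), s (h • e) = h • s e
  ht : ∀ (h : H) (e : E), t (h • e) = h • t e
  lt : ∀ (h : H) (a b : E), a < b → h • a < h • b
  free : ∀ (h : H) (v : V), h • v = v → h = 1

variable (s t) in
/-- essential edges of the component of `v0` in the subgraph with edge set `S` -/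
def EssS (S : Set E) (v0 : V) : Set E :=
  {e | (e ∈ S ∧ Cn s t S (s e) v0) ∧ {w | Cn s t (S ∩ Set.Iio e) (s e) w}.Infinite ∧
    {w | Cn s t (S ∩ Set.Iio e) (t e) w}.Infinite}

theorem EssS.mono {S S' : Set E} (h : S ⊆ S') (v0 : V) : EssS s t S v0 ⊆ EssS s t S' v0 := by
  rintro e ⟨⟨h1, h2⟩, h3, h4⟩
  have hh : S ∩ Set.Iio e ⊆ S' ∩ Set.Iio e := Set.inter_subset_inter_left _ h
  exact ⟨⟨h h1, h2.mono h⟩, h3.mono fun w hw => hw.mono hh, h4.mono fun w hw => hw.mono hh⟩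

theorem PreAct.main (A : PreAct H s t) (hp : Pot s t) [Nontrivial H] (S : Set E) (v0 : V)
    (hS : ∀ (h : H), ∀ e ∈ S, h • e ∈ S)
    (hfin : ((fun e => (Quotient.mk _ e : MulAction.orbitRel.Quotient H E)) '' S).Finite)
    (hv : ∀ h : H, Cn s t S (h • v0) v0) :
    Module.Finite (ZMod 2) (Additive H →+ ZMod 2) ∧
    Module.finrank (ZMod 2) (Additive H →+ ZMod 2) =
      Set.ncard ((fun e => (Quotient.mk _ e : MulAction.orbitRel.Quotient H E)) '' EssS s t S v0)
        + 1 := by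
  classical
  have hcn : ∀ (h : H) {v w : V}, Cn s t S v w → Cn s t S (h • v) (h • w) := fun h v w hc =>
    Cn.map (fun v => h • v) (fun e => h • e) (A.hs h) (A.ht h) (hS h) hc
  let E' : SubMulAction H E :=
    { carrier := {e | e ∈ S ∧ Cn s t S (s e) v0}
      smul_mem' := fun h e he => ⟨hS h e he.1, by
        rw [A.hs]; exact (hcn h he.2).trans (hv h)⟩ }
  let V' : SubMulAction H V :=
    { carrier := {v | Cn s t S v v0}
      smul_mem' := fun h v hv' => (hcn h hv').trans (hv h) }
  let s' : E' → V' := fun e => ⟨s e.1, e.2.2⟩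
  let t' : E' → V' := fun e => ⟨t e.1, (Cn.edge e.2.1).symm.trans e.2.2⟩
  have lift : ∀ (D : Set E) (v w : V) (hv : Cn s t S v v0), Cn s t (S ∩ D) v w →
      ∃ hw : Cn s t S w v0, Cn s' t' {e | e.1 ∈ D} ⟨v, hv⟩ ⟨w, hw⟩ := by
    intro D v w hv h
    induction h with
    | refl => exact ⟨hv, Cn.refl _⟩
    | @tail b c _ h ih =>
      obtain ⟨hb, hbc⟩ := ih
      obtain ⟨e, ⟨heS, heD⟩, ⟨rfl, rfl⟩ | ⟨rfl, rfl⟩⟩ := h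
      · refine ⟨(Cn.edge heS).symm.trans hb, hbc.trans ?_⟩
        exact Cn.edge (s := s') (t := t') (e := ⟨e, heS, hb⟩) heD
      · refine ⟨(Cn.edge heS).trans hb, hbc.trans ?_⟩
        exact (Cn.edge (s := s') (t := t') (e := ⟨e, heS, (Cn.edge heS).trans hb⟩) heD).symm
  have A' : Act H s' t' :=
    { hs := fun h e => Subtype.ext (A.hs h e.1)
      ht := fun h e => Subtype.ext (A.ht h e.1)
      lt := fun h a b hab => A.lt h a.1 b.1 hab
      free := fun h v hv => A.free h v.1 (congrArg Subtype.val hv)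
      conn := by
        rintro ⟨v, hv⟩ ⟨w, hw⟩
        have h1 : Cn s t S v w := Cn.trans hv (Cn.symm hw)
        obtain ⟨_, h2⟩ := lift Set.univ v w hv (by simpa using h1)
        exact h2.mono (Set.subset_univ _) }
  have hp' : Pot s' t' := by
    intro c
    obtain ⟨p, hp⟩ := hp (fun e => if h : e ∈ E' then c ⟨e, h⟩ else 0)
    refine ⟨fun v => p v.1, fun e => ?_⟩
    have := hp e.1
    rw [dif_pos e.2] at this
    exact this
  let j : MulAction.orbitRel.Quotient H E' → MulAction.orbitRel.Quotient H E :=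
    Quotient.map (fun e => e.1) (by
      rintro a b ⟨h, hh⟩
      exact ⟨h, congrArg Subtype.val hh⟩)
  have hj : Function.Injective j := by
    intro a b
    induction a using Quotient.inductionOn with | _ a
    induction b using Quotient.inductionOn with | _ b
    intro hab
    obtain ⟨h, hh⟩ := (Quotient.exact hab : MulAction.orbitRel H E a.1 b.1)
    exact Quotient.sound ⟨h, Subtype.ext hh⟩
  have : Finite (MulAction.orbitRel.Quotient H E') := by
    have : Finite (((fun e => (Quotient.mk _ e : MulAction.orbitRel.Quotient H E)) '' S)) := hfin
    refine Finite.of_injective (fun q => (⟨j q, ?_⟩ :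
      ((fun e => (Quotient.mk _ e : MulAction.orbitRel.Quotient H E)) '' S))) ?_
    · induction q using Quotient.inductionOn with | _ a
      exact ⟨a.1, a.2.1, rfl⟩
    · intro a b hab
      exact hj (congrArg Subtype.val hab)
  have : Nonempty V' := ⟨⟨v0, Cn.refl _⟩⟩
  obtain ⟨h1, h2⟩ := A'.main hp'
  refine ⟨h1, ?_⟩
  rw [h2, ← Set.ncard_image_of_injective _ hj]
  congr 2
  have hinf : ∀ (e : E') (v : V'), {w | Cn s' t' (Set.Iio e) v w}.Infinite ↔
      {w | Cn s t (S ∩ Set.Iio e.1) v.1 w}.Infinite := by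
    intro e v
    have : {w | Cn s t (S ∩ Set.Iio e.1) v.1 w} =
        Subtype.val '' {w | Cn s' t' (Set.Iio e) v w} := by
      ext w
      constructor
      · intro hw
        obtain ⟨hw', h⟩ := lift _ _ _ v.2 hw
        exact ⟨⟨w, hw'⟩, h, rfl⟩
      · rintro ⟨w, hw, rfl⟩
        exact Cn.map (fun v : V' => v.1) (fun e : E' => e.1) (fun _ => rfl) (fun _ => rfl)
          (D' := S ∩ Set.Iio e.1) (fun e' he' => ⟨e'.2.1, he'⟩) hw
    rw [this, Set.infinite_image_iff Subtype.val_injective.injOn]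
  ext q
  constructor
  · rintro ⟨_, ⟨e, ⟨he1, he2⟩, rfl⟩, rfl⟩
    exact ⟨e.1, ⟨e.2, (hinf e (s' e)).1 he1, (hinf e (t' e)).1 he2⟩, rfl⟩
  · rintro ⟨e, ⟨he, he1, he2⟩, rfl⟩
    exact ⟨_, ⟨⟨e, he⟩, ⟨(hinf ⟨e, he⟩ (s' ⟨e, he⟩)).2 he1, (hinf ⟨e, he⟩ (t' ⟨e, he⟩)).2 he2⟩, rfl⟩, rfl⟩

end Sub

end HNC


namespace HNC

section Comb
variable {V E F : Type*} [Group F] [MulAction F V] [MulAction F E] {s t : E → V}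

/-- a cofinite invariant edge set joining the orbit of a vertex -/
theorem exists_S (hs : ∀ (h : F) (e : E), s (h • e) = h • s e)
    (ht : ∀ (h : F) (e : E), t (h • e) = h • t e) (conn : ∀ v w : V, Cn s t Set.univ v w)
    (H : Subgroup F) (hH : H.FG) (v0 : V) :
    ∃ S : Set E, (∀ (h : H), ∀ e ∈ S, h • e ∈ S) ∧
      ((fun e => (Quotient.mk _ e : MulAction.orbitRel.Quotient H E)) '' S).Finite ∧
      (∀ h : H, Cn s t S (h • v0) v0) := by
  obtain ⟨T, hT⟩ := hH
  choose P hPf _ hP using fun g : F => (conn (g • v0) v0).exists_finite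
  let S : Set E := {e | ∃ h : H, ∃ g ∈ T, ∃ p ∈ P g, e = h • p}
  have hS : ∀ (h : H), ∀ e ∈ S, h • e ∈ S := by
    rintro h _ ⟨h', g, hg, p, hp, rfl⟩
    exact ⟨h * h', g, hg, p, hp, by rw [mul_smul]⟩
  have hcn : ∀ (h : F) (hh : h ∈ H) {v w : V}, Cn s t S v w → Cn s t S (h • v) (h • w) :=
    fun h hh v w hc =>
    Cn.map (fun v => h • v) (fun e => h • e) (hs h) (ht h) (fun e he => hS ⟨h, hh⟩ e he) hc
  refine ⟨S, hS, ?_, ?_⟩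
  · have h1 : (⋃ g ∈ T, P g).Finite := T.finite_toSet.biUnion fun g _ => hPf g
    refine (h1.image (fun e => (Quotient.mk _ e : MulAction.orbitRel.Quotient H E))).subset ?_
    rintro _ ⟨_, ⟨h', g, hg, p, hp, rfl⟩, rfl⟩
    refine ⟨p, Set.mem_biUnion hg hp, ?_⟩
    exact Quotient.sound ⟨h'⁻¹, by simp⟩
  · have key : ∀ h : F, h ∈ H → Cn s t S (h • v0) v0 := by
      intro h hh
      have hh' : h ∈ Subgroup.closure (T : Set F) := by rwa [hT]
      induction hh' using Subgroup.closure_induction with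
      | mem x hx =>
        have hsub : P x ⊆ S := fun p hp => ⟨1, x, hx, p, hp, by simp⟩
        exact (hP x).mono hsub
      | one => rw [one_smul]; exact Cn.refl _
      | mul x y hx hy ihx ihy =>
        rw [hT] at hx hy
        rw [mul_smul]
        exact (hcn x hx (ihy hy)).trans (ihx hx)
      | inv x hx ih =>
        rw [hT] at hx
        have := hcn x⁻¹ (H.inv_mem hx) (ih hx)
        rw [inv_smul_smul] at this
        exact this.symm
    exact fun h => key h.1 h.2

theorem comb [LinearOrder E] (hs : ∀ (h : F) (e : E), s (h • e) = h • s e)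
    (ht : ∀ (h : F) (e : E), t (h • e) = h • t e) (conn : ∀ v w : V, Cn s t Set.univ v w)
    (lt : ∀ (h : F) (a b : E), a < b → h • a < h • b)
    (freeE : ∀ (h : F) (e : E), h • e = e → h = 1)
    (hp : Pot s t) [Nonempty V]
    (H₁ H₂ : Subgroup F) (fg₁ : H₁.FG) (fg₂ : H₂.FG)
    (free₁ : ∀ h ∈ H₁, ∀ v : V, h • v = v → h = 1)
    (free₂ : ∀ h ∈ H₂, ∀ v : V, h • v = v → h = 1)
    [Nontrivial H₁] [Nontrivial H₂] [Nontrivial (H₁ ⊓ H₂ : Subgroup F)] :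
    Module.Finite (ZMod 2) (Additive (H₁ ⊓ H₂ : Subgroup F) →+ ZMod 2) ∧
    Module.finrank (ZMod 2) (Additive (H₁ ⊓ H₂ : Subgroup F) →+ ZMod 2) - 1 ≤
      (Module.finrank (ZMod 2) (Additive H₁ →+ ZMod 2) - 1) *
      (Module.finrank (ZMod 2) (Additive H₂ →+ ZMod 2) - 1) := by
  obtain ⟨v0⟩ := ‹Nonempty V›
  have mk : ∀ H : Subgroup F, (∀ h ∈ H, ∀ v : V, h • v = v → h = 1) → PreAct H s t :=
    fun H hH =>
    { hs := fun h e => hs h.1 e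
      ht := fun h e => ht h.1 e
      lt := fun h a b hab => lt h.1 a b hab
      free := fun h v hv => Subtype.ext (hH h.1 h.2 v hv) }
  obtain ⟨S₁, inv₁, fin₁, cn₁⟩ := exists_S hs ht conn H₁ fg₁ v0
  obtain ⟨S₂, inv₂, fin₂, cn₂⟩ := exists_S hs ht conn H₂ fg₂ v0
  obtain ⟨-, m₁⟩ := (mk H₁ free₁).main hp S₁ v0 inv₁ fin₁ cn₁
  obtain ⟨-, m₂⟩ := (mk H₂ free₂).main hp S₂ v0 inv₂ fin₂ cn₂
  obtain ⟨χ, hχ⟩ := hp.side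
  let q : ∀ H : Subgroup F, E → MulAction.orbitRel.Quotient H E := fun H e => Quotient.mk _ e
  let j : MulAction.orbitRel.Quotient (H₁ ⊓ H₂ : Subgroup F) E →
      MulAction.orbitRel.Quotient H₁ E × MulAction.orbitRel.Quotient H₂ E :=
    Quotient.lift (fun e => (q H₁ e, q H₂ e)) (by
      rintro a b ⟨h, hh⟩
      exact Prod.ext (Quotient.sound ⟨⟨h.1, h.2.1⟩, hh⟩) (Quotient.sound ⟨⟨h.1, h.2.2⟩, hh⟩))
  have hj : Function.Injective j := by
    intro a b
    induction a using Quotient.inductionOn with | _ a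
    induction b using Quotient.inductionOn with | _ b
    intro hab
    obtain ⟨h, hh⟩ := (Quotient.exact (congrArg Prod.fst hab) : MulAction.orbitRel H₁ E a b)
    obtain ⟨h', hh'⟩ := (Quotient.exact (congrArg Prod.snd hab) : MulAction.orbitRel H₂ E a b)
    have h1 : h.1 • b = a := hh
    have h2 : h'.1 • b = a := hh'
    have h3 : h'.1⁻¹ * h.1 = 1 := freeE _ b (by rw [mul_smul, h1, ← h2, inv_smul_smul])
    have h4 : h'.1 = h.1 := inv_mul_eq_one.mp h3
    exact Quotient.sound ⟨⟨h.1, h.2, h4 ▸ h'.2⟩, hh⟩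
  have maps : ∀ (A A₁ A₂ : Set E), A ⊆ A₁ → A ⊆ A₂ →
      j '' (q (H₁ ⊓ H₂) '' A) ⊆ (q H₁ '' A₁) ×ˢ (q H₂ '' A₂) := by
    rintro A A₁ A₂ h1 h2 _ ⟨_, ⟨e, he, rfl⟩, rfl⟩
    exact ⟨⟨e, h1 he, rfl⟩, ⟨e, h2 he, rfl⟩⟩
  have finK : (q (H₁ ⊓ H₂) '' (S₁ ∩ S₂)).Finite := by
    refine Set.Finite.of_finite_image ?_ hj.injOn
    exact (fin₁.prod fin₂).subset (maps _ _ _ Set.inter_subset_left Set.inter_subset_right)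
  obtain ⟨mf, m⟩ := (mk (H₁ ⊓ H₂) (fun h hh => free₁ h hh.1)).main hp (S₁ ∩ S₂) v0
    (fun h e he => ⟨inv₁ ⟨h.1, h.2.1⟩ e he.1, inv₂ ⟨h.1, h.2.2⟩ e he.2⟩) finK
    (fun h => hχ.inter (cn₁ ⟨h.1, h.2.1⟩) (cn₂ ⟨h.1, h.2.2⟩))
  refine ⟨mf, ?_⟩
  rw [m, m₁, m₂]
  simp only [Nat.add_sub_cancel]
  rw [← Set.ncard_prod, ← Set.ncard_image_of_injective _ hj]
  have sub : ∀ (S : Set E), EssS s t S v0 ⊆ S := fun S e he => he.1.1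
  refine Set.ncard_le_ncard (maps _ _ _ (EssS.mono Set.inter_subset_left v0)
    (EssS.mono Set.inter_subset_right v0)) ?_
  exact (fin₁.subset (Set.image_mono (sub _))).prod (fin₂.subset (Set.image_mono (sub _)))

end Comb

section Free

theorem free_hom {X H : Type*} [Group H] (e : FreeGroup X ≃* H) :
    Nonempty ((Additive H →+ ZMod 2) ≃ₗ[ZMod 2] (X → ZMod 2)) := by
  let f : (Additive H →+ ZMod 2) →ₗ[ZMod 2] (X → ZMod 2) :=
    { toFun := fun φ x => φ (Additive.ofMul (e (FreeGroup.of x)))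
      map_add' := fun _ _ => rfl
      map_smul' := fun _ _ => rfl }
  refine ⟨LinearEquiv.ofBijective f ⟨?_, ?_⟩⟩
  · intro φ ψ h
    have : (AddMonoidHom.toMultiplicativeRight φ).comp e.toMonoidHom =
        (AddMonoidHom.toMultiplicativeRight ψ).comp e.toMonoidHom := by
      ext x
      exact congrFun h x
    ext y
    have h2 := DFunLike.congr_fun this (e.symm y)
    simpa using h2
  · intro c
    refine ⟨MonoidHom.toAdditiveLeft
      ((FreeGroup.lift (fun x => Multiplicative.ofAdd (c x))).comp e.symm.toMonoidHom), ?_⟩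
    funext x
    simp [f]

theorem free_finrank {n : ℕ} {H : Type*} [Group H] (e : FreeGroup (Fin n) ≃* H) :
    Module.finrank (ZMod 2) (Additive H →+ ZMod 2) = n := by
  obtain ⟨f⟩ := free_hom e
  rw [f.finrank_eq]; simp

theorem free_finite {H : Type*} [Group H] [IsFreeGroup H]
    [Module.Finite (ZMod 2) (Additive H →+ ZMod 2)] :
    ∃ n : ℕ, Nonempty (FreeGroup (Fin n) ≃* H) := by
  let e := IsFreeGroup.mulEquiv H
  obtain ⟨f⟩ := free_hom e
  have h1 : Module.Finite (ZMod 2) (IsFreeGroup.Generators H → ZMod 2) := Module.Finite.equiv f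
  have h2 : Finite (IsFreeGroup.Generators H → ZMod 2) := Module.finite_of_finite (ZMod 2)
  have h3 : Finite (IsFreeGroup.Generators H) := by
    classical
    refine Finite.of_injective (fun x => (Pi.single x 1 : IsFreeGroup.Generators H → ZMod 2)) ?_
    intro x y h
    by_contra hne
    have := congrFun h x
    simp [hne] at this
  obtain ⟨n, ⟨k⟩⟩ := Finite.exists_equiv_fin (IsFreeGroup.Generators H)
  exact ⟨n, ⟨(FreeGroup.freeGroupCongr k).symm.trans e⟩⟩

theorem free_trivial {H : Type*} [Group H] [Subsingleton H] :
    Nonempty (FreeGroup (Fin 0) ≃* H) := by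
  have : Unique H := ⟨⟨1⟩, fun _ => Subsingleton.elim _ _⟩
  exact ⟨MulEquiv.ofUnique⟩

theorem free_fg {n : ℕ} {F : Type*} [Group F] (H : Subgroup F) (e : FreeGroup (Fin n) ≃* H) :
    H.FG := by
  exact (Group.fg_iff_subgroup_fg H).1 (Group.fg_of_surjective (f := e.toMonoidHom) e.surjective)

end Free

end HNC


namespace HNC

section Tree
variable {I : Type*} (G : I → Type*) [∀ i, Group (G i)]

/-- edges of the tree -/
structure Ed where
  /-- the group element -/
  g : CoprodI G
  /-- the index -/
  i : I

/-- vertices of the tree -/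
abbrev Vt := CoprodI G ⊕ (Σ i : I, CoprodI G ⧸ (CoprodI.of : G i →* CoprodI G).range)

variable {G}

instance : MulAction (CoprodI G) (Ed G) where
  smul a e := ⟨a * e.g, e.i⟩
  one_smul e := by
    show (⟨1 * e.g, e.i⟩ : Ed G) = e
    rw [one_mul]
  mul_smul a b e := by
    show (⟨a * b * e.g, e.i⟩ : Ed G) = ⟨a * (b * e.g), e.i⟩
    rw [mul_assoc]

theorem Ed.smul_def (a : CoprodI G) (e : Ed G) : a • e = ⟨a * e.g, e.i⟩ := rfl

/-- source -/
def sE (e : Ed G) : Vt G := Sum.inl e.g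
/-- target -/
def tE (e : Ed G) : Vt G := Sum.inr ⟨e.i, (e.g : CoprodI G ⧸ (CoprodI.of : G e.i →* CoprodI G).range)⟩

theorem sE_smul (a : CoprodI G) (e : Ed G) : sE (a • e) = a • sE e := rfl
theorem tE_smul (a : CoprodI G) (e : Ed G) : tE (a • e) = a • tE e := rfl

theorem Ed.free (a : CoprodI G) (e : Ed G) (h : a • e = e) : a = 1 := by
  have : a * e.g = e.g := congrArg Ed.g h
  simpa using this

theorem Vt.free (H : Subgroup (CoprodI G))
    (hH : ∀ (s : CoprodI G) (i : I) (g : G i), s * CoprodI.of g * s⁻¹ ∈ H → g = 1) :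
    ∀ h ∈ H, ∀ v : Vt G, h • v = v → h = 1 := by
  rintro h hh (g | ⟨i, g⟩) hv
  · have : h * g = g := Sum.inl_injective hv
    simpa using this
  · induction g using QuotientGroup.induction_on with | H g
    have h1 : (⟨i, ((h * g : CoprodI G) : CoprodI G ⧸ (CoprodI.of : G i →* CoprodI G).range)⟩ :
      Σ i : I, CoprodI G ⧸ (CoprodI.of : G i →* CoprodI G).range) = ⟨i, g⟩ := Sum.inr_injective hv
    have h2 := eq_of_heq (Sigma.mk.inj h1).2
    obtain ⟨x, hx⟩ := QuotientGroup.eq.1 h2.symm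
    have h3 : h = g * CoprodI.of x * g⁻¹ := by rw [hx]; group
    have h4 := hH g i x (h3 ▸ hh)
    rw [h3, h4]; simp

theorem tE_eq (g : CoprodI G) {i : I} (x : G i) :
    tE (⟨g * CoprodI.of x, i⟩ : Ed G) = tE ⟨g, i⟩ := by
  have : ((g * CoprodI.of x : CoprodI G) : CoprodI G ⧸ (CoprodI.of : G i →* CoprodI G).range) =
      (g : CoprodI G ⧸ (CoprodI.of : G i →* CoprodI G).range) := by
    rw [eq_comm, QuotientGroup.eq]
    exact ⟨x, by group⟩
  unfold tE
  simp only [this]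

theorem cn_step (g : CoprodI G) {i : I} (x : G i) :
    Cn (sE (G := G)) tE Set.univ (Sum.inl g) (Sum.inl (g * CoprodI.of x)) := by
  have h1 : Cn (sE (G := G)) tE Set.univ (Sum.inl g) (tE ⟨g, i⟩) :=
    Cn.edge (e := (⟨g, i⟩ : Ed G)) (Set.mem_univ _)
  have h2 : Cn (sE (G := G)) tE Set.univ (Sum.inl (g * CoprodI.of x))
      (tE ⟨g * CoprodI.of x, i⟩) :=
    Cn.edge (e := (⟨g * CoprodI.of x, i⟩ : Ed G)) (Set.mem_univ _)
  rw [tE_eq] at h2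
  exact h1.trans h2.symm

theorem cn_one (g a : CoprodI G) :
    Cn (sE (G := G)) tE Set.univ (Sum.inl a) (Sum.inl (a * g)) := by
  induction g using CoprodI.induction_on generalizing a with
  | one => rw [mul_one]; exact Cn.refl _
  | of i x => exact cn_step a x
  | mul x y hx hy => rw [← mul_assoc]; exact (hx a).trans (hy _)

theorem tree_conn (v w : Vt G) : Cn (sE (G := G)) tE Set.univ v w := by
  have key : ∀ v : Vt G, Cn (sE (G := G)) tE Set.univ (Sum.inl 1) v := by
    rintro (g | ⟨i, g⟩)
    · simpa using cn_one g 1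
    · induction g using QuotientGroup.induction_on with | H g
      have h1 : Cn (sE (G := G)) tE Set.univ (Sum.inl g) (tE ⟨g, i⟩) :=
        Cn.edge (e := (⟨g, i⟩ : Ed G)) (Set.mem_univ _)
      have h2 := cn_one g 1
      rw [one_mul] at h2
      exact h2.trans h1
  exact (key v).symm.trans (key w)

/-- the twisted action of a letter -/
def stepPerm (c : Ed G → ZMod 2) (i : I) : G i →* Equiv.Perm (CoprodI G × ZMod 2) where
  toFun x :=
    { toFun := fun a => (a.1 * CoprodI.of x⁻¹, a.2 + c ⟨a.1 * CoprodI.of x⁻¹, i⟩ - c ⟨a.1, i⟩)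
      invFun := fun a => (a.1 * CoprodI.of x, a.2 + c ⟨a.1 * CoprodI.of x, i⟩ - c ⟨a.1, i⟩)
      left_inv := fun a => by
        simp [mul_assoc, ← map_mul]
      right_inv := fun a => by
        simp [mul_assoc, ← map_mul] }
  map_one' := by
    ext a <;> simp
  map_mul' x y := by
    ext a
    · simp [mul_assoc]
    · simp [mul_assoc]
      ring

/-- the twisted action -/
def twist (c : Ed G → ZMod 2) : CoprodI G →* Equiv.Perm (CoprodI G × ZMod 2) :=
  CoprodI.lift (stepPerm c)

theorem twist_fst (c : Ed G → ZMod 2) (g : CoprodI G) (a) : (twist c g a).1 = a.1 * g⁻¹ := by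
  induction g using CoprodI.induction_on generalizing a with
  | one => simp
  | of i x => simp [twist, stepPerm]
  | mul x y hx hy => rw [map_mul, Equiv.Perm.mul_apply, hx, hy, mul_inv_rev, mul_assoc]

theorem tree_pot : Pot (sE (G := G)) tE := by
  intro c
  let p : CoprodI G → ZMod 2 := fun g => (twist c g⁻¹ (1, 0)).2
  have hp : ∀ g {i} (x : G i), p (g * CoprodI.of x) = p g + c ⟨g * CoprodI.of x, i⟩ - c ⟨g, i⟩ := by
    intro g i x
    have h1 : twist c (g * CoprodI.of x)⁻¹ (1, 0) =
        stepPerm c i x⁻¹ (twist c g⁻¹ (1, 0)) := by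
      rw [mul_inv_rev, map_mul, Equiv.Perm.mul_apply, ← map_inv]
      simp [twist]
    have h2 := twist_fst c g⁻¹ (1, 0)
    simp only [p]
    rw [h1]
    generalize twist c g⁻¹ (1, 0) = a at h2
    obtain ⟨a, u⟩ := a
    simp only [one_mul, inv_inv] at h2
    subst h2
    simp [stepPerm]
  have hq : ∀ i, ∃ q : CoprodI G ⧸ (CoprodI.of : G i →* CoprodI G).range → ZMod 2,
      ∀ g : CoprodI G, q g = p g - c ⟨g, i⟩ := by
    intro i
    refine ⟨Quotient.lift (fun g => p g - c ⟨g, i⟩) ?_, fun g => rfl⟩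
    intro a b hab
    obtain ⟨x, hx⟩ := QuotientGroup.leftRel_apply.1 hab
    have : b = a * CoprodI.of x := by rw [hx]; group
    show p a - c ⟨a, i⟩ = p b - c ⟨b, i⟩
    rw [this, hp]; ring
  choose q hq using hq
  refine ⟨Sum.elim p (fun a => q a.1 a.2), fun e => ?_⟩
  simp only [sE, tE, Sum.elim_inl, Sum.elim_inr]
  rw [hq]
  generalize p e.g = a
  generalize c _ = b
  revert a b
  decide

theorem tree_order [∀ i, LinearOrder (G i)]
    [∀ i, CovariantClass (G i) (G i) (· * ·) (· ≤ ·)] :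
    ∃ _ : LinearOrder (Ed G), ∀ (h : CoprodI G) (a b : Ed G), a < b → h • a < h • b := by
  classical
  let : LinearOrder I := IsWellOrder.linearOrder WellOrderingRel
  obtain ⟨lt, irr, tr, tot, mul⟩ := exists_lt G
  let r : Ed G → Ed G → Prop := fun a b => lt a.g b.g ∨ (a.g = b.g ∧ a.i < b.i)
  have : IsStrictTotalOrder (Ed G) r :=
    { trichotomous := by
        rintro ⟨a, i⟩ ⟨b, j⟩ h1 h2
        simp only [r, not_or, not_and] at h1 h2
        have hab : a = b := by
          by_contra hne
          rcases tot a b hne with h | h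
          · exact h1.1 h
          · exact h2.1 h
        subst hab
        rw [le_antisymm (not_lt.1 (h2.2 rfl)) (not_lt.1 (h1.2 rfl))]
      irrefl := by
        rintro a (h | h)
        · exact irr _ h
        · exact lt_irrefl _ h.2
      trans := by
        rintro ⟨a, i⟩ ⟨b, j⟩ ⟨c, k⟩ (h | ⟨h, h'⟩) (h2 | ⟨h2, h2'⟩)
        · exact Or.inl (tr _ _ _ h h2)
        · simp only at h2; subst h2; exact Or.inl h
        · simp only at h; subst h; exact Or.inl h2
        · exact Or.inr ⟨h.trans h2, h'.trans h2'⟩ }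
  refine ⟨linearOrderOfSTO r, ?_⟩
  rintro h a b (hab | ⟨hab, hab'⟩)
  · exact Or.inl (mul _ _ _ hab)
  · exact Or.inr ⟨by simp [Ed.smul_def, hab], hab'⟩

end Tree

end HNC

/-- Let `G_α`, `α ∈ I`, be nontrivial left ordered groups, `𝓕` their free product, and
`H₁`, `H₂` finitely generated factor-free subgroups of `𝓕` (free of ranks `r₁`, `r₂`).
Then `H₁ ∩ H₂` is free of some finite rank `r` and `r̄(H₁ ∩ H₂) ≤ r̄(H₁) ⬝ r̄(H₂)`,
where `r̄` denotes the reduced rank `max(rank − 1, 0)` (here natural subtraction). -/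
theorem reduced_rank_inter_le_of_leftOrdered
    {I : Type*} {G : I → Type*} [∀ i, Group (G i)] [∀ i, Nontrivial (G i)]
    [∀ i, LinearOrder (G i)]
    [∀ i, CovariantClass (G i) (G i) (· * ·) (· ≤ ·)]
    (H₁ H₂ : Subgroup (CoprodI G))
    (hff₁ : IsFactorFree H₁) (hff₂ : IsFactorFree H₂)
    (r₁ r₂ : ℕ)
    (e₁ : FreeGroup (Fin r₁) ≃* H₁) (e₂ : FreeGroup (Fin r₂) ≃* H₂) :
    ∃ r : ℕ, Nonempty (FreeGroup (Fin r) ≃* ↥(H₁ ⊓ H₂)) ∧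
      r - 1 ≤ (r₁ - 1) * (r₂ - 1) := by
  rcases subsingleton_or_nontrivial ↥(H₁ ⊓ H₂) with hK | hK
  · exact ⟨0, HNC.free_trivial, by simp⟩
  · have n₁ : Nontrivial H₁ :=
      (Subgroup.inclusion_injective (inf_le_left : H₁ ⊓ H₂ ≤ H₁)).nontrivial
    have n₂ : Nontrivial H₂ :=
      (Subgroup.inclusion_injective (inf_le_right : H₁ ⊓ H₂ ≤ H₂)).nontrivial
    obtain ⟨ord, hord⟩ := HNC.tree_order (G := G)
    obtain ⟨mf, m⟩ := HNC.comb HNC.sE_smul HNC.tE_smul HNC.tree_conn hord HNC.Ed.free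
      HNC.tree_pot H₁ H₂ (HNC.free_fg H₁ e₁) (HNC.free_fg H₂ e₂)
      (HNC.Vt.free H₁ hff₁) (HNC.Vt.free H₂ hff₂)
    have f₁ : IsFreeGroup H₁ := IsFreeGroup.ofMulEquiv e₁
    have f : IsFreeGroup ↥(H₁ ⊓ H₂) := by
      have e : ((H₁ ⊓ H₂).subgroupOf H₁) ≃* ↥(H₁ ⊓ H₂) :=
        Subgroup.subgroupOfEquivOfLe inf_le_left
      exact IsFreeGroup.ofMulEquiv e
    obtain ⟨r, ⟨e⟩⟩ := HNC.free_finite (H := ↥(H₁ ⊓ H₂))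
    refine ⟨r, ⟨e⟩, ?_⟩
    rwa [HNC.free_finrank e, HNC.free_finrank e₁, HNC.free_finrank e₂] at m
end

section
/- Let G_α, α ∈ I, be nontrivial left ordered groups, let 𝓕 = *_{α∈I} G_α be their free product, and let H₁, H₂ be finitely generated factor-free subgroups of 𝓕. Then there are only finitely many double cosets H₁ t H₂, t ∈ 𝓕, with the property H₁ ∩ t H₂ t⁻¹ ≠ {1}, and if S(H₁, H₂) is any set of representatives of these double cosets, then Σ_{s ∈ S(H₁,H₂)} r̄(H₁ ∩ s H₂ s⁻¹) ≤ r̄(H₁) · r̄(H₂). -/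
open Monoid Finset

/-- The conjugate subgroup `t H t⁻¹`. -/
def conjSubgroup {F : Type*} [Group F] (t : F) (H : Subgroup F) : Subgroup F :=
  Subgroup.map (MulAut.conj t).toMonoidHom H

/-- `s` and `t` lie in the same double coset `H₁ s H₂ = H₁ t H₂`. -/
def SameDoset {F : Type*} [Group F] (H₁ H₂ : Subgroup F) (s t : F) : Prop :=
  ∃ h₁ ∈ H₁, ∃ h₂ ∈ H₂, t = h₁ * s * h₂

/-- `S` is a set of representatives of those double cosets `H₁ t H₂` of `F`
that have the property `H₁ ∩ t H₂ t⁻¹ ≠ {1}`. -/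
def IsDosetTransversal {F : Type*} [Group F] (H₁ H₂ : Subgroup F) (S : Set F) : Prop :=
  (∀ s ∈ S, H₁ ⊓ conjSubgroup s H₂ ≠ ⊥) ∧
  (∀ s ∈ S, ∀ s' ∈ S, SameDoset H₁ H₂ s s' → s = s') ∧
  (∀ t : F, H₁ ⊓ conjSubgroup t H₂ ≠ ⊥ → ∃ s ∈ S, SameDoset H₁ H₂ s t)

namespace SHN

set_option linter.unusedSectionVars false

/-- `a b : E → V` (source and target maps) form a tree, cohomologically. -/
structure IsTreeLike {V E : Type*} (a b : E → V) : Prop where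
  int : ∀ φ : E → ℚ, ∃ p : V → ℚ, ∀ e, p (b e) - p (a e) = φ e
  conn : ∀ p : V → ℚ, (∀ e, p (a e) = p (b e)) → ∀ x y, p x = p y

/-- Reachability using only edges in `S`. -/
def Reach {V E : Type*} (a b : E → V) (S : Set E) : V → V → Prop :=
  Relation.EqvGen (fun x y => ∃ e ∈ S, a e = x ∧ b e = y)

/-- The component of `x` in the graph with edge set `S`. -/
def Comp {V E : Type*} (a b : E → V) (S : Set E) (x : V) : Set V :=
  {y | Reach a b S x y}

section reach
variable {V E : Type*} {a b : E → V}

theorem Reach.refl (S : Set E) (x : V) : Reach a b S x x := Relation.EqvGen.refl x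
theorem Reach.symm {S : Set E} {x y : V} (h : Reach a b S x y) : Reach a b S y x :=
  Relation.EqvGen.symm _ _ h
theorem Reach.trans {S : Set E} {x y z : V} (h : Reach a b S x y) (h' : Reach a b S y z) :
    Reach a b S x z := Relation.EqvGen.trans _ _ _ h h'
theorem Reach.edge {S : Set E} {e : E} (he : e ∈ S) : Reach a b S (a e) (b e) :=
  Relation.EqvGen.rel _ _ ⟨e, he, rfl, rfl⟩

theorem Reach.rec' {S : Set E} {x y : V} (h : Reach a b S x y) (r : V → V → Prop)
    (hr : Equivalence r) (he : ∀ e ∈ S, r (a e) (b e)) : r x y := by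
  induction h with
  | rel x y h => obtain ⟨e, h, rfl, rfl⟩ := h; exact he e h
  | refl x => exact hr.refl x
  | symm x y _ ih => exact hr.symm ih
  | trans x y z _ _ ih1 ih2 => exact hr.trans ih1 ih2

theorem Reach.equivalence (S : Set E) : Equivalence (Reach a b S) :=
  ⟨Reach.refl S, Reach.symm, Reach.trans⟩

theorem Reach.mono {S S' : Set E} (hS : S ⊆ S') {x y : V} (h : Reach a b S x y) :
    Reach a b S' x y :=
  h.rec' _ (Reach.equivalence S') (fun _ he => Reach.edge (hS he))

theorem Reach.map {V' E' : Type*} {a' b' : E' → V'} (f : V → V') (g : E → E')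
    (hfa : ∀ e, a' (g e) = f (a e)) (hfb : ∀ e, b' (g e) = f (b e))
    {S : Set E} {S' : Set E'} (hS : ∀ e ∈ S, g e ∈ S') {x y : V} (h : Reach a b S x y) :
    Reach a' b' S' (f x) (f y) := by
  refine h.rec' (fun x y => Reach a' b' S' (f x) (f y))
    ⟨fun x => Reach.refl _ _, Reach.symm, Reach.trans⟩ ?_
  intro e he
  rw [← hfa, ← hfb]
  exact Reach.edge (hS e he)

theorem Reach.const {S : Set E} {x y : V} (h : Reach a b S x y) {α : Type*} (p : V → α)
    (hp : ∀ e ∈ S, p (a e) = p (b e)) : p x = p y :=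
  h.rec' (fun x y => p x = p y) ⟨fun _ => rfl, Eq.symm, Eq.trans⟩ hp

theorem Reach.closed {S : Set E} {x y : V} (h : Reach a b S x y) (D : Set V)
    (hD : ∀ e ∈ S, a e ∈ D ↔ b e ∈ D) (hx : x ∈ D) : y ∈ D := by
  have := h.const (fun z => z ∈ D) (fun e he => propext (hD e he))
  simp only [eq_iff_iff] at this
  exact this.1 hx

theorem Comp.eq_of_reach {S : Set E} {x y : V} (h : Reach a b S x y) :
    Comp a b S x = Comp a b S y := by
  ext z; exact ⟨fun hz => h.symm.trans hz, fun hz => h.trans hz⟩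

theorem Comp.mono {S S' : Set E} (hS : S ⊆ S') (x : V) : Comp a b S x ⊆ Comp a b S' x :=
  fun _ h => Reach.mono hS h

theorem Comp.self (S : Set E) (x : V) : x ∈ Comp a b S x := Reach.refl S x

theorem Comp.infinite_map {V' E' : Type*} {a' b' : E' → V'} (f : V → V') (g : E → E')
    (hf : Function.Injective f)
    (hfa : ∀ e, a' (g e) = f (a e)) (hfb : ∀ e, b' (g e) = f (b e))
    {S : Set E} {S' : Set E'} (hS : ∀ e ∈ S, g e ∈ S') {x : V} (h : (Comp a b S x).Infinite) :
    (Comp a' b' S' (f x)).Infinite := by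
  refine (h.image (f := f) hf.injOn).mono ?_
  rintro _ ⟨y, hy, rfl⟩
  exact Reach.map f g hfa hfb hS hy

/-- A reachable pair is joined by finitely many edges, all in the component. -/
theorem Reach.finite_support {S : Set E} {x y : V} (h : Reach a b S x y) :
    ∃ P : Set E, P.Finite ∧ Reach a b P x y ∧ ∀ e ∈ P, Reach a b P x (a e) := by
  induction h with
  | rel x y h =>
    obtain ⟨e, h, rfl, rfl⟩ := h
    exact ⟨{e}, Set.finite_singleton e, Reach.edge rfl, by rintro _ rfl; exact Reach.refl _ _⟩
  | refl x => exact ⟨∅, Set.finite_empty, Reach.refl _ _, by simp⟩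
  | symm x y _ ih =>
    obtain ⟨P, h1, h2, h3⟩ := ih
    exact ⟨P, h1, h2.symm, fun e he => h2.symm.trans (h3 e he)⟩
  | trans x y z _ _ ih1 ih2 =>
    obtain ⟨P, h1, h2, h3⟩ := ih1
    obtain ⟨Q, k1, k2, k3⟩ := ih2
    have hP : P ⊆ P ∪ Q := Set.subset_union_left
    have hQ : Q ⊆ P ∪ Q := Set.subset_union_right
    refine ⟨P ∪ Q, h1.union k1, (h2.mono hP).trans (k2.mono hQ), ?_⟩
    rintro e (he | he)
    · exact (h3 e he).mono hP
    · exact (h2.mono hP).trans ((k3 e he).mono hQ)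

theorem Reach.exists_Iic [LinearOrder E] {U : Set E} {x y : V} (h : Reach a b U x y) :
    x = y ∨ ∃ e ∈ U, Reach a b (Set.Iic e) x y := by
  induction h with
  | rel x y h =>
    obtain ⟨e, h, rfl, rfl⟩ := h
    exact Or.inr ⟨e, h, Reach.edge (Set.mem_Iic.2 le_rfl)⟩
  | refl x => exact Or.inl rfl
  | symm x y _ ih =>
    rcases ih with rfl | ⟨e, he, h⟩
    · exact Or.inl rfl
    · exact Or.inr ⟨e, he, h.symm⟩
  | trans x y z _ _ ih1 ih2 =>
    rcases ih1 with rfl | ⟨e, he, h⟩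
    · exact ih2
    rcases ih2 with rfl | ⟨e', he', h'⟩
    · exact Or.inr ⟨e, he, h⟩
    refine Or.inr ⟨max e e', ?_, ?_⟩
    · rcases max_choice e e' with h | h <;> rw [h] <;> assumption
    · exact (h.mono (Set.Iic_subset_Iic.2 (le_max_left _ _))).trans
        (h'.mono (Set.Iic_subset_Iic.2 (le_max_right _ _)))

theorem IsTreeLike.reach (hT : IsTreeLike a b) (x y : V) : Reach a b Set.univ x y := by
  classical
  have := hT.conn (fun z => if Reach a b Set.univ x z then 1 else 0) (fun e => by
    have : Reach a b Set.univ x (a e) ↔ Reach a b Set.univ x (b e) :=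
      ⟨fun h => h.trans (Reach.edge (Set.mem_univ e)), fun h => h.trans (Reach.edge (Set.mem_univ e)).symm⟩
    simp [this]) x y
  by_contra hc
  simp [Reach.refl, hc] at this

theorem IsTreeLike.not_reach (hT : IsTreeLike a b) {S : Set E} {e : E} (he : e ∉ S) :
    ¬ Reach a b S (a e) (b e) := by
  classical
  intro h
  obtain ⟨p, hp⟩ := hT.int (fun e' => if e' = e then 1 else 0)
  have := h.const p (fun e' he' => by
    have h1 := hp e'
    rw [if_neg (by rintro rfl; exact he he')] at h1
    linarith)
  have h2 := hp e
  rw [if_pos rfl] at h2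
  linarith

end reach

section kill
variable {V E : Type*} {a b : E → V} [LinearOrder E] [LinearOrder V]

/-- `v` is the largest vertex of a finite component. -/
def IsRoot (a b : E → V) (S : Set E) (v : V) : Prop :=
  (Comp a b S v).Finite ∧ ∀ y ∈ Comp a b S v, y ≤ v

/-- Adding the edge `e` kills the root `v`. -/
def Kills (a b : E → V) (e : E) (v : V) : Prop :=
  IsRoot a b (Set.Iio e) v ∧ ¬ IsRoot a b (Set.Iic e) v

/-- The edge `e` joins two infinite components of the graph of smaller edges. -/
def Bridge {V E : Type*} [LinearOrder E] (a b : E → V) (e : E) : Prop :=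
  (Comp a b (Set.Iio e) (a e)).Infinite ∧ (Comp a b (Set.Iio e) (b e)).Infinite

theorem IsRoot.anti {S S' : Set E} (hS : S ⊆ S') {v : V} (h : IsRoot a b S' v) :
    IsRoot a b S v :=
  ⟨h.1.subset (Comp.mono hS v), fun y hy => h.2 y (Comp.mono hS v hy)⟩

theorem Kills.edge_unique {e e' : E} {v : V} (h : Kills a b e v) (h' : Kills a b e' v) :
    e = e' := by
  rcases lt_trichotomy e e' with hl | hl | hl
  · exact absurd (h'.1.anti (Set.Iic_subset_Iio.2 hl)) h.2
  · exact hl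
  · exact absurd (h.1.anti (Set.Iic_subset_Iio.2 hl)) h'.2

theorem comp_Iic_closed (e : E) {y z : V} (h : Reach a b (Set.Iic e) y z) :
    Reach a b (Set.Iio e) y z ∨
      ((Reach a b (Set.Iio e) (a e) y ∨ Reach a b (Set.Iio e) (b e) y) ∧
       (Reach a b (Set.Iio e) (a e) z ∨ Reach a b (Set.Iio e) (b e) z)) := by
  refine h.rec' (fun y z => Reach a b (Set.Iio e) y z ∨
      ((Reach a b (Set.Iio e) (a e) y ∨ Reach a b (Set.Iio e) (b e) y) ∧
       (Reach a b (Set.Iio e) (a e) z ∨ Reach a b (Set.Iio e) (b e) z))) ⟨?_, ?_, ?_⟩ ?_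
  · intro x; exact Or.inl (Reach.refl _ _)
  · rintro x y (h | ⟨h1, h2⟩)
    · exact Or.inl h.symm
    · exact Or.inr ⟨h2, h1⟩
  · rintro x y z (h | ⟨h1, h2⟩) (k | ⟨k1, k2⟩)
    · exact Or.inl (h.trans k)
    · exact Or.inr ⟨k1.imp (fun t => t.trans h.symm) (fun t => t.trans h.symm), k2⟩
    · exact Or.inr ⟨h1, h2.imp (fun t => t.trans k) (fun t => t.trans k)⟩
    · exact Or.inr ⟨h1, k2⟩
  · intro e' he'
    rcases (Set.mem_Iic.1 he').lt_or_eq with hl | rfl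
    · exact Or.inl (Reach.edge hl)
    · exact Or.inr ⟨Or.inl (Reach.refl _ _), Or.inr (Reach.refl _ _)⟩

theorem Iio_sub_Iic (e : E) : Set.Iio e ⊆ Set.Iic e := fun _ h => le_of_lt h

theorem comp_Iic_eq (e : E) :
    Comp a b (Set.Iic e) (a e) =
      Comp a b (Set.Iio e) (a e) ∪ Comp a b (Set.Iio e) (b e) := by
  ext z
  constructor
  · intro h
    rcases comp_Iic_closed e h with h | ⟨_, h⟩
    · exact Or.inl h
    · exact h
  · rintro (h | h)
    · exact Comp.mono (Iio_sub_Iic e) _ h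
    · exact (Reach.edge (Set.mem_Iic.2 le_rfl)).trans (Reach.mono (Iio_sub_Iic e) h)

theorem comp_Iic_eq' (e : E) :
    Comp a b (Set.Iic e) (b e) =
      Comp a b (Set.Iio e) (a e) ∪ Comp a b (Set.Iio e) (b e) := by
  rw [← comp_Iic_eq]
  exact (Comp.eq_of_reach (Reach.edge (Set.mem_Iic.2 le_rfl))).symm

theorem Kills.mem {e : E} {v : V} (h : Kills a b e v) :
    Reach a b (Set.Iio e) (a e) v ∨ Reach a b (Set.Iio e) (b e) v := by
  by_contra hc
  refine h.2 ?_
  have : Comp a b (Set.Iic e) v ⊆ Comp a b (Set.Iio e) v := by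
    intro z hz
    rcases comp_Iic_closed e hz with h | ⟨h, _⟩
    · exact h
    · exact absurd h hc
  exact ⟨h.1.1.subset this, fun y hy => h.1.2 y (this hy)⟩

theorem Kills.comp {e : E} {v : V} (h : Kills a b e v) :
    Comp a b (Set.Iic e) v = Comp a b (Set.Iio e) (a e) ∪ Comp a b (Set.Iio e) (b e) := by
  rcases h.mem with h | h
  · rw [← comp_Iic_eq]; exact (Comp.eq_of_reach (h.mono (Iio_sub_Iic e))).symm
  · rw [← comp_Iic_eq']; exact (Comp.eq_of_reach (h.mono (Iio_sub_Iic e))).symm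

theorem Kills.not_bridge {e : E} {v : V} (h : Kills a b e v) : ¬ Bridge a b e := by
  rintro ⟨h1, h2⟩
  rcases h.mem with hm | hm
  · exact h1 (by rw [Comp.eq_of_reach hm]; exact h.1.1)
  · exact h2 (by rw [Comp.eq_of_reach hm]; exact h.1.1)

theorem Kills.aux {e : E} {v v' : V} (h : Kills a b e v) (h' : Kills a b e v')
    (hv : Reach a b (Set.Iio e) (a e) v) (hv' : Reach a b (Set.Iio e) (b e) v') : False := by
  have hA : Comp a b (Set.Iio e) (a e) = Comp a b (Set.Iio e) v := Comp.eq_of_reach hv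
  have hB : Comp a b (Set.Iio e) (b e) = Comp a b (Set.Iio e) v' := Comp.eq_of_reach hv'
  have hc := h.comp
  have hc' := h'.comp
  rw [hA, hB] at hc hc'
  have h1 : v < v' := by
    by_contra hn
    push Not at hn
    refine h.2 ⟨by rw [hc]; exact h.1.1.union h'.1.1, ?_⟩
    rw [hc]
    rintro y (hy | hy)
    · exact h.1.2 y hy
    · exact (h'.1.2 y hy).trans hn
  refine h'.2 ⟨by rw [hc']; exact h.1.1.union h'.1.1, ?_⟩
  rw [hc']
  rintro y (hy | hy)
  · exact (h.1.2 y hy).trans h1.le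
  · exact h'.1.2 y hy

theorem Kills.vertex_unique {e : E} {v v' : V} (h : Kills a b e v) (h' : Kills a b e v') :
    v = v' := by
  have key : Reach a b (Set.Iio e) v v' → v = v' := fun hr =>
    le_antisymm (h'.1.2 v hr.symm) (h.1.2 v' hr)
  rcases h.mem with hm | hm <;> rcases h'.mem with hm' | hm'
  · exact key (hm.symm.trans hm')
  · exact (Kills.aux h h' hm hm').elim
  · exact (Kills.aux h' h hm' hm).elim
  · exact key (hm.symm.trans hm')

theorem exists_root {S : Set E} {x : V} (h : (Comp a b S x).Finite) :
    ∃ v, Reach a b S x v ∧ IsRoot a b S v := by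
  obtain ⟨v, hv, hmax⟩ := h.exists_maximalFor id _ ⟨x, Comp.self S x⟩
  refine ⟨v, hv, ?_⟩
  rw [IsRoot, ← Comp.eq_of_reach hv]
  refine ⟨h, fun y hy => ?_⟩
  rcases le_total y v with h | h
  · exact h
  · exact hmax hy h

theorem exists_kills (hT : IsTreeLike a b) {e : E} (he : ¬ Bridge a b e) :
    ∃ v, Kills a b e v := by
  by_cases hA : (Comp a b (Set.Iio e) (a e)).Finite <;>
  by_cases hB : (Comp a b (Set.Iio e) (b e)).Finite
  · obtain ⟨u, hu, hur⟩ := exists_root hA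
    obtain ⟨w, hw, hwr⟩ := exists_root hB
    have hne : u ≠ w := by
      rintro rfl
      exact hT.not_reach (S := Set.Iio e) (by simp) (hu.trans hw.symm)
    have huw : Reach a b (Set.Iic e) u w :=
      (hu.mono (Iio_sub_Iic e)).symm.trans
        ((Reach.edge (Set.mem_Iic.2 le_rfl)).trans (hw.mono (Iio_sub_Iic e)))
    rcases lt_or_gt_of_ne hne with hl | hl
    · exact ⟨u, hur, fun h => absurd (h.2 w huw) (not_le.2 hl)⟩
    · exact ⟨w, hwr, fun h => absurd (h.2 u huw.symm) (not_le.2 hl)⟩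
  · obtain ⟨u, hu, hur⟩ := exists_root hA
    refine ⟨u, hur, fun h => hB ?_⟩
    have h1 := h.1
    rw [← Comp.eq_of_reach (hu.mono (Iio_sub_Iic e)), comp_Iic_eq] at h1
    exact h1.subset Set.subset_union_right
  · obtain ⟨u, hu, hur⟩ := exists_root hB
    refine ⟨u, hur, fun h => hA ?_⟩
    have h1 := h.1
    rw [← Comp.eq_of_reach (hu.mono (Iio_sub_Iic e)), comp_Iic_eq'] at h1
    exact h1.subset Set.subset_union_left
  · exact absurd ⟨hA, hB⟩ he

end kill

section action
variable {V E H : Type*} {a b : E → V} [Group H] [MulAction H V] [MulAction H E]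

/-- Equivariance of the endpoint maps, freeness on vertices. -/
structure IsFreeGraph (H : Type*) {V E : Type*} [Group H] [MulAction H V] [MulAction H E]
    (a b : E → V) : Prop where
  ha : ∀ (h : H) (e : E), a (h • e) = h • a e
  hb : ∀ (h : H) (e : E), b (h • e) = h • b e
  free : ∀ (h : H) (x : V), h • x = x → h = 1

theorem IsFreeGraph.freeE (hG : IsFreeGraph H a b) (h : H) (e : E) (he : h • e = e) : h = 1 :=
  hG.free h (a e) (by rw [← hG.ha, he])

theorem Reach.smul (hG : IsFreeGraph H a b) (h : H) {S S' : Set E}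
    (hS : ∀ e ∈ S, h • e ∈ S') {x y : V} (hr : Reach a b S x y) :
    Reach a b S' (h • x) (h • y) :=
  hr.map (fun x => h • x) (fun e => h • e) (hG.ha h) (hG.hb h) hS

theorem locally_finite (hG : IsFreeGraph H a b) [Finite (MulAction.orbitRel.Quotient H E)]
    (v : V) : {e : E | a e = v ∨ b e = v}.Finite := by
  have key : ∀ c : E → V, (∀ (h : H) (e : E), c (h • e) = h • c e) → {e : E | c e = v}.Finite := by
    intro c hc
    refine Set.Finite.of_injOn (f := fun e => (Quotient.mk'' e : MulAction.orbitRel.Quotient H E))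
      (t := Set.univ) (fun _ _ => Set.mem_univ _) ?_ Set.finite_univ
    intro e he e' he' hee
    have : e ∈ MulAction.orbit H e' := MulAction.orbitRel_apply.1 (Quotient.exact hee)
    obtain ⟨h, rfl⟩ := this
    have h1 : h • c e' = c e' := by
      have := hc h e'
      simp only [Set.mem_ofPred_eq] at he he'
      rw [← this, he, he']
    have := hG.free h _ h1
    subst this
    simp
  exact (key a hG.ha).union (key b hG.hb)

theorem exists_edge_killing [LinearOrder E] [LinearOrder V] [Infinite V]
    [Finite (MulAction.orbitRel.Quotient H E)] [Finite (MulAction.orbitRel.Quotient H V)]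
    (hT : IsTreeLike a b) (hG : IsFreeGraph H a b)
    (hE : ∀ (h : H) (e e' : E), e ≤ e' → h • e ≤ h • e')
    (hV : ∀ (h : H) (x y : V), x ≤ y → h • x ≤ h • y) (v : V) :
    ∃ e, Kills a b e v := by
  classical
  set U : Set E := {e | IsRoot a b (Set.Iic e) v} with hU
  have hdown : ∀ e ∈ U, ∀ e' ≤ e, e' ∈ U := fun e he e' hle =>
    IsRoot.anti (Set.Iic_subset_Iic.2 hle) he
  set D := Comp a b U v with hD
  have hDle : ∀ y ∈ D, y ≤ v := by
    intro y hy
    rcases Reach.exists_Iic hy with rfl | ⟨e, he, hr⟩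
    · exact le_rfl
    · exact he.2 y hr
  by_cases hfin : D.Finite
  · -- finite case
    have hex : ∃ e, ¬ (a e ∈ D ↔ b e ∈ D) := by
      by_contra hc
      push Not at hc
      have : D = Set.univ := by
        ext y
        simp only [Set.mem_univ, iff_true]
        exact (hT.reach v y).closed D (fun e _ => hc e) (Comp.self U v)
      exact Set.infinite_univ (this ▸ hfin)
    have hbf : {e | ¬ (a e ∈ D ↔ b e ∈ D)}.Finite := by
      refine (hfin.biUnion (t := fun x => {e : E | a e = x ∨ b e = x})
        (fun x _ => locally_finite hG x)).subset ?_
      intro e he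
      simp only [Set.mem_ofPred_eq] at he
      simp only [Set.mem_iUnion, Set.mem_ofPred_eq]
      by_cases h1 : a e ∈ D
      · exact ⟨_, h1, Or.inl rfl⟩
      · by_cases h2 : b e ∈ D
        · exact ⟨_, h2, Or.inr rfl⟩
        · exact absurd (by simp [h1, h2]) he
    obtain ⟨e0, he0, hmin⟩ := hbf.exists_minimalFor id _ hex
    have he0U : e0 ∉ U := by
      intro h
      apply he0
      have hr : Reach a b U (a e0) (b e0) := Reach.edge h
      exact ⟨fun k => Reach.trans k hr, fun k => Reach.trans k hr.symm⟩
    have hlt : U ⊆ Set.Iio e0 := by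
      intro e he
      by_contra hc
      exact he0U (hdown e he e0 (not_lt.1 hc))
    have hsub : Comp a b (Set.Iio e0) v ⊆ D := by
      intro y hy
      refine Reach.closed hy D ?_ (Comp.self U v)
      intro e he
      by_contra hc
      exact absurd (hmin (j := e) hc (le_of_lt he)) (not_le.2 he)
    exact ⟨e0, ⟨hfin.subset hsub, fun y hy => hDle y (hsub hy)⟩, he0U⟩
  · exfalso
    have hinf : D.Infinite := hfin
    -- two points of D in one orbit
    obtain ⟨x, hx, y, hy, hxy, hq⟩ := hinf.exists_ne_map_eq_of_mapsTo
      (f := fun x => (Quotient.mk'' x : MulAction.orbitRel.Quotient H V)) (t := Set.univ)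
      (fun _ _ => Set.mem_univ _) Set.finite_univ
    have : y ∈ MulAction.orbit H x := MulAction.orbitRel_apply.1 (Quotient.exact hq.symm)
    obtain ⟨h, hh⟩ := this
    simp only at hh
    have hh1 : h ≠ 1 := by rintro rfl; simp at hh; exact hxy hh
    -- proper inclusion is impossible
    have key : ∀ (k : H) (z : V), z ∈ D → k • z ∈ D → ∀ e ∈ U, k⁻¹ • e ∈ U := by
      intro k z hz hkz e he
      by_contra hc
      have hsm : ∀ e' ∈ U, k • e' ∈ Set.Iic e := by
        intro e' he'
        have h1 : e' ≤ k⁻¹ • e := by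
          by_contra hcc
          exact hc (hdown e' he' _ (le_of_lt (not_le.1 hcc)))
        have := hE k _ _ h1
        simpa using this
      have hkD : ∀ w ∈ D, k • w ∈ Comp a b (Set.Iic e) (k • z) := fun w hw =>
        Reach.smul hG k hsm (Reach.trans (Reach.symm hz) hw)
      have hfinz : (Comp a b (Set.Iic e) (k • z)).Finite := by
        rcases Reach.exists_Iic hkz with h1 | ⟨e1, he1, hr⟩
        · rw [← h1]; exact he.1
        · have hm : max e e1 ∈ U := by rcases max_choice e e1 with h | h <;> rw [h] <;> assumption
          refine Set.Finite.subset ?_ (Comp.mono (Set.Iic_subset_Iic.2 (le_max_left e e1)) _)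
          rw [← Comp.eq_of_reach (hr.mono (Set.Iic_subset_Iic.2 (le_max_right e e1)))]
          exact hm.1
      refine (hinf.image (f := fun w => k • w) (MulAction.injective k).injOn) (hfinz.subset ?_)
      rintro _ ⟨w, hw, rfl⟩
      exact hkD w hw
    have k1 := key h x hx (by rw [hh]; exact hy)
    have k2 := key h⁻¹ y hy (by rw [← hh]; simpa using hx)
    simp only [inv_inv] at k2
    have m1 : h • v ∈ D := by
      have : Reach a b U (h • x) (h • v) := Reach.smul hG h k2 (Reach.symm hx)
      rw [hh] at this
      exact Reach.trans hy this
    have m2 : h⁻¹ • v ∈ D := by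
      have : Reach a b U (h⁻¹ • y) (h⁻¹ • v) := Reach.smul hG h⁻¹ k1 (Reach.symm hy)
      rw [← hh, inv_smul_smul] at this
      exact Reach.trans hx this
    have l1 := hDle _ m1
    have l2 := hV h _ _ (hDle _ m2)
    rw [smul_inv_smul] at l2
    exact hh1 (hG.free h v (le_antisymm l1 l2))

theorem smul_Iio [LinearOrder E] (hE : ∀ (h : H) (e e' : E), e ≤ e' → h • e ≤ h • e') (h : H)
    (e : E) : ∀ e' ∈ Set.Iio e, h • e' ∈ Set.Iio (h • e) := by
  intro e' he'
  have h1 : e' < e := he'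
  exact lt_of_le_of_ne (hE h _ _ h1.le) (fun hc => h1.ne (MulAction.injective h hc))

theorem smul_Iic [LinearOrder E] (hE : ∀ (h : H) (e e' : E), e ≤ e' → h • e ≤ h • e') (h : H)
    (e : E) : ∀ e' ∈ Set.Iic e, h • e' ∈ Set.Iic (h • e) :=
  fun e' he' => hE h e' e he'

theorem comp_smul (hG : IsFreeGraph H a b) (h : H) {S S' : Set E}
    (hS : ∀ e ∈ S, h • e ∈ S') (hS' : ∀ e ∈ S', h⁻¹ • e ∈ S) (x : V) :
    Comp a b S' (h • x) = (fun y => h • y) '' Comp a b S x := by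
  ext y
  constructor
  · intro hy
    refine ⟨h⁻¹ • y, ?_, by simp⟩
    have := Reach.smul hG h⁻¹ hS' hy
    rw [inv_smul_smul] at this
    exact this
  · rintro ⟨y, hy, rfl⟩
    exact Reach.smul hG h hS hy

theorem IsRoot.smul [LinearOrder V] (hG : IsFreeGraph H a b)
    (hV : ∀ (h : H) (x y : V), x ≤ y → h • x ≤ h • y) (h : H) {S S' : Set E}
    (hS : ∀ e ∈ S, h • e ∈ S') (hS' : ∀ e ∈ S', h⁻¹ • e ∈ S) {x : V} (hr : IsRoot a b S x) :
    IsRoot a b S' (h • x) := by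
  rw [IsRoot, comp_smul hG h hS hS']
  refine ⟨hr.1.image _, ?_⟩
  rintro _ ⟨y, hy, rfl⟩
  exact hV h _ _ (hr.2 y hy)

theorem Kills.smul [LinearOrder E] [LinearOrder V] (hG : IsFreeGraph H a b)
    (hE : ∀ (h : H) (e e' : E), e ≤ e' → h • e ≤ h • e')
    (hV : ∀ (h : H) (x y : V), x ≤ y → h • x ≤ h • y) (h : H) {e : E} {v : V}
    (hk : Kills a b e v) : Kills a b (h • e) (h • v) := by
  constructor
  · refine hk.1.smul hG hV h (smul_Iio hE h e) ?_
    have := smul_Iio hE h⁻¹ (h • e)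
    rwa [inv_smul_smul] at this
  · intro hc
    apply hk.2
    have h1 := smul_Iic hE h⁻¹ (h • e)
    have h2 := smul_Iic hE h e
    rw [inv_smul_smul] at h1
    have := hc.smul hG hV h⁻¹ h1 (by rwa [inv_inv])
    rwa [inv_smul_smul] at this

theorem Bridge.smul [LinearOrder E] (hG : IsFreeGraph H a b)
    (hE : ∀ (h : H) (e e' : E), e ≤ e' → h • e ≤ h • e') (h : H) {e : E}
    (hk : Bridge a b e) : Bridge a b (h • e) := by
  constructor
  · rw [hG.ha]
    exact Comp.infinite_map (fun x => h • x) (fun e => h • e) (MulAction.injective h)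
      (hG.ha h) (hG.hb h) (smul_Iio hE h e) hk.1
  · rw [hG.hb]
    exact Comp.infinite_map (fun x => h • x) (fun e => h • e) (MulAction.injective h)
      (hG.ha h) (hG.hb h) (smul_Iio hE h e) hk.2

/-- Orbits of bridges. -/
def BridgeOrbits (H : Type*) {V E : Type*} [Group H] [MulAction H E] [LinearOrder E]
    (a b : E → V) : Set (MulAction.orbitRel.Quotient H E) :=
  (fun e => (Quotient.mk'' e : MulAction.orbitRel.Quotient H E)) '' {e | Bridge a b e}

theorem card_bridgeOrbits_aux [LinearOrder E] [LinearOrder V] [Infinite V]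
    [Finite (MulAction.orbitRel.Quotient H E)] [Finite (MulAction.orbitRel.Quotient H V)]
    (hT : IsTreeLike a b) (hG : IsFreeGraph H a b)
    (hE : ∀ (h : H) (e e' : E), e ≤ e' → h • e ≤ h • e')
    (hV : ∀ (h : H) (x y : V), x ≤ y → h • x ≤ h • y) :
    (BridgeOrbits H a b).ncard + Nat.card (MulAction.orbitRel.Quotient H V) =
      Nat.card (MulAction.orbitRel.Quotient H E) := by
  classical
  rw [← Set.ncard_add_ncard_compl (BridgeOrbits H a b)]
  congr 1
  choose f hf using fun v => exists_edge_killing hT hG hE hV v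
  have hfs : ∀ (h : H) v, f (h • v) = h • f v := fun h v =>
    (hf (h • v)).edge_unique ((hf v).smul hG hE hV h)
  have hmk : ∀ {e e' : E}, (Quotient.mk'' e : MulAction.orbitRel.Quotient H E) = Quotient.mk'' e' ↔
      ∃ h : H, h • e' = e := by
    intro e e'
    rw [Quotient.eq'']
    exact Iff.rfl
  have hmkV : ∀ {e e' : V}, (Quotient.mk'' e : MulAction.orbitRel.Quotient H V) = Quotient.mk'' e' ↔
      ∃ h : H, h • e' = e := by
    intro e e'
    rw [Quotient.eq'']
    exact Iff.rfl
  let F : MulAction.orbitRel.Quotient H V → MulAction.orbitRel.Quotient H E :=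
    Quotient.lift (fun v => (Quotient.mk'' (f v))) (fun v w hvw => by
      obtain ⟨h, rfl⟩ := hvw
      exact hmk.2 ⟨h, (hfs h w).symm⟩)
  have hFi : Function.Injective F := by
    intro x y
    induction x using Quotient.inductionOn'
    induction y using Quotient.inductionOn'
    rename_i x y
    intro hxy
    obtain ⟨h, hh⟩ := hmk.1 hxy
    refine hmkV.2 ⟨h, ?_⟩
    rw [← hfs] at hh
    have h1 := hf (h • y)
    rw [hh] at h1
    exact h1.vertex_unique (hf x)
  have hFr : Set.range F = (BridgeOrbits H a b)ᶜ := by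
    ext o
    induction o using Quotient.inductionOn'
    rename_i e
    constructor
    · rintro ⟨v, hv⟩ ⟨e', he', hee⟩
      induction v using Quotient.inductionOn'
      rename_i v
      have : (Quotient.mk'' (f v) : MulAction.orbitRel.Quotient H E) = Quotient.mk'' e' := by
        rw [show (Quotient.mk'' (f v) : MulAction.orbitRel.Quotient H E) = _ from hv]
        exact hee.symm
      obtain ⟨h, hh⟩ := hmk.1 this
      apply (hf v).not_bridge
      rw [← hh]
      exact Bridge.smul hG hE h he'
    · intro he
      have : ¬ Bridge a b e := fun hb => he ⟨e, hb, rfl⟩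
      obtain ⟨v, hv⟩ := exists_kills hT this
      refine ⟨Quotient.mk'' v, ?_⟩
      have : f v = e := (hf v).edge_unique hv
      show Quotient.mk'' (f v) = _
      rw [this]
  rw [← hFr, ← Set.image_univ, Set.ncard_image_of_injective _ hFi, Set.ncard_univ]

end action

section rank
variable {V E H : Type*} {a b : E → V} [Group H] [MulAction H V] [MulAction H E]

theorem not_isOfFinOrder [LinearOrder E] (hfree : ∀ (h : H) (e : E), h • e = e → h = 1)
    (hE : ∀ (h : H) (e e' : E), e ≤ e' → h • e ≤ h • e') (e : E) {h : H} (hh : h ≠ 1) :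
    ¬ IsOfFinOrder h := by
  have hA : ∀ k : H, e < k • e → ∀ n : ℕ, e < k ^ (n + 1) • e := by
    intro k hk n
    induction n with
    | zero => simpa using hk
    | succ n ih =>
      rw [pow_succ', mul_smul]
      exact lt_of_lt_of_le hk (hE k _ _ ih.le)
  have hB : ∀ k : H, e < k • e → ¬ IsOfFinOrder k := by
    intro k hk hf
    obtain ⟨n, hn, hkn⟩ := isOfFinOrder_iff_pow_eq_one.1 hf
    obtain ⟨m, rfl⟩ : ∃ m, n = m + 1 := ⟨n - 1, by omega⟩
    have := hA k hk m
    rw [hkn, one_smul] at this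
    exact lt_irrefl _ this
  rcases lt_trichotomy e (h • e) with hl | hl | hl
  · exact hB h hl
  · exact absurd (hfree h e hl.symm) hh
  · have := smul_Iio hE h⁻¹ (e) (h • e) hl
    rw [inv_smul_smul] at this
    intro hf
    exact hB h⁻¹ this hf.inv

theorem exists_smul_out (H : Type*) {V : Type*} [Group H] [MulAction H V] (x : V) :
    ∃ h : H, h • (Quotient.out (Quotient.mk'' x : MulAction.orbitRel.Quotient H V)) = x := by
  have h1 : (Quotient.mk'' x : MulAction.orbitRel.Quotient H V) =
      Quotient.mk'' (Quotient.out (Quotient.mk'' x : MulAction.orbitRel.Quotient H V)) :=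
    (Quotient.out_eq' _).symm
  rw [Quotient.eq''] at h1
  exact h1

/-- Coordinates on orbits of a free action. -/
theorem exists_coord (hfree : ∀ (h : H) (x : V), h • x = x → h = 1) :
    ∃ c : V → H, (∀ x, x = c x • (Quotient.out
        (Quotient.mk'' x : MulAction.orbitRel.Quotient H V))) ∧
      ∀ (h : H) x, c (h • x) = h * c x := by
  have hex : ∀ x : V, ∃ h : H, x = h • (Quotient.out
        (Quotient.mk'' x : MulAction.orbitRel.Quotient H V)) := by
    intro x
    obtain ⟨h, hh⟩ := exists_smul_out H x
    exact ⟨h, hh.symm⟩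
  choose c hc using hex
  refine ⟨c, hc, fun h x => ?_⟩
  have hq : (Quotient.mk'' (h • x) : MulAction.orbitRel.Quotient H V) = Quotient.mk'' x :=
    Quotient.sound' ⟨h, rfl⟩
  have h1 := hc (h • x)
  rw [hq] at h1
  have h2 := hc x
  have h3 : ((h * c x)⁻¹ * c (h • x)) • (Quotient.out
      (Quotient.mk'' x : MulAction.orbitRel.Quotient H V)) = (Quotient.out
      (Quotient.mk'' x : MulAction.orbitRel.Quotient H V)) := by
    rw [mul_smul, ← h1, inv_smul_eq_iff, mul_smul, ← h2]
  have := hfree _ _ h3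
  rw [inv_mul_eq_one] at this
  exact this.symm

theorem exists_vertex_order [LinearOrder E] (hG : IsFreeGraph H a b)
    (hE : ∀ (h : H) (e e' : E), e ≤ e' → h • e ≤ h • e') (e0 : E) :
    ∃ _ : LinearOrder V, ∀ (h : H) (x y : V), x ≤ y → h • x ≤ h • y := by
  classical
  obtain ⟨c, hc, hcs⟩ := exists_coord (V := V) hG.free
  let : LinearOrder (MulAction.orbitRel.Quotient H V) := IsWellOrder.linearOrder WellOrderingRel
  let f : V → (MulAction.orbitRel.Quotient H V) ×ₗ E := fun x =>
    toLex (Quotient.mk'' x, c x • e0)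
  have hf : Function.Injective f := by
    intro x y hxy
    have h1 : (Quotient.mk'' x : MulAction.orbitRel.Quotient H V) = Quotient.mk'' y :=
      congrArg (fun z => (ofLex z).1) hxy
    have h2 : c x • e0 = c y • e0 := congrArg (fun z => (ofLex z).2) hxy
    have h3 : c x = c y := by
      have : ((c y)⁻¹ * c x) • e0 = e0 := by rw [mul_smul, h2, inv_smul_smul]
      have := hG.freeE _ _ this
      rw [inv_mul_eq_one] at this
      exact this.symm
    rw [hc x, hc y, h1, h3]
  refine ⟨LinearOrder.lift' f hf, fun h x y hxy => ?_⟩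
  have hxy' : f x ≤ f y := hxy
  change f (h • x) ≤ f (h • y)
  rw [Prod.Lex.le_iff] at hxy' ⊢
  have hq : ∀ x : V, (ofLex (f (h • x))).1 = (ofLex (f x)).1 := fun x =>
    Quotient.sound' ⟨h, rfl⟩
  have hq2 : ∀ x : V, (ofLex (f (h • x))).2 = h • (ofLex (f x)).2 := fun x => by
    show c (h • x) • e0 = h • (c x • e0)
    rw [hcs, mul_smul]
  rw [hq, hq, hq2, hq2]
  rcases hxy' with h1 | ⟨h1, h2⟩
  · exact Or.inl h1
  · exact Or.inr ⟨h1, hE h _ _ h2⟩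

theorem infinite_vertices [LinearOrder E] (hG : IsFreeGraph H a b)
    (hE : ∀ (h : H) (e e' : E), e ≤ e' → h • e ≤ h • e') (e0 : E) [Nontrivial H] :
    Infinite V := by
  obtain ⟨h, hh⟩ := exists_ne (1 : H)
  have h1 := not_isOfFinOrder hG.freeE hE e0 hh
  refine Infinite.of_injective (fun n : ℤ => h ^ n • a e0) ?_
  intro m n hmn
  simp only at hmn
  have : ((h ^ n)⁻¹ * h ^ m) • a e0 = a e0 := by rw [mul_smul, hmn, inv_smul_smul]
  have := hG.free _ _ this
  rw [inv_mul_eq_one] at this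
  exact (injective_zpow_iff_not_isOfFinOrder.2 h1 this).symm

/-- Rank formula for a free group acting freely on a tree. -/
theorem rank_formula [Finite (MulAction.orbitRel.Quotient H E)]
    [Finite (MulAction.orbitRel.Quotient H V)]
    (hT : IsTreeLike a b) (hG : IsFreeGraph H a b) (x0 : V) (n : ℕ)
    (ε : FreeGroup (Fin n) ≃* H) :
    n + Nat.card (MulAction.orbitRel.Quotient H V) =
      Nat.card (MulAction.orbitRel.Quotient H E) + 1 := by
  classical
  let P : Submodule ℚ (V → ℚ) :=
    { carrier := {p | ∀ (h : H) (e : E), p (b (h • e)) - p (a (h • e)) = p (b e) - p (a e)}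
      add_mem' := by
        intro p q hp hq h e
        have h1 := hp h e
        have h2 := hq h e
        simp only [Pi.add_apply]
        linarith
      zero_mem' := by intro h e; simp
      smul_mem' := by
        intro c p hp h e
        have h1 := hp h e
        simp only [Pi.smul_apply, smul_eq_mul]
        rw [← mul_sub, ← mul_sub, h1] }
  have hPmem : ∀ p : P, ∀ (h : H) (e : E),
      p.1 (b (h • e)) - p.1 (a (h • e)) = p.1 (b e) - p.1 (a e) := fun p => p.2
  -- first coordinates
  let L1 : P →ₗ[ℚ] ((MulAction.orbitRel.Quotient H E → ℚ) × ℚ) :=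
    { toFun := fun p => (fun o => p.1 (b o.out) - p.1 (a o.out), p.1 x0)
      map_add' := by
        intro p q
        refine Prod.ext ?_ ?_
        · funext o
          simp only [Submodule.coe_add, Pi.add_apply, Prod.fst_add]
          ring
        · simp
      map_smul' := by
        intro c p
        refine Prod.ext ?_ ?_
        · funext o
          simp [mul_sub]
        · simp }
  have hL1 : Function.Bijective L1 := by
    constructor
    · rw [← LinearMap.ker_eq_bot, LinearMap.ker_eq_bot']
      intro p hp
      have h1 : ∀ o : MulAction.orbitRel.Quotient H E, p.1 (b o.out) - p.1 (a o.out) = 0 :=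
        fun o => congrFun (congrArg Prod.fst hp) o
      have h2 : p.1 x0 = 0 := congrArg Prod.snd hp
      have h3 : ∀ e, p.1 (a e) = p.1 (b e) := by
        intro e
        obtain ⟨h, hh⟩ := exists_smul_out H e
        have h4 := hPmem p h (Quotient.out
            (Quotient.mk'' e : MulAction.orbitRel.Quotient H E))
        rw [hh, h1] at h4
        linarith
      ext x
      rw [hT.conn p.1 h3 x x0, h2]
      rfl
    · rintro ⟨φ, c⟩
      obtain ⟨p, hp⟩ := hT.int (fun e => φ (Quotient.mk'' e))
      refine ⟨⟨fun x => p x - p x0 + c, ?_⟩, ?_⟩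
      · intro h e
        have h1 := hp (h • e)
        have h2 := hp e
        have : (Quotient.mk'' (h • e) : MulAction.orbitRel.Quotient H E) = Quotient.mk'' e :=
          Quotient.sound' ⟨h, rfl⟩
        simp only [this] at h1
        linarith
      · refine Prod.ext ?_ ?_
        · funext o
          have := hp o.out
          rw [Quotient.out_eq'] at this
          show (p (b o.out) - p x0 + c) - (p (a o.out) - p x0 + c) = φ o
          linarith
        · show p x0 - p x0 + c = c
          ring
  have hcst : ∀ (p : P) (h : H) (x y : V), p.1 (h • x) - p.1 x = p.1 (h • y) - p.1 y := by
    intro p h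
    refine hT.conn (fun x => p.1 (h • x) - p.1 x) (fun e => ?_)
    have := hPmem p h e
    rw [hG.ha, hG.hb] at this
    linarith
  let L2 : P →ₗ[ℚ] ((Fin n → ℚ) × (MulAction.orbitRel.Quotient H V → ℚ)) :=
    { toFun := fun p => (fun i => p.1 (ε (FreeGroup.of i) • x0) - p.1 x0, fun o => p.1 o.out)
      map_add' := by
        intro p q
        refine Prod.ext ?_ ?_
        · funext o
          simp only [Submodule.coe_add, Pi.add_apply, Prod.fst_add]
          ring
        · rfl
      map_smul' := by
        intro c p
        refine Prod.ext ?_ ?_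
        · funext o
          simp [mul_sub]
        · rfl }
  have hL2 : Function.Bijective L2 := by
    constructor
    · rw [← LinearMap.ker_eq_bot, LinearMap.ker_eq_bot']
      intro p hp
      have h1 : ∀ i, p.1 (ε (FreeGroup.of i) • x0) - p.1 x0 = 0 :=
        fun o => congrFun (congrArg Prod.fst hp) o
      have h2 : ∀ o : MulAction.orbitRel.Quotient H V, p.1 o.out = 0 :=
        fun o => congrFun (congrArg Prod.snd hp) o
      have h3 : ∀ w : FreeGroup (Fin n), ∀ x, p.1 (ε w • x) = p.1 x := by
        intro w
        induction w using FreeGroup.induction_on with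
        | C1 => intro x; simp
        | of i =>
          intro x
          have := hcst p (ε (FreeGroup.of i)) x x0
          rw [h1] at this
          linarith
        | inv_of i ih =>
          intro x
          have := ih (ε (FreeGroup.of i)⁻¹ • x)
          rw [← mul_smul, ← map_mul, mul_inv_cancel, map_one, one_smul] at this
          exact this.symm
        | mul u v hu hv =>
          intro x
          rw [map_mul, mul_smul, hu, hv]
      ext x
      obtain ⟨h, hh⟩ := exists_smul_out H x
      rw [← hh]
      obtain ⟨w, rfl⟩ := ε.surjective h
      rw [h3, h2]
      rfl
    · rintro ⟨c, w⟩
      let χ0 : FreeGroup (Fin n) →* Multiplicative ℚ :=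
        FreeGroup.lift (fun i => Multiplicative.ofAdd (c i))
      let χ : H → ℚ := fun h => Multiplicative.toAdd (χ0 (ε.symm h))
      have hχ : ∀ h k, χ (h * k) = χ h + χ k := by intro h k; simp [χ]
      obtain ⟨cd, hcd, hcds⟩ := exists_coord (V := V) hG.free
      let p : V → ℚ := fun x => χ (cd x) + w (Quotient.mk'' x)
      have hq : ∀ (h : H) (x : V),
          (Quotient.mk'' (h • x) : MulAction.orbitRel.Quotient H V) = Quotient.mk'' x :=
        fun h x => Quotient.sound' ⟨h, rfl⟩
      have hps : ∀ h x, p (h • x) = χ h + p x := by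
        intro h x
        simp only [p, hcds, hχ, hq]
        ring
      refine ⟨⟨p, ?_⟩, ?_⟩
      · intro h e
        rw [hG.ha, hG.hb, hps, hps]
        ring
      · refine Prod.ext ?_ ?_
        · funext i
          show p (ε (FreeGroup.of i) • x0) - p x0 = c i
          rw [hps]
          simp [χ, χ0]
        · funext o
          show p o.out = w o
          have h1 := hcd o.out
          have h2 : (Quotient.mk'' o.out : MulAction.orbitRel.Quotient H V) = o :=
            Quotient.out_eq' o
          rw [h2] at h1
          have h3 : cd o.out = 1 := hG.free _ _ h1.symm
          have h4 : χ 1 = 0 := by simp [χ]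
          simp only [p, h3, h2, h4, zero_add]
  let := Fintype.ofFinite (MulAction.orbitRel.Quotient H E)
  let := Fintype.ofFinite (MulAction.orbitRel.Quotient H V)
  have e1 := (LinearEquiv.ofBijective L1 hL1).finrank_eq
  have e2 := (LinearEquiv.ofBijective L2 hL2).finrank_eq
  rw [e1] at e2
  simp only [Module.finrank_prod, Module.finrank_fintype_fun_eq_card, Module.finrank_self,
    Fintype.card_fin] at e2
  rw [Nat.card_eq_fintype_card, Nat.card_eq_fintype_card]
  exact e2.symm

theorem card_bridgeOrbits [LinearOrder E] [Nontrivial H] [Nonempty E]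
    [Finite (MulAction.orbitRel.Quotient H E)]
    (hT : IsTreeLike a b) (hG : IsFreeGraph H a b)
    (hE : ∀ (h : H) (e e' : E), e ≤ e' → h • e ≤ h • e')
    (hend : ∀ x : V, ∃ e, a e = x ∨ b e = x) (n : ℕ)
    (ε : FreeGroup (Fin n) ≃* H) :
    (BridgeOrbits H a b).ncard + 1 = n := by
  obtain ⟨e0⟩ := ‹Nonempty E›
  have : Finite (MulAction.orbitRel.Quotient H V) := by
    refine Finite.of_surjective (α := MulAction.orbitRel.Quotient H E × Bool)
      (fun q => Quotient.mk'' (if q.2 then a q.1.out else b q.1.out)) ?_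
    intro o
    induction o using Quotient.inductionOn'
    rename_i x
    obtain ⟨e, he⟩ := hend x
    obtain ⟨h, hh⟩ := exists_smul_out H e
    rcases he with rfl | rfl
    · refine ⟨(Quotient.mk'' e, true), ?_⟩
      refine Eq.symm (Quotient.sound' ⟨h, ?_⟩)
      simp only [if_true]
      rw [← hG.ha, hh]
    · refine ⟨(Quotient.mk'' e, false), ?_⟩
      refine Eq.symm (Quotient.sound' ⟨h, ?_⟩)
      simp only [Bool.false_eq_true, if_false]
      rw [← hG.hb, hh]
  have := infinite_vertices hG hE e0
  obtain ⟨_, hV⟩ := exists_vertex_order hG hE e0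
  have h1 := card_bridgeOrbits_aux hT hG hE hV
  have h2 := rank_formula hT hG (a e0) n ε
  omega

end rank

section ambient
variable {F V E : Type*} {a b : E → V} [Group F] [MulAction F V] [MulAction F E]

/-- An `H`-invariant, connected, nonempty, `H`-cofinite set of edges. -/
structure IsGood (a b : E → V) (H : Subgroup F) (X : Set E) : Prop where
  inv : ∀ h ∈ H, ∀ e ∈ X, h • e ∈ X
  conn : ∀ p : V → ℚ, (∀ e ∈ X, p (a e) = p (b e)) → ∀ e ∈ X, ∀ e' ∈ X, p (a e) = p (a e')
  ne : X.Nonempty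
  fin : ∃ P : Set E, P.Finite ∧ ∀ e ∈ X, ∃ e' ∈ P, ∃ h ∈ H, h • e' = e

/-- Bridges of the subgraph with edge set `X`. -/
def BridgeIn [LinearOrder E] (a b : E → V) (X : Set E) (e : E) : Prop :=
  (Comp a b (X ∩ Set.Iio e) (a e)).Infinite ∧ (Comp a b (X ∩ Set.Iio e) (b e)).Infinite

theorem good_core [LinearOrder E] (hT : IsTreeLike a b)
    (ha : ∀ (h : F) (e : E), a (h • e) = h • a e) (hb : ∀ (h : F) (e : E), b (h • e) = h • b e)
    (hE : ∀ (h : F) (e e' : E), e ≤ e' → h • e ≤ h • e')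
    (H : Subgroup F) (hH : ∀ h ∈ H, ∀ x : V, h • x = x → h = 1) (hn : H ≠ ⊥)
    (X : Set E) (hX : IsGood a b H X) (n : ℕ) (ε : FreeGroup (Fin n) ≃* H) :
    ∃ R : Finset E, R.card + 1 = n ∧ (∀ e ∈ R, e ∈ X ∧ BridgeIn a b X e) ∧
      (∀ e ∈ X, BridgeIn a b X e → ∃ e' ∈ R, ∃ h ∈ H, h • e' = e) ∧
      (∀ e ∈ R, ∀ e' ∈ R, (∃ h ∈ H, h • e' = e) → e = e') := by
  classical
  let Y : SubMulAction H E := ⟨X, fun h e he => hX.inv h.1 h.2 e he⟩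
  let W : SubMulAction H V := ⟨{x | ∃ e ∈ X, a e = x ∨ b e = x}, by
    rintro h x ⟨e, he, hx⟩
    refine ⟨h.1 • e, hX.inv h.1 h.2 e he, ?_⟩
    rw [ha, hb]
    exact hx.imp (fun t => by rw [t]; rfl) (fun t => by rw [t]; rfl)⟩
  let a' : Y → W := fun e => ⟨a e.1, e.1, e.2, Or.inl rfl⟩
  let b' : Y → W := fun e => ⟨b e.1, e.1, e.2, Or.inr rfl⟩
  have hG : IsFreeGraph H a' b' :=
    { ha := fun h e => Subtype.ext (ha h.1 e.1)
      hb := fun h e => Subtype.ext (hb h.1 e.1)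
      free := fun h x hx => Subtype.ext (hH h.1 h.2 x.1 (congrArg Subtype.val hx)) }
  have hT' : IsTreeLike a' b' := by
    constructor
    · intro φ
      obtain ⟨p, hp⟩ := hT.int (fun e => if he : e ∈ X then φ ⟨e, he⟩ else 0)
      refine ⟨fun x => p x.1, fun e => ?_⟩
      have := hp e.1
      rw [dif_pos (show e.1 ∈ X from e.2)] at this
      exact this
    · intro p hp
      have h1 := hX.conn (fun x => if hx : x ∈ W then p ⟨x, hx⟩ else 0) (by
        intro e he
        have k1 : a e ∈ W := ⟨e, he, Or.inl rfl⟩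
        have k2 : b e ∈ W := ⟨e, he, Or.inr rfl⟩
        simp only [k1, k2, dif_pos]
        exact hp ⟨e, he⟩)
      have h2 : ∀ e e' : Y, p (a' e) = p (a' e') := by
        intro e e'
        have := h1 e.1 e.2 e'.1 e'.2
        have k1 : a e.1 ∈ W := ⟨e.1, e.2, Or.inl rfl⟩
        have k2 : a e'.1 ∈ W := ⟨e'.1, e'.2, Or.inl rfl⟩
        simp only [k1, k2, dif_pos] at this
        exact this
      have h3 : ∀ x : W, ∃ e : Y, p x = p (a' e) := by
        rintro ⟨x, e, he, rfl | rfl⟩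
        · exact ⟨⟨e, he⟩, rfl⟩
        · exact ⟨⟨e, he⟩, (hp ⟨e, he⟩).symm⟩
      intro x y
      obtain ⟨e, he⟩ := h3 x
      obtain ⟨e', he'⟩ := h3 y
      rw [he, he', h2]
  have hE' : ∀ (h : H) (e e' : Y), e ≤ e' → h • e ≤ h • e' := fun h e e' hl => hE h.1 e.1 e'.1 hl
  have hend : ∀ x : W, ∃ e : Y, a' e = x ∨ b' e = x := by
    rintro ⟨x, e, he, hx⟩
    exact ⟨⟨e, he⟩, hx.imp (fun t => Subtype.ext t) (fun t => Subtype.ext t)⟩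
  have hmk : ∀ {e e' : Y}, (Quotient.mk'' e : MulAction.orbitRel.Quotient H Y) = Quotient.mk'' e' ↔
      ∃ h ∈ H, h • e'.1 = e.1 := by
    intro e e'
    rw [Quotient.eq'']
    constructor
    · rintro ⟨h, hh⟩
      exact ⟨h.1, h.2, congrArg Subtype.val hh⟩
    · rintro ⟨h, h1, hh⟩
      exact ⟨⟨h, h1⟩, Subtype.ext hh⟩
  have : Nontrivial H := (Subgroup.nontrivial_iff_ne_bot H).2 hn
  have : Nonempty Y := hX.ne.to_subtype
  have : Finite (MulAction.orbitRel.Quotient H Y) := by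
    obtain ⟨P, hP, hPX⟩ := hX.fin
    have := hP.to_subtype
    choose f hf g hg hgf using fun o : MulAction.orbitRel.Quotient H Y => hPX o.out.1 o.out.2
    refine Finite.of_injective (fun o => (⟨f o, hf o⟩ : P)) ?_
    intro o o' hoo
    have h1 : f o = f o' := congrArg Subtype.val hoo
    have h2 : (Quotient.mk'' o.out : MulAction.orbitRel.Quotient H Y) = Quotient.mk'' o'.out := by
      refine hmk.2 ⟨g o * (g o')⁻¹, H.mul_mem (hg o) (H.inv_mem (hg o')), ?_⟩
      rw [mul_smul, ← hgf o', inv_smul_smul, ← h1, hgf]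
    rwa [Quotient.out_eq', Quotient.out_eq'] at h2
  have hcard := card_bridgeOrbits hT' hG hE' hend n ε
  -- comparison of bridges
  have hr : ∀ (e : Y) (x y : V), Reach a b (X ∩ Set.Iio e.1) x y →
      x = y ∨ ∃ (hx : x ∈ W) (hy : y ∈ W), Reach a' b' (Set.Iio e) ⟨x, hx⟩ ⟨y, hy⟩ := by
    intro e x y hxy
    refine hxy.rec' (fun x y => x = y ∨ ∃ (hx : x ∈ W) (hy : y ∈ W),
      Reach a' b' (Set.Iio e) ⟨x, hx⟩ ⟨y, hy⟩) ⟨fun _ => Or.inl rfl, ?_, ?_⟩ ?_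
    · rintro x y (rfl | ⟨hx, hy, h⟩)
      · exact Or.inl rfl
      · exact Or.inr ⟨hy, hx, h.symm⟩
    · rintro x y z (rfl | ⟨hx, hy, h⟩) (rfl | ⟨hy', hz, h'⟩)
      · exact Or.inl rfl
      · exact Or.inr ⟨hy', hz, h'⟩
      · exact Or.inr ⟨hx, hy, h⟩
      · exact Or.inr ⟨hx, hz, h.trans h'⟩
    · rintro e' ⟨he', hlt⟩
      refine Or.inr ⟨⟨e', he', Or.inl rfl⟩, ⟨e', he', Or.inr rfl⟩, ?_⟩
      exact Reach.edge (e := (⟨e', he'⟩ : Y)) hlt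
  have hcomp : ∀ (e : Y) (x : W), (Comp a b (X ∩ Set.Iio e.1) x.1).Infinite ↔
      (Comp a' b' (Set.Iio e) x).Infinite := by
    intro e x
    constructor
    · intro h hf
      refine h ((hf.image Subtype.val).subset ?_)
      intro y hy
      rcases hr e _ _ hy with h1 | ⟨h1, h2, h3⟩
      · exact ⟨x, Comp.self _ _, h1⟩
      · exact ⟨⟨y, h2⟩, h3, rfl⟩
    · intro h
      exact Comp.infinite_map (a' := a) (b' := b) (S := Set.Iio e) (S' := X ∩ Set.Iio e.1)
        (Subtype.val : W → V) (Subtype.val : Y → E)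
        Subtype.val_injective (fun _ => rfl) (fun _ => rfl) (fun e' he' => ⟨e'.2, he'⟩) h
  have hbr : ∀ e : Y, BridgeIn a b X e.1 ↔ Bridge a' b' e := fun e =>
    and_congr (hcomp e (a' e)) (hcomp e (b' e))
  choose g hg hgo using fun o : BridgeOrbits H a' b' => o.2
  have hgi : Function.Injective (fun o => (g o).1) := by
    intro o o' hoo
    have : g o = g o' := Subtype.ext hoo
    apply Subtype.ext
    rw [← hgo o, ← hgo o', this]
  have hfinr : (Set.range (fun o => (g o).1)).Finite := Set.finite_range _
  refine ⟨hfinr.toFinset, ?_, ?_, ?_, ?_⟩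
  · rw [← Set.ncard_eq_toFinset_card _ hfinr, ← Set.image_univ,
      Set.ncard_image_of_injective _ hgi, Set.ncard_univ]
    exact hcard
  · intro e he
    rw [Set.Finite.mem_toFinset] at he
    obtain ⟨o, rfl⟩ := he
    exact ⟨(g o).2, (hbr _).2 (hg o)⟩
  · intro e he hbe
    have hB : Bridge a' b' (⟨e, he⟩ : Y) := (hbr (⟨e, he⟩ : Y)).1 hbe
    let o : BridgeOrbits H a' b' := ⟨Quotient.mk'' (⟨e, he⟩ : Y), ⟨(⟨e, he⟩ : Y), hB, rfl⟩⟩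
    refine ⟨(g o).1, by rw [Set.Finite.mem_toFinset]; exact ⟨o, rfl⟩, ?_⟩
    exact hmk.1 (hgo o).symm
  · intro e he e' he' hee
    rw [Set.Finite.mem_toFinset] at he he'
    obtain ⟨o, rfl⟩ := he
    obtain ⟨o', rfl⟩ := he'
    have := hmk.2 hee
    have h1 : o = o' := by
      apply Subtype.ext
      rw [← hgo o, ← hgo o']
      exact this
    rw [h1]

theorem IsGood.conj (ha : ∀ (h : F) (e : E), a (h • e) = h • a e)
    (hb : ∀ (h : F) (e : E), b (h • e) = h • b e) {H : Subgroup F} {X : Set E}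
    (hX : IsGood a b H X) (s : F) : IsGood a b (conjSubgroup s H) {e | s⁻¹ • e ∈ X} := by
  constructor
  · rintro _ ⟨h, hh, rfl⟩ e he
    show s⁻¹ • (s * h * s⁻¹) • e ∈ X
    have : s⁻¹ • (s * h * s⁻¹) • e = h • s⁻¹ • e := by simp [mul_smul]
    rw [this]
    exact hX.inv h hh _ he
  · intro p hp e he e' he'
    have := hX.conn (fun x => p (s • x)) (by
      intro e he
      have := hp (s • e) (by show s⁻¹ • s • e ∈ X; rwa [inv_smul_smul])
      rwa [ha, hb] at this) _ he _ he'
    simpa only [← ha, smul_inv_smul] using this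
  · obtain ⟨e, he⟩ := hX.ne
    exact ⟨s • e, by show s⁻¹ • s • e ∈ X; rwa [inv_smul_smul]⟩
  · obtain ⟨P, hP, hPX⟩ := hX.fin
    refine ⟨(fun e => s • e) '' P, hP.image _, ?_⟩
    intro e he
    obtain ⟨e', he', h, hh, hhe⟩ := hPX _ he
    refine ⟨s • e', ⟨e', he', rfl⟩, s * h * s⁻¹, ⟨h, hh, rfl⟩, ?_⟩
    rw [mul_smul, mul_smul, inv_smul_smul, hhe, smul_inv_smul]

theorem inter_nonempty [LinearOrder E] (hT : IsTreeLike a b)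
    (ha : ∀ (h : F) (e : E), a (h • e) = h • a e) (hb : ∀ (h : F) (e : E), b (h • e) = h • b e)
    (hE : ∀ (h : F) (e e' : E), e ≤ e' → h • e ≤ h • e')
    (hFE : ∀ (h : F) (e : E), h • e = e → h = 1)
    {A B : Subgroup F} (hA : ∀ h ∈ A, ∀ x : V, h • x = x → h = 1)
    {X Y : Set E} (hX : IsGood a b A X) (hY : IsGood a b B Y) (hn : A ⊓ B ≠ ⊥) :
    (X ∩ Y).Nonempty := by
  classical
  by_contra hemp
  obtain ⟨k, hk, hk1⟩ : ∃ k ∈ A ⊓ B, k ≠ 1 := by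
    by_contra hc
    push Not at hc
    exact hn ((Subgroup.eq_bot_iff_forall _).2 hc)
  obtain ⟨x0, hx0⟩ := hX.ne
  obtain ⟨y0, hy0⟩ := hY.ne
  have hord := not_isOfFinOrder hFE hE x0 hk1
  -- a function increasing by one along k
  obtain ⟨q, hq⟩ : ∃ q : V → ℚ, ∀ x, q (k • x) = q x + 1 := by
    obtain ⟨c, hc, hcs⟩ := exists_coord (V := V) (H := Subgroup.zpowers k) (by
      intro h x hx
      exact Subtype.ext (hA h.1 ((Subgroup.zpowers_le.2 hk.1) h.2) x hx))
    choose m hm using fun h : Subgroup.zpowers k => Subgroup.mem_zpowers_iff.1 h.2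
    refine ⟨fun x => (m (c x) : ℚ), fun x => ?_⟩
    have h1 := hcs ⟨k, Subgroup.mem_zpowers k⟩ x
    have h2 : k ^ (m (c (k • x))) = k ^ (1 + m (c x)) := by
      rw [hm, zpow_add, hm, zpow_one]
      exact congrArg Subtype.val h1
    have h3 := injective_zpow_iff_not_isOfFinOrder.2 hord h2
    show ((m (c (k • x)) : ℤ) : ℚ) = _
    rw [h3]
    push_cast
    ring
  obtain ⟨p, hp⟩ := hT.int (fun e => if e ∈ X then q (b e) - q (a e) else 0)
  have hXk : ∀ e, k • e ∈ X ↔ e ∈ X := by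
    intro e
    refine ⟨fun h => ?_, hX.inv k hk.1 e⟩
    have := hX.inv k⁻¹ (A.inv_mem hk.1) _ h
    rwa [inv_smul_smul] at this
  have hc := hT.conn (fun x => p (k • x) - p x) (fun e => by
    have h1 := hp (k • e)
    have h2 := hp e
    simp only [hXk, ha, hb, hq] at h1
    split_ifs at h1 h2 <;> linarith) (a x0) (a y0)
  have h1 := hX.conn (fun x => p x - q x) (fun e he => by
    have := hp e
    rw [if_pos he] at this
    linarith) _ (hX.inv k hk.1 _ hx0) _ hx0
  have h2 := hY.conn p (fun e he => by
    have := hp e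
    rw [if_neg (fun h => hemp ⟨e, h, he⟩)] at this
    linarith) _ (hY.inv k hk.2 _ hy0) _ hy0
  simp only [ha, hq] at h1 h2 hc
  linarith

theorem IsGood.inter [LinearOrder E] (hT : IsTreeLike a b)
    (ha : ∀ (h : F) (e : E), a (h • e) = h • a e) (hb : ∀ (h : F) (e : E), b (h • e) = h • b e)
    (hE : ∀ (h : F) (e e' : E), e ≤ e' → h • e ≤ h • e')
    (hFE : ∀ (h : F) (e : E), h • e = e → h = 1)
    {A B : Subgroup F} (hA : ∀ h ∈ A, ∀ x : V, h • x = x → h = 1)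
    {X Y : Set E} (hX : IsGood a b A X) (hY : IsGood a b B Y) (hn : A ⊓ B ≠ ⊥) :
    IsGood a b (A ⊓ B) (X ∩ Y) := by
  classical
  constructor
  · rintro h ⟨h1, h2⟩ e ⟨he1, he2⟩
    exact ⟨hX.inv h h1 e he1, hY.inv h h2 e he2⟩
  · intro c hc e he e' he'
    let q : V → ℚ := fun x => if ∃ e ∈ X ∩ Y, a e = x ∨ b e = x then c x else 0
    have hqa : ∀ e ∈ X ∩ Y, q (a e) = c (a e) := fun e he => if_pos ⟨e, he, Or.inl rfl⟩
    have hqb : ∀ e ∈ X ∩ Y, q (b e) = c (b e) := fun e he => if_pos ⟨e, he, Or.inr rfl⟩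
    obtain ⟨p, hp⟩ := hT.int (fun e => if e ∈ X then q (b e) - q (a e) else 0)
    have h1 := hX.conn (fun x => p x - q x) (fun e he => by
      have := hp e
      rw [if_pos he] at this
      linarith) _ he.1 _ he'.1
    have h2 := hY.conn p (fun e he => by
      have := hp e
      split_ifs at this with hx
      · rw [hqa e ⟨hx, he⟩, hqb e ⟨hx, he⟩, hc e ⟨hx, he⟩] at this
        linarith
      · linarith) _ he.2 _ he'.2
    simp only [hqa e he, hqa e' he'] at h1
    linarith
  · exact inter_nonempty hT ha hb hE hFE hA hX hY hn
  · obtain ⟨P, hP, hPX⟩ := hX.fin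
    obtain ⟨Q, hQ, hQY⟩ := hY.fin
    have hs : ∀ z : E × E, ∃ e0 : E, ∀ e ∈ X ∩ Y, (∃ h ∈ A, h • z.1 = e) → (∃ h ∈ B, h • z.2 = e) →
        ∃ h ∈ A ⊓ B, h • e0 = e := by
      intro z
      by_cases hz : ∃ e0 ∈ X ∩ Y, (∃ h ∈ A, h • z.1 = e0) ∧ (∃ h ∈ B, h • z.2 = e0)
      · obtain ⟨e0, -, ⟨h, hh, hhe⟩, ⟨k, hk, hke⟩⟩ := hz
        refine ⟨e0, ?_⟩
        rintro e - ⟨h', hh', hhe'⟩ ⟨k', hk', hke'⟩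
        have e1 : (h' * h⁻¹) • e0 = e := by rw [← hhe, mul_smul, inv_smul_smul, hhe']
        have e2 : (k' * k⁻¹) • e0 = e := by rw [← hke, mul_smul, inv_smul_smul, hke']
        have e3 : ((k' * k⁻¹)⁻¹ * (h' * h⁻¹)) • e0 = e0 := by
          rw [mul_smul, e1, ← e2, inv_smul_smul]
        have e4 := hFE _ _ e3
        rw [inv_mul_eq_one] at e4
        refine ⟨h' * h⁻¹, ⟨A.mul_mem hh' (A.inv_mem hh), ?_⟩, e1⟩
        rw [← e4]
        exact B.mul_mem hk' (B.inv_mem hk)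
      · exact ⟨z.1, fun e he h1 h2 => absurd ⟨e, he, h1, h2⟩ hz⟩
    choose f hf using hs
    refine ⟨f '' (P ×ˢ Q), (hP.prod hQ).image f, ?_⟩
    intro e he
    obtain ⟨p, hp, hpe⟩ := hPX e he.1
    obtain ⟨q, hq, hqe⟩ := hQY e he.2
    exact ⟨f (p, q), ⟨(p, q), ⟨hp, hq⟩, rfl⟩, hf (p, q) e he hpe hqe⟩

theorem exists_good (hT : IsTreeLike a b)
    (ha : ∀ (h : F) (e : E), a (h • e) = h • a e) (hb : ∀ (h : F) (e : E), b (h • e) = h • b e)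
    (H : Subgroup F) (e0 : E) (n : ℕ) (ε : FreeGroup (Fin n) ≃* H) :
    ∃ X : Set E, IsGood a b H X := by
  choose P hPf hPr hPe using fun i : Fin n =>
    (hT.reach (a e0) ((ε (FreeGroup.of i) : F) • a e0)).finite_support
  let Q : Set E := {e0} ∪ ⋃ i, P i
  have hQf : Q.Finite := (Set.finite_singleton e0).union (Set.finite_iUnion hPf)
  let X : Set E := {e | ∃ e' ∈ Q, ∃ h ∈ H, h • e' = e}
  have hinv : ∀ h ∈ H, ∀ e ∈ X, h • e ∈ X := by
    rintro h hh _ ⟨e', he', k, hk, rfl⟩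
    exact ⟨e', he', h * k, H.mul_mem hh hk, mul_smul _ _ _⟩
  have hQX : Q ⊆ X := fun e he => ⟨e, he, 1, H.one_mem, one_smul _ _⟩
  have hPX : ∀ i, P i ⊆ X := fun i e he => hQX (Or.inr (Set.mem_iUnion.2 ⟨i, he⟩))
  have hsm : ∀ h ∈ H, ∀ x y, Reach a b X x y → Reach a b X (h • x) (h • y) := fun h hh x y hr =>
    hr.map (fun x => h • x) (fun e => h • e) (ha h) (hb h) (hinv h hh)
  have hgen : ∀ w : FreeGroup (Fin n), Reach a b X (a e0) ((ε w : F) • a e0) := by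
    intro w
    induction w using FreeGroup.induction_on with
    | C1 => simpa using Reach.refl X (a e0)
    | of i => exact (hPr i).mono (hPX i)
    | inv_of i ih =>
      have := hsm _ (ε (FreeGroup.of i)⁻¹).2 _ _ ih
      rw [← mul_smul, ← Subgroup.coe_mul, ← map_mul, inv_mul_cancel, map_one, Subgroup.coe_one,
        one_smul] at this
      exact this.symm
    | mul u v hu hv =>
      rw [map_mul, Subgroup.coe_mul, mul_smul]
      exact hu.trans (hsm _ (ε u).2 _ _ hv)
  have hall : ∀ e ∈ X, Reach a b X (a e0) (a e) := by
    rintro _ ⟨e, he, h, hh, rfl⟩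
    have h1 : Reach a b X (a e0) (a e) := by
      rcases he with rfl | he
      · exact Reach.refl _ _
      · obtain ⟨i, hi⟩ := Set.mem_iUnion.1 he
        exact (hPe i e hi).mono (hPX i)
    have h2 := hgen (ε.symm ⟨h, hh⟩)
    rw [MulEquiv.apply_symm_apply] at h2
    rw [ha]
    exact h2.trans (hsm h hh _ _ h1)
  refine ⟨X, hinv, ?_, ⟨e0, hQX (Or.inl rfl)⟩, Q, hQf, fun e he => he⟩
  intro p hp e he e' he'
  exact ((hall e he).symm.trans (hall e' he')).const p hp

end ambient

section main
variable {F V E : Type*} {a b : E → V} [Group F] [MulAction F V] [MulAction F E]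

theorem BridgeIn.smul [LinearOrder E]
    (ha : ∀ (h : F) (e : E), a (h • e) = h • a e) (hb : ∀ (h : F) (e : E), b (h • e) = h • b e)
    (hE : ∀ (h : F) (e e' : E), e ≤ e' → h • e ≤ h • e') {X Y : Set E} (h : F)
    (hXY : ∀ e ∈ X, h • e ∈ Y) {e : E} (hk : BridgeIn a b X e) : BridgeIn a b Y (h • e) := by
  have hS : ∀ e' ∈ X ∩ Set.Iio e, h • e' ∈ Y ∩ Set.Iio (h • e) := fun e' he' =>
    ⟨hXY e' he'.1, smul_Iio hE h e e' he'.2⟩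
  constructor
  · rw [ha]
    exact Comp.infinite_map (fun x => h • x) (fun e => h • e) (MulAction.injective h)
      (ha h) (hb h) hS hk.1
  · rw [hb]
    exact Comp.infinite_map (fun x => h • x) (fun e => h • e) (MulAction.injective h)
      (ha h) (hb h) hS hk.2

theorem sameDoset_of_edges (hFE : ∀ (h : F) (e : E), h • e = e → h = 1)
    {H₁ H₂ : Subgroup F} {s s' : F} {e e' r₁ r₂ : E}
    (h1 : ∃ h ∈ H₁, h • r₁ = e) (h1' : ∃ h ∈ H₁, h • r₁ = e')
    (h2 : ∃ h ∈ H₂, h • r₂ = s⁻¹ • e) (h2' : ∃ h ∈ H₂, h • r₂ = s'⁻¹ • e') :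
    ∃ u ∈ H₁, ∃ v ∈ H₂, s' = u * s * v ∧ u • e = e' := by
  obtain ⟨u, hu, rfl⟩ := h1
  obtain ⟨u', hu', rfl⟩ := h1'
  obtain ⟨v, hv, hve⟩ := h2
  obtain ⟨v', hv', hve'⟩ := h2'
  have e1 : r₂ = (v⁻¹ * s⁻¹ * u) • r₁ := by
    rw [mul_smul, mul_smul, ← hve, inv_smul_smul]
  have e2 : r₂ = (v'⁻¹ * s'⁻¹ * u') • r₁ := by
    rw [mul_smul, mul_smul, ← hve', inv_smul_smul]
  have e3 : ((v⁻¹ * s⁻¹ * u)⁻¹ * (v'⁻¹ * s'⁻¹ * u')) • r₁ = r₁ := by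
    rw [mul_smul, ← e2, e1, inv_smul_smul]
  have e4 := hFE _ _ e3
  rw [inv_mul_eq_one] at e4
  refine ⟨u' * u⁻¹, H₁.mul_mem hu' (H₁.inv_mem hu), v * v'⁻¹, H₂.mul_mem hv (H₂.inv_mem hv'),
    ?_, ?_⟩
  · have : s' = u' * (v'⁻¹ * s'⁻¹ * u')⁻¹ * v'⁻¹ := by group
    rw [this, ← e4]
    group
  · rw [mul_smul, inv_smul_smul]

theorem sameDoset_ne_bot {H₁ H₂ : Subgroup F} {s t : F} (h : SameDoset H₁ H₂ s t)
    (ht : H₁ ⊓ conjSubgroup t H₂ ≠ ⊥) : H₁ ⊓ conjSubgroup s H₂ ≠ ⊥ := by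
  obtain ⟨u, hu, v, hv, rfl⟩ := h
  intro hb
  apply ht
  rw [Subgroup.eq_bot_iff_forall] at hb ⊢
  rintro x ⟨hx1, y, hy, rfl⟩
  have := hb (u⁻¹ * (u * s * v * y * (u * s * v)⁻¹) * u) ⟨H₁.mul_mem (H₁.mul_mem (H₁.inv_mem hu) hx1) hu,
    v * y * v⁻¹, H₂.mul_mem (H₂.mul_mem hv hy) (H₂.inv_mem hv), by
      show s * (v * y * v⁻¹) * s⁻¹ = _
      group⟩
  show u * s * v * y * (u * s * v)⁻¹ = 1
  calc u * s * v * y * (u * s * v)⁻¹ = u * (u⁻¹ * (u * s * v * y * (u * s * v)⁻¹) * u) * u⁻¹ := by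
        group
    _ = 1 := by rw [this]; group

theorem SameDoset.symm' {H₁ H₂ : Subgroup F} {s t : F} (h : SameDoset H₁ H₂ s t) :
    SameDoset H₁ H₂ t s := by
  obtain ⟨u, hu, v, hv, rfl⟩ := h
  exact ⟨u⁻¹, H₁.inv_mem hu, v⁻¹, H₂.inv_mem hv, by group⟩

theorem SameDoset.trans' {H₁ H₂ : Subgroup F} {s t r : F} (h : SameDoset H₁ H₂ s t)
    (h' : SameDoset H₁ H₂ t r) : SameDoset H₁ H₂ s r := by
  obtain ⟨u, hu, v, hv, rfl⟩ := h
  obtain ⟨u', hu', v', hv', rfl⟩ := h'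
  exact ⟨u' * u, H₁.mul_mem hu' hu, v * v', H₂.mul_mem hv hv', by group⟩

theorem main_abs [LinearOrder E] [Nonempty E] (hT : IsTreeLike a b)
    (ha : ∀ (h : F) (e : E), a (h • e) = h • a e) (hb : ∀ (h : F) (e : E), b (h • e) = h • b e)
    (hE : ∀ (h : F) (e e' : E), e ≤ e' → h • e ≤ h • e')
    (hFE : ∀ (h : F) (e : E), h • e = e → h = 1)
    (H₁ H₂ : Subgroup F) (hf₁ : ∀ h ∈ H₁, ∀ x : V, h • x = x → h = 1)
    (hf₂ : ∀ h ∈ H₂, ∀ x : V, h • x = x → h = 1)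
    (r₁ r₂ : ℕ) (e₁ : FreeGroup (Fin r₁) ≃* H₁) (e₂ : FreeGroup (Fin r₂) ≃* H₂) :
    (∃ S : Set F, S.Finite ∧ IsDosetTransversal H₁ H₂ S) ∧
    (∀ S : Finset F, IsDosetTransversal H₁ H₂ ↑S →
      ∀ n : F → ℕ,
        (∀ s ∈ S, Nonempty (FreeGroup (Fin (n s)) ≃* ↥(H₁ ⊓ conjSubgroup s H₂))) →
        ∑ s ∈ S, (n s - 1) ≤ (r₁ - 1) * (r₂ - 1)) := by
  classical
  obtain ⟨e0⟩ := ‹Nonempty E›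
  obtain ⟨X, hX⟩ := exists_good hT ha hb H₁ e0 r₁ e₁
  obtain ⟨Y, hY⟩ := exists_good hT ha hb H₂ e0 r₂ e₂
  have hYs := fun s => hY.conj ha hb s
  constructor
  · let st : Setoid F := ⟨SameDoset H₁ H₂, fun x => ⟨1, H₁.one_mem, 1, H₂.one_mem, by simp⟩,
      SameDoset.symm', SameDoset.trans'⟩
    let rep : F → F := fun t => Quotient.out (Quotient.mk st t)
    have hrep : ∀ t, SameDoset H₁ H₂ (rep t) t := fun t => Quotient.mk_out (s := st) t
    have hrep' : ∀ s t, SameDoset H₁ H₂ s t → rep s = rep t := fun s t h => by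
      show Quotient.out _ = Quotient.out _
      rw [Quotient.sound (s := st) h]
    refine ⟨rep '' {t | H₁ ⊓ conjSubgroup t H₂ ≠ ⊥}, ?_, ?_, ?_, ?_⟩
    · obtain ⟨P, hP, hPX⟩ := hX.fin
      obtain ⟨Q, hQ, hQY⟩ := hY.fin
      have key : ∀ t : {t | H₁ ⊓ conjSubgroup t H₂ ≠ ⊥}, ∃ z : E × E, z ∈ P ×ˢ Q ∧
          ∃ e, (∃ h ∈ H₁, h • z.1 = e) ∧ (∃ h ∈ H₂, h • z.2 = t.1⁻¹ • e) := by
        rintro ⟨t, ht⟩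
        obtain ⟨e, he1, he2⟩ := inter_nonempty hT ha hb hE hFE hf₁ hX (hYs t) ht
        obtain ⟨p, hp, hpe⟩ := hPX e he1
        obtain ⟨q, hq, hqe⟩ := hQY _ he2
        exact ⟨(p, q), ⟨hp, hq⟩, e, hpe, hqe⟩
      choose z hz ez hz1 hz2 using key
      rw [Set.image_eq_range]
      refine Set.Finite.subset ((hP.prod hQ).image
        (fun w => if hw : ∃ t, z t = w then rep hw.choose.1 else 1)) ?_
      rintro _ ⟨t, rfl⟩
      refine ⟨z t, hz t, ?_⟩
      have hw : ∃ t', z t' = z t := ⟨t, rfl⟩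
      simp only
      rw [dif_pos hw]
      have hc := hw.choose_spec
      refine hrep' _ _ ?_
      have k1 := hz1 hw.choose
      have k2 := hz2 hw.choose
      rw [hc] at k1 k2
      obtain ⟨u, hu, v, hv, huv, -⟩ := sameDoset_of_edges hFE k1 (hz1 t) k2 (hz2 t)
      exact ⟨u, hu, v, hv, huv⟩
    · rintro _ ⟨t, ht, rfl⟩
      exact sameDoset_ne_bot (hrep t) ht
    · rintro _ ⟨t, ht, rfl⟩ _ ⟨t', ht', rfl⟩ h
      exact hrep' _ _ (SameDoset.trans' (SameDoset.trans' (SameDoset.symm' (hrep t)) h) (hrep t'))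
    · intro t ht
      exact ⟨rep t, ⟨t, ht, rfl⟩, hrep t⟩
  · intro S hS n hn
    rcases S.eq_empty_or_nonempty with rfl | ⟨s0, hs0⟩
    · simp
    have hb₁ : H₁ ≠ ⊥ := by
      rintro rfl
      exact hS.1 s0 hs0 (by simp)
    have hb₂ : H₂ ≠ ⊥ := by
      rintro rfl
      exact hS.1 s0 hs0 (by simp [conjSubgroup])
    obtain ⟨R₁, hc₁, hR₁, hR₁', -⟩ := good_core hT ha hb hE H₁ hf₁ hb₁ X hX r₁ e₁
    obtain ⟨R₂, hc₂, hR₂, hR₂', -⟩ := good_core hT ha hb hE H₂ hf₂ hb₂ Y hY r₂ e₂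
    have hR : ∀ s : F, ∃ R : Finset E, s ∈ S → R.card + 1 = n s ∧
        (∀ e ∈ R, e ∈ X ∩ {e | s⁻¹ • e ∈ Y} ∧ BridgeIn a b (X ∩ {e | s⁻¹ • e ∈ Y}) e) ∧
        (∀ e ∈ R, ∀ e' ∈ R, (∃ h ∈ H₁ ⊓ conjSubgroup s H₂, h • e' = e) → e = e') := by
      intro s
      by_cases hs : s ∈ S
      · obtain ⟨ε⟩ := hn s hs
        have hbs := hS.1 s hs
        have hg := IsGood.inter hT ha hb hE hFE hf₁ hX (hYs s) hbs
        obtain ⟨R, h1, h2, -, h3⟩ := good_core hT ha hb hE (H₁ ⊓ conjSubgroup s H₂)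
          (fun h hh x hx => hf₁ h hh.1 x hx) hbs _ hg (n s) ε
        exact ⟨R, fun _ => ⟨h1, h2, h3⟩⟩
      · exact ⟨∅, fun h => absurd h hs⟩
    choose R hR using hR
    have hsum : ∑ s ∈ S, (n s - 1) = (S.sigma R).card := by
      rw [Finset.card_sigma]
      refine Finset.sum_congr rfl fun s hs => ?_
      have := (hR s hs).1
      omega
    have hprod : (r₁ - 1) * (r₂ - 1) = (R₁ ×ˢ R₂).card := by
      rw [Finset.card_product, ← hc₁, ← hc₂]
      simp
    rw [hsum, hprod]
    have key : ∀ z : (Σ _ : F, E), ∃ w : E × E, z ∈ S.sigma R → w ∈ R₁ ×ˢ R₂ ∧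
        (∃ h ∈ H₁, h • w.1 = z.2) ∧ (∃ h ∈ H₂, h • w.2 = z.1⁻¹ • z.2) := by
      rintro ⟨s, e⟩
      by_cases hz : (⟨s, e⟩ : Σ _ : F, E) ∈ S.sigma R
      · obtain ⟨hs, he⟩ := Finset.mem_sigma.1 hz
        obtain ⟨⟨heX, heY⟩, hbr⟩ := (hR s hs).2.1 e he
        have b1 : BridgeIn a b X e := by
          have := hbr.smul ha hb hE (Y := X) 1 (fun e he => by rw [one_smul]; exact he.1)
          rwa [one_smul] at this
        have b2 : BridgeIn a b Y (s⁻¹ • e) := hbr.smul ha hb hE s⁻¹ (fun e he => he.2)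
        obtain ⟨w1, hw1, hw1'⟩ := hR₁' e heX b1
        obtain ⟨w2, hw2, hw2'⟩ := hR₂' _ heY b2
        exact ⟨(w1, w2), fun _ => ⟨Finset.mem_product.2 ⟨hw1, hw2⟩, hw1', hw2'⟩⟩
      · exact ⟨(e, e), fun h => absurd h hz⟩
    choose f hf using key
    refine Finset.card_le_card_of_injOn f (fun z hz => (hf z hz).1) ?_
    rintro ⟨s, e⟩ hz ⟨s', e'⟩ hz' hff
    obtain ⟨-, h1, h2⟩ := hf _ hz
    obtain ⟨-, h1', h2'⟩ := hf _ hz'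
    rw [← hff] at h1' h2'
    obtain ⟨u, hu, v, hv, huv, hue⟩ := sameDoset_of_edges hFE h1 h1' h2 h2'
    obtain ⟨hs, he⟩ := Finset.mem_sigma.1 hz
    obtain ⟨hs', he'⟩ := Finset.mem_sigma.1 hz'
    simp only at hs he hs' he' huv hue
    have hss : s = s' := hS.2.1 s hs s' hs' ⟨u, hu, v, hv, huv⟩
    subst hss
    have hee : e' = e := by
      refine (hR s hs).2.2 e' he' e he ⟨u, ⟨hu, v⁻¹, H₂.inv_mem hv, ?_⟩, hue⟩
      show s * v⁻¹ * s⁻¹ = u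
      have : u = s * v⁻¹ * s⁻¹ := by
        rw [eq_mul_inv_iff_mul_eq, eq_mul_inv_iff_mul_eq]
        exact huv.symm
      exact this.symm
    rw [hee]

end main

section order
variable {I : Type*} {G : I → Type*} [∀ i, Group (G i)] [∀ i, LinearOrder (G i)] [LinearOrder I]

/-- sign of a group element -/
def sg {A : Type*} [Group A] [LinearOrder A] (g : A) : ℤ :=
  if 1 < g then 1 else if g < 1 then -1 else 0

/-- sign of a jump between indices -/
def jmp {I : Type*} [LinearOrder I] : Option I → Option I → ℤ
  | some p, some q => if p < q then 1 else if q < p then -1 else 0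
  | _, _ => 0

/-- first index -/
def hdi {I : Type*} {G : I → Type*} : List (Σ i, G i) → Option I
  | [] => none
  | x :: _ => some x.1

/-- the Dicks–Sunic weight -/
def tau : List (Σ i, G i) → ℤ
  | [] => 0
  | x :: l => sg x.2 + jmp (some x.1) (hdi l) + tau l

/-- reduced lists -/
def Red : List (Σ i, G i) → Prop
  | [] => True
  | x :: l => x.2 ≠ 1 ∧ some x.1 ≠ hdi l ∧ Red l

/-- product of a list -/
def lprod : List (Σ i, G i) → CoprodI G
  | [] => 1
  | x :: l => CoprodI.of x.2 * lprod l

/-- reverse-invert the first list and append the second -/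
def ra : List (Σ i, G i) → List (Σ i, G i) → List (Σ i, G i)
  | [], l => l
  | x :: k, l => ra k (⟨x.1, x.2⁻¹⟩ :: l)

theorem hdi_cons (x : Σ i, G i) (l : List (Σ i, G i)) : hdi (x :: l) = some x.1 := rfl

theorem jmp_antisymm (p q : Option I) : jmp p q = - jmp q p := by
  rcases p with _ | p <;> rcases q with _ | q <;> simp only [jmp, neg_zero]
  rcases lt_trichotomy p q with h | h | h
  · simp [h, h.not_gt]
  · simp [h]
  · simp [h, h.not_gt]

theorem jmp_abs (p q : Option I) : |jmp p q| ≤ 1 := by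
  rcases p with _ | p <;> rcases q with _ | q <;> simp only [jmp] <;> (try split_ifs) <;> simp

theorem jmp_odd {p q : I} (h : p ≠ q) : Odd (jmp (some p) (some q)) := by
  rcases lt_or_gt_of_ne h with h | h
  · simp [jmp, h]
  · simp [jmp, h, h.not_gt]

theorem jmp_tri (i : I) (p q : Option I) (hpq : p ≠ q) (hp : some i ≠ p) (hq : some i ≠ q) :
    |jmp p q - jmp (some i) q + jmp (some i) p| ≤ 1 := by
  rcases p with _ | p <;> rcases q with _ | q
  · simp at hpq
  · simp only [jmp]
    split_ifs <;> simp
  · simp only [jmp]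
    split_ifs <;> simp
  · have h1 : p ≠ q := fun h => hpq (by rw [h])
    have h2 : i ≠ p := fun h => hp (by rw [h])
    have h3 : i ≠ q := fun h => hq (by rw [h])
    simp only [jmp]
    rcases lt_or_gt_of_ne h1 with h1 | h1 <;> rcases lt_or_gt_of_ne h2 with h2 | h2 <;>
      rcases lt_or_gt_of_ne h3 with h3 | h3 <;>
      simp [h1, h2, h3, h1.not_gt, h2.not_gt, h3.not_gt]
    · exact absurd (h3.trans h2) h1.not_gt
    · exact absurd (h2.trans h3) h1.not_gt

section sg
variable {A : Type*} [Group A] [LinearOrder A] [CovariantClass A A (· * ·) (· ≤ ·)]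

theorem mul_lt' {a b : A} (c : A) (h : a < b) : c * a < c * b :=
  lt_of_le_of_ne (CovariantClass.elim c h.le) (fun h' => h.ne (mul_left_cancel h'))

theorem sg_diff_lt {g h : A} (hl : g < h) : sg (g⁻¹ * h) = 1 := by
  have := mul_lt' g⁻¹ hl
  rw [inv_mul_cancel] at this
  simp [sg, this]

theorem sg_diff_gt {g h : A} (hl : h < g) : sg (g⁻¹ * h) = -1 := by
  have := mul_lt' g⁻¹ hl
  rw [inv_mul_cancel] at this
  simp [sg, this, this.not_gt]

theorem sg_inv (g : A) : sg g⁻¹ = - sg g := by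
  rcases lt_trichotomy 1 g with h | h | h
  · have := sg_diff_gt h
    rw [mul_one] at this
    rw [this]
    simp [sg, h]
  · simp [← h, sg]
  · have := sg_diff_lt h
    rw [mul_one] at this
    rw [this]
    simp [sg, h, h.not_gt]

theorem sg_odd {g : A} (h : g ≠ 1) : Odd (sg g) := by
  rcases lt_or_gt_of_ne h with h | h
  · simp [sg, h, h.not_gt]
  · simp [sg, h]

theorem sg_bd (g : A) : -1 ≤ sg g ∧ sg g ≤ 1 := by
  unfold sg
  split_ifs <;> simp

theorem sg_mono {g h : A} (hl : g < h) : sg g ≤ sg h := by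
  rcases lt_trichotomy 1 g with h2 | h2 | h2
  · simp [sg, h2, h2.trans hl]
  · subst h2
    simp [sg, hl]
  · have : sg g = -1 := by simp [sg, h2, h2.not_gt]
    rw [this]
    exact (sg_bd h).1

theorem sg_tri (g h : A) : |sg (g⁻¹ * h) - sg h + sg g| ≤ 1 := by
  have b1 := sg_bd g
  have b2 := sg_bd h
  rw [abs_le]
  rcases lt_trichotomy g h with h1 | h1 | h1
  · rw [sg_diff_lt h1]
    have := sg_mono h1
    omega
  · rw [h1, inv_mul_cancel]
    simp [sg]
  · rw [sg_diff_gt h1]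
    have := sg_mono h1
    omega
end sg

variable [∀ i, CovariantClass (G i) (G i) (· * ·) (· ≤ ·)]

theorem tau_ra (k l : List (Σ i, G i)) : tau (ra k l) = jmp (hdi k) (hdi l) + tau l - tau k := by
  induction k generalizing l with
  | nil => simp [ra, tau, hdi, jmp]
  | cons x k ih =>
    rw [ra, ih]
    simp only [tau, hdi_cons, sg_inv]
    rw [jmp_antisymm (hdi k)]
    ring

theorem lprod_ra (k l : List (Σ i, G i)) : lprod (ra k l) = (lprod k)⁻¹ * lprod l := by
  induction k generalizing l with
  | nil => simp [ra, lprod]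
  | cons x k ih =>
    rw [ra, ih]
    simp only [lprod, map_inv]
    group

theorem red_ra (k l : List (Σ i, G i)) (hk : Red k) (hl : Red l)
    (h : hdi k = none ∨ hdi k ≠ hdi l) : Red (ra k l) := by
  induction k generalizing l with
  | nil => exact hl
  | cons x k ih =>
    rw [ra]
    refine ih _ hk.2.2 ⟨inv_ne_one.2 hk.1, ?_, hl⟩ ?_
    · simpa [hdi] using h
    · right
      exact hk.2.1.symm

theorem tau_odd (l : List (Σ i, G i)) (hl : Red l) (h : l ≠ []) : Odd (tau l) := by
  induction l with
  | nil => exact absurd rfl h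
  | cons x l ih =>
    rcases l with _ | ⟨y, l⟩
    · simpa [tau, hdi, jmp] using sg_odd hl.1
    · have h1 := ih hl.2.2 (by simp)
      have h2 : Odd (jmp (some x.1) (some y.1)) := jmp_odd (fun h => hl.2.1 (by rw [h]; rfl))
      have h3 := sg_odd hl.1
      rw [tau]
      exact (h3.add_odd h2).add_odd h1

theorem tau_main (k l : List (Σ i, G i)) (hk : Red k) (hl : Red l) :
    ∃ m, Red m ∧ lprod m = (lprod k)⁻¹ * lprod l ∧ |tau m - tau l + tau k| ≤ 1 := by
  induction k generalizing l with
  | nil => exact ⟨l, hl, by simp [lprod], by simp [tau]⟩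
  | cons x k ih =>
    by_cases hx : hdi (x :: k) = hdi l
    · rcases l with _ | ⟨y, l⟩
      · simp [hdi] at hx
      · obtain ⟨i, g⟩ := x
        obtain ⟨i', h⟩ := y
        have : i = i' := by simpa [hdi] using hx
        subst this
        by_cases hgh : g = h
        · subst hgh
          by_cases hkl : hdi k = hdi l
          · obtain ⟨m, h1, h2, h3⟩ := ih l hk.2.2 hl.2.2
            refine ⟨m, h1, ?_, ?_⟩
            · rw [h2]
              simp only [lprod]
              group
            · simp only [tau, hkl]
              convert h3 using 2
              ring
          · refine ⟨ra k l, red_ra _ _ hk.2.2 hl.2.2 (Or.inr hkl), ?_, ?_⟩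
            · rw [lprod_ra]
              simp only [lprod]
              group
            · rw [tau_ra]
              simp only [tau]
              convert jmp_tri i (hdi k) (hdi l) hkl hk.2.1 hl.2.1 using 2
              ring
        · refine ⟨ra k (⟨i, g⁻¹ * h⟩ :: l), red_ra _ _ hk.2.2 ⟨?_, hl.2.1, hl.2.2⟩
            (Or.inr hk.2.1.symm), ?_, ?_⟩
          · simpa [inv_mul_eq_one] using hgh
          · rw [lprod_ra]
            simp only [lprod, map_mul, map_inv]
            group
          · rw [tau_ra]
            simp only [tau, hdi_cons]
            convert sg_tri g h using 2
            rw [jmp_antisymm (hdi k)]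
            ring
    · refine ⟨ra (x :: k) l, red_ra _ _ hk hl (Or.inr hx), lprod_ra _ _, ?_⟩
      rw [tau_ra]
      convert jmp_abs (hdi (x :: k)) (hdi l) using 2
      ring

theorem red_word (w : CoprodI.Word G) : Red w.toList ∧ lprod w.toList = w.prod := by
  obtain ⟨l, h1, h2⟩ := w
  simp only [CoprodI.Word.prod]
  induction l with
  | nil => exact ⟨trivial, rfl⟩
  | cons x l ih =>
    obtain ⟨h3, h4⟩ := ih (fun l hl => h1 l (List.mem_cons_of_mem _ hl)) h2.tail
    refine ⟨⟨h1 x (by simp), ?_, h3⟩, ?_⟩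
    · rcases l with _ | ⟨y, l⟩
      · simp [hdi]
      · simp at h2
        simpa [hdi] using h2.1
    · simp [lprod, h4]

theorem word_red (l : List (Σ i, G i)) (hl : Red l) : ∃ w : CoprodI.Word G, w.toList = l := by
  refine ⟨⟨l, ?_, ?_⟩, rfl⟩
  · induction l with
    | nil => simp
    | cons x l ih =>
      intro y hy
      rcases List.mem_cons.1 hy with rfl | hy
      · exact hl.1
      · exact ih hl.2.2 y hy
  · induction l with
    | nil => simp
    | cons x l ih =>
      rcases l with _ | ⟨y, l⟩
      · simp
      · have := ih hl.2.2
        have h := hl.2.1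
        simp only [List.isChain_cons_cons]
        exact ⟨fun h' => h (by rw [h']; rfl), this⟩

open Classical in
/-- the weight on the free product -/
noncomputable def tauF (f : CoprodI G) : ℤ := tau (CoprodI.Word.equiv f).toList

theorem tauF_lprod (l : List (Σ i, G i)) (hl : Red l) : tauF (lprod l) = tau l := by
  classical
  obtain ⟨w, rfl⟩ := word_red l hl
  rw [(red_word w).2]
  unfold tauF
  congr 2
  exact CoprodI.Word.equiv.apply_symm_apply w

theorem exists_red (f : CoprodI G) : ∃ l, Red l ∧ lprod l = f := by
  classical
  refine ⟨_, (red_word (CoprodI.Word.equiv f)).1, ?_⟩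
  rw [(red_word _).2]
  exact CoprodI.Word.equiv.symm_apply_apply f

theorem tauF_main (x y : CoprodI G) : |tauF (x⁻¹ * y) - tauF y + tauF x| ≤ 1 := by
  obtain ⟨k, hk, rfl⟩ := exists_red x
  obtain ⟨l, hl, rfl⟩ := exists_red y
  obtain ⟨m, hm, h1, h2⟩ := tau_main k l hk hl
  rw [← h1, tauF_lprod _ hk, tauF_lprod _ hl, tauF_lprod _ hm]
  exact h2

theorem tauF_one : tauF (1 : CoprodI G) = 0 := tauF_lprod [] trivial

theorem tauF_odd (x : CoprodI G) (hx : x ≠ 1) : Odd (tauF x) := by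
  obtain ⟨k, hk, rfl⟩ := exists_red x
  rw [tauF_lprod _ hk]
  refine tau_odd _ hk ?_
  rintro rfl
  exact hx rfl

theorem tauF_inv (x : CoprodI G) : tauF x⁻¹ = - tauF x := by
  by_cases hx : x = 1
  · simp [hx, tauF_one]
  · have h := tauF_main x 1
    rw [mul_one, tauF_one, abs_le] at h
    obtain ⟨a, ha⟩ := tauF_odd x hx
    obtain ⟨b, hb⟩ := tauF_odd x⁻¹ (inv_ne_one.2 hx)
    omega

open Classical in
/-- the left order on the free product -/
@[reducible] noncomputable def ordF : LinearOrder (CoprodI G) where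
  le x y := x = y ∨ 0 < tauF (x⁻¹ * y)
  le_refl x := Or.inl rfl
  le_trans x y z := by
    rintro (rfl | h1) (rfl | h2)
    · exact Or.inl rfl
    · exact Or.inr h2
    · exact Or.inr h1
    · right
      have h := tauF_main (y⁻¹ * x) (y⁻¹ * z)
      have e1 : (y⁻¹ * x)⁻¹ * (y⁻¹ * z) = x⁻¹ * z := by group
      have e2 := tauF_inv (y⁻¹ * x)
      rw [mul_inv_rev, inv_inv] at e2
      rw [e1, abs_le] at h
      by_cases hx : x = z
      · subst hx
        omega
      obtain ⟨a, ha⟩ := tauF_odd (x⁻¹ * z) (by simpa [inv_mul_eq_one] using hx)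
      omega
  le_antisymm x y := by
    rintro (rfl | h1) (h | h2)
    · rfl
    · rfl
    · exact h.symm
    · have e2 := tauF_inv (y⁻¹ * x)
      rw [mul_inv_rev, inv_inv] at e2
      omega
  le_total x y := by
    by_cases hx : x = y
    · exact Or.inl (Or.inl hx)
    obtain ⟨a, ha⟩ := tauF_odd (x⁻¹ * y) (by simpa [inv_mul_eq_one] using hx)
    have e2 := tauF_inv (y⁻¹ * x)
    rw [mul_inv_rev, inv_inv] at e2
    by_cases h : 0 < tauF (x⁻¹ * y)
    · exact Or.inl (Or.inr h)
    · refine Or.inr (Or.inr ?_)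
      omega
  toDecidableLE := Classical.decRel _

theorem ordF_mul (c x y : CoprodI G) (h : ordF.le x y) : ordF.le (c * x) (c * y) := by
  rcases h with rfl | h
  · exact Or.inl rfl
  · right
    have : (c * x)⁻¹ * (c * y) = x⁻¹ * y := by group
    rwa [this]

end order

section concrete
variable {I : Type*} {G : I → Type*} [∀ i, Group (G i)]

/-- edges of the Bass–Serre tree -/
def Edg {I : Type*} (G : I → Type*) [∀ i, Group (G i)] := CoprodI G × I

instance : MulAction (CoprodI G) (Edg G) where
  smul h e := (h * e.1, e.2)
  one_smul e := by
    show (1 * e.1, e.2) = e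
    rw [one_mul]
    rfl
  mul_smul x y e := by
    show (x * y * e.1, e.2) = (x * (y * e.1), e.2)
    rw [mul_assoc]

/-- vertices of the Bass–Serre tree -/
abbrev Vtx {I : Type*} (G : I → Type*) [∀ i, Group (G i)] :=
  CoprodI G ⊕ (Σ i, CoprodI G ⧸ (CoprodI.of (M := G) (i := i)).range)

/-- source -/
def src (e : Edg G) : Vtx G := Sum.inl e.1
/-- target -/
def tgt (e : Edg G) : Vtx G := Sum.inr ⟨e.2, QuotientGroup.mk e.1⟩

theorem exists_pot (φ : CoprodI G → I → ℚ) : ∃ p : CoprodI G → ℚ,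
    ∀ f i (g : G i), p (f * CoprodI.of g) + φ (f * CoprodI.of g) i = p f + φ f i := by
  let ρi : ∀ i, G i →* Function.End (CoprodI G × ℚ) := fun i =>
    { toFun := fun g z => (z.1 * (CoprodI.of g)⁻¹, z.2 + φ z.1 i - φ (z.1 * (CoprodI.of g)⁻¹) i)
      map_one' := by
        funext z
        show (_, _) = z
        simp
      map_mul' := fun g g' => by
        funext z
        show (_, _) = (_, _)
        simp [mul_assoc] }
  let ρ := CoprodI.lift ρi
  have h1 : ∀ x z, (ρ x z).1 = z.1 * x⁻¹ := by
    intro x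
    induction x using CoprodI.induction_on with
    | one =>
      intro z
      rw [map_one, inv_one, mul_one]
      rfl
    | of i g =>
      intro z
      show (CoprodI.lift ρi (CoprodI.of g) z).1 = _
      rw [CoprodI.lift_of]
      rfl
    | mul x y hx hy =>
      intro z
      rw [map_mul]
      show (ρ x (ρ y z)).1 = _
      rw [hx, hy, mul_inv_rev, mul_assoc]
  refine ⟨fun f => (ρ f⁻¹ (1, 0)).2, fun f i g => ?_⟩
  have h2 : ρ (f * CoprodI.of g)⁻¹ (1, 0) = ρi i g⁻¹ (ρ f⁻¹ (1, 0)) := by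
    rw [mul_inv_rev, map_mul, ← map_inv]
    show CoprodI.lift ρi (CoprodI.of g⁻¹) _ = _
    rw [CoprodI.lift_of]
  have h3 := h1 f⁻¹ (1, 0)
  simp only [inv_inv, one_mul] at h3
  simp only [h2]
  show (ρ f⁻¹ (1, 0)).2 + φ (ρ f⁻¹ (1, 0)).1 i -
    φ ((ρ f⁻¹ (1, 0)).1 * (CoprodI.of g⁻¹)⁻¹) i + _ = _
  have h4 : (CoprodI.of (M := G) g⁻¹)⁻¹ = CoprodI.of g := by rw [map_inv, inv_inv]
  rw [h3, h4]
  ring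

theorem isTreeLike [Nonempty I] : IsTreeLike (src (G := G)) tgt where
  int φ := by
    obtain ⟨p, hp⟩ := exists_pot (G := G) (fun f i => φ (f, i))
    refine ⟨Sum.elim p (fun z => Quotient.lift (s := QuotientGroup.leftRel _)
      (fun f => p f + φ (f, z.1)) ?_ z.2), ?_⟩
    · intro f f' h
      rw [← Quotient.eq_iff_equiv] at h
      have := QuotientGroup.eq.1 h
      obtain ⟨g, hg⟩ := this
      have e : f' = f * CoprodI.of g := by rw [hg]; group
      rw [e]
      exact (hp f z.1 g).symm
    · rintro ⟨f, i⟩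
      show p f + φ (f, i) - p f = φ (f, i)
      ring
  conn p hp := by
    have h1 : ∀ x f : CoprodI G, p (Sum.inl (f * x)) = p (Sum.inl f) := by
      intro x
      induction x using CoprodI.induction_on with
      | one => intro f; rw [mul_one]
      | of i g =>
        intro f
        have e1 := hp (f, i)
        have e2 := hp (f * CoprodI.of g, i)
        simp only [src, tgt] at e1 e2
        rw [e1, e2]
        congr 3
        refine QuotientGroup.eq.2 ⟨g⁻¹, ?_⟩
        rw [map_inv]
        group
      | mul x y hx hy =>
        intro f
        rw [← mul_assoc, hy, hx]
    have h2 : ∀ x, p x = p (Sum.inl 1) := by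
      rintro (f | ⟨i, z⟩)
      · rw [← h1 f 1, one_mul]
      · obtain ⟨f, rfl⟩ := QuotientGroup.mk_surjective z
        have := hp (f, i)
        simp only [src, tgt] at this
        rw [← this, ← h1 f 1, one_mul]
    intro x y
    rw [h2, h2 y]

theorem free_vtx {H : Subgroup (CoprodI G)} (hH : IsFactorFree H) :
    ∀ h ∈ H, ∀ x : Vtx G, h • x = x → h = 1 := by
  rintro h hh (f | ⟨i, z⟩) hx
  · have : h * f = f := Sum.inl.inj hx
    simpa using this
  · obtain ⟨f, rfl⟩ := QuotientGroup.mk_surjective z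
    have h1 : (⟨i, QuotientGroup.mk (h * f)⟩ :
        Σ i, CoprodI G ⧸ (CoprodI.of (M := G) (i := i)).range) = ⟨i, QuotientGroup.mk f⟩ :=
      Sum.inr.inj hx
    have h2 := eq_of_heq (Sigma.mk.inj h1).2
    obtain ⟨g, hg⟩ := QuotientGroup.eq.1 h2.symm
    have e : h = f * CoprodI.of g * f⁻¹ := by rw [hg]; group
    rw [e] at hh
    rw [e, hH f i g hh]
    simp

/-- Edge order: lexicographic. -/
@[reducible] noncomputable def ordE [∀ i, LinearOrder (G i)] [LinearOrder I]
    [∀ i, CovariantClass (G i) (G i) (· * ·) (· ≤ ·)] : LinearOrder (Edg G) :=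
  letI := ordF (G := G)
  inferInstanceAs (LinearOrder (CoprodI G ×ₗ I))

theorem ordE_smul [∀ i, LinearOrder (G i)] [LinearOrder I]
    [∀ i, CovariantClass (G i) (G i) (· * ·) (· ≤ ·)] (h : CoprodI G) (e e' : Edg G)
    (hee : ordE.le e e') : ordE.le (h • e) (h • e') := by
  let _ := ordF (G := G)
  have h1 := (Prod.Lex.le_iff (α := CoprodI G) (β := I) (x := e) (y := e')).1 hee
  refine (Prod.Lex.le_iff (α := CoprodI G) (β := I) (x := h • e) (y := h • e')).2 ?_
  show h * e.1 < h * e'.1 ∨ h * e.1 = h * e'.1 ∧ e.2 ≤ e'.2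
  rcases h1 with h1 | ⟨h1, h2⟩
  · have h1 : e.1 < e'.1 := h1
    left
    exact lt_of_le_of_ne (ordF_mul h _ _ h1.le) (fun h' => h1.ne (mul_left_cancel h'))
  · right
    have h1 : e.1 = e'.1 := h1
    exact ⟨by rw [h1], h2⟩

end concrete

end SHN

/-- Let `G_α`, `α ∈ I`, be nontrivial left ordered groups, `𝓕` their free product, and
`H₁`, `H₂` finitely generated factor-free subgroups of `𝓕` (free of ranks `r₁`, `r₂`).
Then there are only finitely many double cosets `H₁ t H₂` with `H₁ ∩ t H₂ t⁻¹ ≠ {1}`,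
and for any set `S` of representatives of these double cosets,
`Σ_{s ∈ S} r̄(H₁ ∩ s H₂ s⁻¹) ≤ r̄(H₁) ⬝ r̄(H₂)` (reduced ranks, natural subtraction). -/
theorem sum_reduced_rank_doset_le_of_leftOrdered
    {I : Type*} {G : I → Type*} [∀ i, Group (G i)] [∀ i, Nontrivial (G i)]
    [∀ i, LinearOrder (G i)]
    [∀ i, CovariantClass (G i) (G i) (· * ·) (· ≤ ·)]
    (H₁ H₂ : Subgroup (CoprodI G))
    (hff₁ : IsFactorFree H₁) (hff₂ : IsFactorFree H₂)
    (r₁ r₂ : ℕ)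
    (e₁ : FreeGroup (Fin r₁) ≃* H₁) (e₂ : FreeGroup (Fin r₂) ≃* H₂) :
    (∃ S : Set (CoprodI G), S.Finite ∧ IsDosetTransversal H₁ H₂ S) ∧
    (∀ S : Finset (CoprodI G), IsDosetTransversal H₁ H₂ ↑S →
      ∀ n : CoprodI G → ℕ,
        (∀ s ∈ S, Nonempty (FreeGroup (Fin (n s)) ≃* ↥(H₁ ⊓ conjSubgroup s H₂))) →
        ∑ s ∈ S, (n s - 1) ≤ (r₁ - 1) * (r₂ - 1)) := by
  classical
  rcases isEmpty_or_nonempty I with hI | hI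
  · have h1 : ∀ x : CoprodI G, x = 1 := by
      intro x
      induction x using CoprodI.induction_on with
      | one => rfl
      | of i g => exact (hI.false i).elim
      | mul x y hx hy => rw [hx, hy, mul_one]
    have h2 : ∀ s, H₁ ⊓ conjSubgroup s H₂ = ⊥ := fun s =>
      (Subgroup.eq_bot_iff_forall _).2 fun x _ => h1 x
    refine ⟨⟨∅, Set.finite_empty, by simp, by simp, fun t ht => absurd (h2 t) ht⟩, ?_⟩
    intro S hS n _
    have : S = ∅ := by
      rw [Finset.eq_empty_iff_forall_notMem]
      intro s hs
      exact hS.1 s hs (h2 s)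
    simp [this]
  · let _ : LinearOrder I := IsWellOrder.linearOrder WellOrderingRel
    let _ : LinearOrder (SHN.Edg G) := SHN.ordE
    have : Nonempty (SHN.Edg G) := hI.map fun i => ((1 : CoprodI G), i)
    refine SHN.main_abs (a := SHN.src (G := G)) (b := SHN.tgt) SHN.isTreeLike
      (fun h e => rfl) (fun h e => rfl) SHN.ordE_smul ?_ H₁ H₂
      (SHN.free_vtx hff₁) (SHN.free_vtx hff₂) r₁ r₂ e₁ e₂
    intro h e he
    have : h * e.1 = e.1 := congrArg Prod.fst he
    simpa using this
end

section
/- Let W be a cyclically reduced word in 𝓕. Then there exists a factorization W = W₁W₂ (with |W| = |W₁| + |W₂|) such that the cyclic permutation W₂W₁ of W is either strongly positive or strongly negative. -/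
open Monoid

variable {I : Type*} {G : I → Type*} [∀ i, Group (G i)]

/-- The element of the free product represented by a list of letters. -/
def listProd (l : List (Σ i, G i)) : CoprodI G :=
  (l.map fun p => CoprodI.of p.2).prod

/-- The formal inverse of a list of letters. -/
def invList (l : List (Σ i, G i)) : List (Σ i, G i) :=
  (l.map fun p => (⟨p.1, p.2⁻¹⟩ : Σ i, G i)).reverse

/-- A list of letters (of a reduced word) is *strongly positive* if every
nonempty suffix, viewed as an element of the free product, is `≻ 1`. -/
def StronglyPositiveList [LinearOrder (CoprodI G)] (l : List (Σ i, G i)) : Prop :=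
  ∀ j < l.length, 1 < listProd (l.drop j)

theorem listProd_append_aux {I : Type*} {G : I → Type*} [∀ i, Group (G i)]
    (l m : List (Σ i, G i)) : listProd (l ++ m) = listProd l * listProd m := by
  simp [listProd]

theorem listProd_invList_aux {I : Type*} {G : I → Type*} [∀ i, Group (G i)]
    (l : List (Σ i, G i)) : listProd (invList l) = (listProd l)⁻¹ := by
  induction l with
  | nil => simp [listProd, invList]
  | cons a l ih =>
    have h1 : invList (a :: l) = invList l ++ [(⟨a.1, a.2⁻¹⟩ : Σ i, G i)] := by
      simp [invList]
    have h2 : listProd (a :: l) = CoprodI.of a.2 * listProd l := by simp [listProd]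
    rw [h1, listProd_append_aux, ih, h2, mul_inv_rev]
    simp [listProd]

theorem listProd_ne_one_aux {I : Type*} {G : I → Type*} [∀ i, Group (G i)]
    (l : List (Σ i, G i)) (h1 : ∀ p ∈ l, p.2 ≠ 1)
    (h2 : l.IsChain (fun a b => a.1 ≠ b.1)) (hl : l ≠ []) : listProd l ≠ 1 := by
  classical
  intro h
  let w : CoprodI.Word G := ⟨l, fun p hp => h1 p hp, h2⟩
  have h3 : w.prod = (CoprodI.Word.empty : CoprodI.Word G).prod := by
    rw [CoprodI.Word.prod_empty]; exact h
  have h4 : w = CoprodI.Word.empty := CoprodI.Word.equiv.symm.injective h3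
  exact hl (congrArg CoprodI.Word.toList h4)

/-- Suppose `W` is a cyclically reduced word (`W` is nonempty and the types of its
first and last letters differ). Then there exists a factorization `W = W₁W₂` such
that the cyclic permutation `W₂W₁` of `W` is either strongly positive or strongly
negative. -/
theorem exists_cyclicPermutation_stronglyPositive_or_stronglyNegative
    {I : Type*} {G : I → Type*} [∀ i, Group (G i)] [∀ i, Nontrivial (G i)]
    [LinearOrder (CoprodI G)]
    [CovariantClass (CoprodI G) (CoprodI G) (· * ·) (· ≤ ·)]
    (W : CoprodI.Word G) (hne : W.toList ≠ [])
    (hcyc : (W.toList.head hne).1 ≠ (W.toList.getLast hne).1) :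
    ∃ l₁ l₂ : List (Σ i, G i),
      W.toList = l₁ ++ l₂ ∧
      (StronglyPositiveList (l₂ ++ l₁) ∨
        StronglyPositiveList (invList (l₂ ++ l₁))) := by
  classical
  obtain ⟨l, hl1, hl2⟩ := W
  simp only at hne hcyc ⊢
  set L := l ++ l with hL
  set k := l.length with hk
  have hk0 : 0 < k := List.length_pos_of_ne_nil hne
  have hLlen : L.length = k + k := by simp [hL, hk]
  have hchain : L.IsChain (fun a b => a.1 ≠ b.1) := by
    rw [hL, List.isChain_append]
    refine ⟨hl2, hl2, ?_⟩
    intro x hx y hy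
    rw [List.getLast?_eq_some_getLast hne] at hx
    rw [List.head?_eq_some_head hne] at hy
    simp only [Option.mem_def, Option.some.injEq] at hx hy
    subst hx hy
    exact hcyc.symm
  have hone : ∀ p ∈ L, p.2 ≠ 1 := by
    intro p hp
    rw [hL, List.mem_append, or_self] at hp
    exact hl1 p hp
  have hsplit : ∀ a b, a ≤ b →
      listProd (L.take b) = listProd (L.take a) * listProd ((L.take b).drop a) := by
    intro a b hab
    rw [← listProd_append_aux]
    congr 1
    conv_lhs => rw [← List.take_append_drop a (L.take b)]
    rw [List.take_take, min_eq_left hab]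
  have hdist : ∀ a b, a < b → b ≤ k + k → listProd (L.take a) ≠ listProd (L.take b) := by
    intro a b hab hb h
    have h1 := hsplit a b hab.le
    rw [← h] at h1
    refine listProd_ne_one_aux ((L.take b).drop a) ?_ ?_ ?_ (left_eq_mul.mp h1)
    · intro p hp
      exact hone p (List.mem_of_mem_take (List.mem_of_mem_drop hp))
    · exact (hchain.take b).drop a
    · apply List.ne_nil_of_length_pos
      simp only [List.length_drop, List.length_take]
      omega
  obtain ⟨n, hn, hmax⟩ := Finset.exists_max_image (Finset.range (k + k + 1))
    (fun n => listProd (L.take n)) ⟨0, by simp⟩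
  simp only [Finset.mem_range] at hn hmax
  have hlt : ∀ m, m ≤ k + k → m ≠ n → listProd (L.take m) < listProd (L.take n) := by
    intro m hm hmn
    refine lt_of_le_of_ne (hmax m (by omega)) ?_
    rcases lt_or_gt_of_ne hmn with h | h
    · exact hdist m n h (by omega)
    · exact (hdist n m h hm).symm
  have hmulle : ∀ c a b : CoprodI G, a ≤ b → c * a ≤ c * b := fun c a b h =>
    CovariantClass.elim c h
  have hpos : ∀ c d : CoprodI G, c < c * d → 1 < d := by
    intro c d h
    by_contra h'
    have := hmulle c d 1 (not_lt.mp h')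
    rw [mul_one] at this
    exact absurd h (not_lt.mpr this)
  rcases le_total k n with hkn | hkn
  · obtain ⟨m, rfl⟩ := Nat.exists_eq_add_of_le hkn
    have hC : (L.take (k + m)).drop m = l.drop m ++ l.take m := by
      rw [hL, hk, List.take_length_add_append, List.drop_append_of_le_length (by omega)]
    refine ⟨l.take m, l.drop m, (List.take_append_drop m l).symm, Or.inl ?_⟩
    intro j hj
    have hj' : j < k := by
      simp only [List.length_append, List.length_drop, List.length_take] at hj
      omega
    rw [← hC, List.drop_drop]
    apply hpos (listProd (L.take (m + j)))
    rw [← hsplit _ _ (by omega)]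
    exact hlt _ (by omega) (by omega)
  · refine ⟨l.take n, l.drop n, (List.take_append_drop n l).symm, Or.inr ?_⟩
    have hC : (L.take (k + n)).drop n = l.drop n ++ l.take n := by
      rw [hL, hk, List.take_length_add_append, List.drop_append_of_le_length (by omega)]
    intro j hj
    have hlen : (l.drop n ++ l.take n).length = k := by
      simp only [List.length_append, List.length_drop, List.length_take]
      omega
    have hj' : j < k := by
      simpa only [invList, List.length_reverse, List.length_map, hlen] using hj
    have hdrop : (invList (l.drop n ++ l.take n)).drop j
        = invList ((L.take (n + (k - j))).drop n) := by
      have h1 : (L.take (n + (k - j))).drop n = (l.drop n ++ l.take n).take (k - j) := by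
        rw [← hC, List.take_drop, List.take_take]
        congr 2
        omega
      rw [h1]
      unfold invList
      rw [List.drop_reverse, List.length_map, hlen, List.map_take]
    rw [hdrop, listProd_invList_aux]
    apply hpos (listProd (L.take (n + (k - j))))
    rw [hsplit n (n + (k - j)) (by omega), mul_inv_cancel_right, ← hsplit _ _ (by omega)]
    exact hlt _ (by omega) (by omega)
end
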